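/- Let 1 < q < p < ∞. There exists a constant c > 0 (depending only on p, q and φ₀) such that for every finite set A of nonnegative integers with #A ≥ 2 there exist a finite set E of Haar indices with HF(E) ⊆ A and a nonzero Schwartz function f : ℝ → ℂ with ‖P_E f‖_{F^{−1+1/q}_{p,q}} ≥ c · (log₂ #A)^{1−1/q} · Ž(A)^{1/q} · ‖f‖_{F^{−1+1/q}_{p,q}}, where Ž(A) = min_{n ∈ A} #{ j ∈ A : |j − n| ≤ log₂ #A }. -/

import Mathlib

open MeasureTheory Real FourierTransform
open scoped ENNReal

noncomputable section

def haarFn (j : ℕ) (μ : ℤ) : ℝ → ℂ := fun x =>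
  (Set.Ico ((2:ℝ)^(-(j:ℤ)) * μ) ((2:ℝ)^(-(j:ℤ)) * (μ + 1/2))).indicator (fun _ => (1:ℂ)) x
  - (Set.Ico ((2:ℝ)^(-(j:ℤ)) * (μ + 1/2)) ((2:ℝ)^(-(j:ℤ)) * (μ + 1))).indicator (fun _ => (1:ℂ)) x

def haarProj (E : Finset (ℕ × ℤ)) (f : ℝ → ℂ) : ℝ → ℂ := fun x =>
  ∑ e ∈ E, (2:ℂ)^e.1 * (∫ y : ℝ, f y * haarFn e.1 e.2 y) * haarFn e.1 e.2 x

def HFset (E : Finset (ℕ × ℤ)) : Finset ℕ := E.image Prod.fst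

def conv (f g : ℝ → ℂ) : ℝ → ℂ := fun x => ∫ t : ℝ, f t * g (x - t)

def LPop (φ₀ : ℝ → ℂ) (k : ℕ) (g : ℝ → ℂ) : ℝ → ℂ :=
  if k = 0 then conv g (𝓕⁻ φ₀)
  else conv g (fun x => (2:ℂ)^k * (𝓕⁻ (fun ξ => φ₀ ξ - φ₀ (2*ξ))) ((2:ℝ)^k * x))

def FNorm (φ₀ : ℝ → ℂ) (p q s : ℝ) (g : ℝ → ℂ) : ℝ≥0∞ :=
  (∫⁻ x : ℝ, (∑' k : ℕ, ENNReal.ofReal ((2:ℝ)^((k:ℝ)*s*q)) *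
      (ENNReal.ofReal ‖LPop φ₀ k g x‖)^q)^(p/q) ∂volume)^(1/p)

/-- $\check{\mathcal Z}(A)=\min_{n\in A}\#\{j\in A:|j-n|\le\log_2\#A\}$. -/
def Zlow (A : Finset ℕ) (hA : A.Nonempty) : ℕ :=
  A.inf' hA (fun n => (A.filter (fun (j : ℕ) => |(j:ℝ) - (n:ℝ)| ≤ Real.logb 2 (A.card : ℝ))).card)

/-- A continuous kernel with polynomial decay of order seven for values and increments. -/
structure DecayKernel (C : ℝ) (Φ : ℝ → ℂ) : Prop where
  continuous : Continuous Φ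
  norm_le : ∀ x, ‖Φ x‖ ≤ C / (1 + |x|) ^ 7
  sub_le : ∀ x x', |x - x'| ≤ 1 → ‖Φ x' - Φ x‖ ≤ C * |x' - x| / (1 + |x|) ^ 7

lemma DecayKernel.mono {C C' : ℝ} {Φ : ℝ → ℂ} (h : DecayKernel C Φ) (hC : C ≤ C') :
    DecayKernel C' Φ where
  continuous := h.continuous
  norm_le x := (h.norm_le x).trans (by gcongr)
  sub_le x x' hx := (h.sub_le x x' hx).trans (by gcongr)

lemma SchwartzMap.exists_decayKernel (f : SchwartzMap ℝ ℂ) :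
    ∃ C : ℝ, DecayKernel C f := by
  obtain ⟨C, hC⟩ : ∃ C : ℝ, ∀ n ≤ 1, ∀ x : ℝ,
      (1 + ‖x‖) ^ 7 * ‖iteratedFDeriv ℝ n f x‖ ≤ C :=
    ⟨_, fun n hn x => SchwartzMap.one_add_le_sup_seminorm_apply (𝕜 := ℝ) (m := (7, 1)) le_rfl hn f x⟩
  have h0 : ∀ x : ℝ, ‖f x‖ ≤ C / (1 + |x|) ^ 7 := fun x => by
    have := hC 0 (by norm_num) x
    rw [norm_iteratedFDeriv_zero] at this
    rw [le_div_iff₀ (by positivity), mul_comm]; exact this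
  have h1 : ∀ x : ℝ, ‖deriv f x‖ ≤ C / (1 + |x|) ^ 7 := fun x => by
    have := hC 1 le_rfl x
    rw [norm_iteratedFDeriv_one, ← norm_deriv_eq_norm_fderiv] at this
    rw [le_div_iff₀ (by positivity), mul_comm]; exact this
  have hC0 : 0 ≤ C := le_trans (by positivity) (hC 0 (by norm_num) 0)
  refine ⟨C * 128, f.continuous, fun x => (h0 x).trans ?_, fun x x' hx => ?_⟩
  · gcongr; linarith
  · have key : ∀ z ∈ Set.uIcc x x', ‖deriv f z‖ ≤ C * 128 / (1 + |x|) ^ 7 := by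
      intro z hz
      refine (h1 z).trans ?_
      have hz' : |x - z| ≤ 1 := by
        have := Set.abs_sub_left_of_mem_uIcc hz
        rw [abs_sub_comm]; rw [abs_sub_comm] at hx; linarith
      have : 1 + |x| ≤ 2 * (1 + |z|) := by
        have := abs_add_le (x - z) z
        simp only [sub_add_cancel] at this
        have := abs_nonneg z
        linarith
      rw [div_le_div_iff₀ (by positivity) (by positivity)]
      calc C * (1 + |x|) ^ 7 ≤ C * (2 * (1 + |z|)) ^ 7 := by gcongr
        _ = _ := by ring
    have := Convex.norm_image_sub_le_of_norm_deriv_le (f := f) (s := Set.uIcc x x')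
      (fun z _ => f.differentiableAt) key (convex_uIcc x x') Set.left_mem_uIcc Set.right_mem_uIcc
    rw [Real.norm_eq_abs] at this
    calc _ ≤ _ := this
      _ = _ := by ring

/-- The `k`-th Littlewood-Paley profile. -/
def lpProfile (φ₀ : ℝ → ℂ) (k : ℕ) : ℝ → ℂ :=
  if k = 0 then 𝓕⁻ φ₀ else 𝓕⁻ (fun ξ => φ₀ ξ - φ₀ (2*ξ))

lemma LPop_apply (φ₀ : ℝ → ℂ) (k : ℕ) (g : ℝ → ℂ) (x : ℝ) :
    LPop φ₀ k g x = ∫ t : ℝ, g t * ((2:ℂ)^k * lpProfile φ₀ k ((2:ℝ)^k * (x - t))) := by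
  unfold LPop lpProfile conv
  by_cases hk : k = 0
  · simp [hk]
  · simp [hk]

lemma hasCompactSupport_lpDiff {φ₀ : ℝ → ℂ} (hc : HasCompactSupport φ₀) :
    HasCompactSupport (fun ξ : ℝ => φ₀ ξ - φ₀ (2*ξ)) := by
  have h2 : HasCompactSupport (fun ξ : ℝ => φ₀ (2*ξ)) :=
    hc.comp_homeomorph (Homeomorph.mulLeft₀ (2:ℝ) (by norm_num))
  exact hc.sub h2

lemma contDiff_lpDiff {φ₀ : ℝ → ℂ} (hs : ContDiff ℝ (⊤ : ℕ∞) φ₀) :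
    ContDiff ℝ (⊤ : ℕ∞) (fun ξ : ℝ => φ₀ ξ - φ₀ (2*ξ)) :=
  hs.sub (hs.comp (contDiff_const.mul contDiff_id))

lemma exists_decayKernel_fourierInv {φ : ℝ → ℂ} (hs : ContDiff ℝ (⊤ : ℕ∞) φ)
    (hc : HasCompactSupport φ) : ∃ C : ℝ, DecayKernel C (𝓕⁻ φ) := by
  obtain ⟨C, hC⟩ := SchwartzMap.exists_decayKernel (𝓕⁻ (hc.toSchwartzMap hs))
  refine ⟨C, ?_⟩
  rw [SchwartzMap.fourierInv_coe] at hC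
  exact hC

lemma exists_decayKernel_lpProfile {φ₀ : ℝ → ℂ} (hs : ContDiff ℝ (⊤ : ℕ∞) φ₀)
    (hc : HasCompactSupport φ₀) :
    ∃ C : ℝ, 0 < C ∧ ∀ k, DecayKernel C (lpProfile φ₀ k) := by
  obtain ⟨C₁, h₁⟩ := exists_decayKernel_fourierInv hs hc
  obtain ⟨C₂, h₂⟩ := exists_decayKernel_fourierInv (contDiff_lpDiff hs) (hasCompactSupport_lpDiff hc)
  refine ⟨max 1 (max C₁ C₂), by positivity, fun k => ?_⟩
  unfold lpProfile
  split_ifs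
  · exact h₁.mono (by simp)
  · exact h₂.mono (by simp)

/-- A measurable mean-zero function bounded by one and supported in the ball of radius
`2^{-l}` about `y`. -/
structure IsDyadicAtom (l : ℕ) (y : ℝ) (ψ : ℝ → ℂ) : Prop where
  measurable : Measurable ψ
  norm_le : ∀ t, ‖ψ t‖ ≤ 1
  eq_zero : ∀ t, ((2:ℝ)^l)⁻¹ < |t - y| → ψ t = 0
  integral_eq_zero : ∫ t, ψ t = 0

lemma integrable_of_bounded_support {ψ : ℝ → ℂ} {B y r : ℝ} (hm : Measurable ψ)
    (hB : ∀ t, ‖ψ t‖ ≤ B) (h0 : ∀ t, r < |t - y| → ψ t = 0) : Integrable ψ := by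
  have : Integrable (Set.indicator (Set.Icc (y - r) (y + r)) ψ) := by
    rw [integrable_indicator_iff measurableSet_Icc]
    exact Measure.integrableOn_of_bounded (M := B) (by simp) hm.aestronglyMeasurable
      (Filter.Eventually.of_forall hB)
  convert this using 1
  ext t
  by_cases ht : t ∈ Set.Icc (y - r) (y + r)
  · simp [ht]
  · rw [Set.indicator_of_notMem ht, h0]
    by_contra! hlt
    exact ht ⟨by linarith [(abs_le.mp hlt).1], by linarith [(abs_le.mp hlt).2]⟩

lemma IsDyadicAtom.integrable {l : ℕ} {y : ℝ} {ψ : ℝ → ℂ} (h : IsDyadicAtom l y ψ) : Integrable ψ :=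
  integrable_of_bounded_support h.measurable h.norm_le h.eq_zero

lemma integrable_mul_kernel {C : ℝ} {Φ : ℝ → ℂ} (hΦ : DecayKernel C Φ) {g : ℝ → ℂ}
    (hg : Integrable g) (k : ℕ) (x : ℝ) :
    Integrable (fun t => g t * ((2:ℂ)^k * Φ ((2:ℝ)^k * (x - t)))) := by
  refine hg.mul_bdd (c := 2 ^ k * C) ?_ (Filter.Eventually.of_forall fun t => ?_)
  · have := hΦ.continuous
    fun_prop
  · rw [norm_mul, norm_pow, Complex.norm_ofNat]
    gcongr
    refine (hΦ.norm_le _).trans ?_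
    have hC : 0 ≤ C := by
      have := (norm_nonneg _).trans (hΦ.norm_le 0)
      simpa using this
    apply div_le_self hC
    exact one_le_pow₀ (by linarith [abs_nonneg ((2:ℝ)^k * (x - t))])

lemma kernel_coarse_bound {C : ℝ} {Φ : ℝ → ℂ} (hΦ : DecayKernel C Φ) (hC : 0 < C) {k l : ℕ}
    (hkl : k ≤ l) {y : ℝ} {ψ : ℝ → ℂ} (hψ : IsDyadicAtom l y ψ) (x : ℝ) :
    ‖∫ t, ψ t * ((2:ℂ)^k * Φ ((2:ℝ)^k * (x - t)))‖ ≤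
      2 * C * ((4:ℝ)^(l-k))⁻¹ / (1 + (2:ℝ)^k * |x - y|) ^ 7 := by
  have h1 : ∫ t, ψ t * ((2:ℂ)^k * Φ ((2:ℝ)^k * (x - t))) =
      ∫ t in Set.Icc (y - ((2:ℝ)^l)⁻¹) (y + ((2:ℝ)^l)⁻¹),
        ψ t * ((2:ℂ)^k * (Φ ((2:ℝ)^k * (x - t)) - Φ ((2:ℝ)^k * (x - y)))) := by
    rw [setIntegral_eq_integral_of_forall_compl_eq_zero]
    · have e : ∀ t, ψ t * ((2:ℂ)^k * (Φ ((2:ℝ)^k * (x - t)) - Φ ((2:ℝ)^k * (x - y)))) =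
          ψ t * ((2:ℂ)^k * Φ ((2:ℝ)^k * (x - t))) - ψ t * ((2:ℂ)^k * Φ ((2:ℝ)^k * (x - y))) :=
        fun t => by ring
      simp only [e]
      rw [integral_sub (integrable_mul_kernel hΦ hψ.integrable k x)
        (hψ.integrable.mul_const _), integral_mul_const, hψ.integral_eq_zero]
      simp
    · intro t ht
      rw [hψ.eq_zero, zero_mul]
      by_contra! hlt
      exact ht ⟨by linarith [(abs_le.mp hlt).1], by linarith [(abs_le.mp hlt).2]⟩
  rw [h1]
  set D := (2:ℝ)^k * (C * ((2:ℝ)^k * ((2:ℝ)^l)⁻¹) / (1 + (2:ℝ)^k * |x - y|) ^ 7) with hD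
  have h2 : ∀ t ∈ Set.Icc (y - ((2:ℝ)^l)⁻¹) (y + ((2:ℝ)^l)⁻¹),
      ‖ψ t * ((2:ℂ)^k * (Φ ((2:ℝ)^k * (x - t)) - Φ ((2:ℝ)^k * (x - y))))‖ ≤ D := by
    intro t ht
    have hty : |y - t| ≤ ((2:ℝ)^l)⁻¹ := abs_le.mpr ⟨by linarith [ht.2], by linarith [ht.1]⟩
    have e1 : (2:ℝ)^k * (x - t) - (2:ℝ)^k * (x - y) = (2:ℝ)^k * (y - t) := by ring
    have e2 : |(2:ℝ)^k * (x - t) - (2:ℝ)^k * (x - y)| ≤ (2:ℝ)^k * ((2:ℝ)^l)⁻¹ := by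
      rw [e1, abs_mul, abs_of_pos (by positivity : (0:ℝ) < 2^k)]
      gcongr
    have e3 : (2:ℝ)^k * ((2:ℝ)^l)⁻¹ ≤ 1 := by
      rw [← div_eq_mul_inv, div_le_one (by positivity)]
      exact pow_le_pow_right₀ (by norm_num) hkl
    have := hΦ.sub_le ((2:ℝ)^k * (x - y)) ((2:ℝ)^k * (x - t)) (by rw [abs_sub_comm]; linarith)
    rw [abs_mul ((2:ℝ)^k) (x - y), abs_of_pos (by positivity : (0:ℝ) < 2^k)] at this
    rw [norm_mul, norm_mul, norm_pow, Complex.norm_ofNat]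
    calc _ ≤ 1 * (2 ^ k * ‖Φ ((2:ℝ)^k * (x - t)) - Φ ((2:ℝ)^k * (x - y))‖) := by
          gcongr; exact hψ.norm_le t
      _ ≤ D := by
          rw [one_mul, hD]
          gcongr
          refine this.trans ?_
          gcongr
  refine (norm_setIntegral_le_of_norm_le_const (by simp) h2).trans (le_of_eq ?_)
  rw [Real.volume_real_Icc_of_le (by have : (0:ℝ) < ((2:ℝ)^l)⁻¹ := by positivity
                                     linarith), hD]
  obtain ⟨d, rfl⟩ := Nat.exists_eq_add_of_le hkl
  have : (4:ℝ)^d = 2^d * 2^d := by rw [← mul_pow]; norm_num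
  simp only [add_tsub_cancel_left, this, pow_add]
  field_simp
  ring

lemma integrable_inv_one_add_abs_sq : Integrable (fun u : ℝ => ((1 + |u|) ^ 2)⁻¹) := by
  refine integrable_inv_one_add_sq.mono' ?_ (Filter.Eventually.of_forall fun u => ?_)
  · apply Continuous.aestronglyMeasurable
    exact Continuous.inv₀ (by fun_prop) (fun u => by positivity)
  · rw [Real.norm_of_nonneg (by positivity)]
    gcongr
    nlinarith [abs_nonneg u, sq_abs u]

lemma kernel_fine_bound {C : ℝ} {Φ : ℝ → ℂ} (hΦ : DecayKernel C Φ) (hC : 0 < C) {k l : ℕ}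
    (hkl : l ≤ k) {y : ℝ} {ψ : ℝ → ℂ} (hψ : IsDyadicAtom l y ψ) (x : ℝ) :
    ‖∫ t, ψ t * ((2:ℂ)^k * Φ ((2:ℝ)^k * (x - t)))‖ ≤
      32 * C * (∫ u : ℝ, ((1 + |u|) ^ 2)⁻¹) / (1 + (2:ℝ)^l * |x - y|) ^ 5 := by
  have hk : (0:ℝ) < 2 ^ k := by positivity
  set D := 32 * C / (1 + (2:ℝ)^l * |x - y|) ^ 5 with hD
  have hint : Integrable (fun t : ℝ => ((1 + |(2:ℝ)^k * (x - t)|) ^ 2)⁻¹) :=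
    (integrable_inv_one_add_abs_sq.comp_mul_left' hk.ne').comp_sub_left x
  have h2 : ∀ t, ‖ψ t * ((2:ℂ)^k * Φ ((2:ℝ)^k * (x - t)))‖ ≤
      D * 2 ^ k * ((1 + |(2:ℝ)^k * (x - t)|) ^ 2)⁻¹ := by
    intro t
    by_cases ht : ((2:ℝ)^l)⁻¹ < |t - y|
    · rw [hψ.eq_zero t ht]; simp; positivity
    push Not at ht
    rw [norm_mul, norm_mul, norm_pow, Complex.norm_ofNat]
    set v := |(2:ℝ)^k * (x - t)| with hv
    have hv0 : 0 ≤ v := abs_nonneg _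
    have hle : 1 + (2:ℝ)^l * |x - y| ≤ 2 * (1 + v) := by
      have a1 : |x - y| ≤ |x - t| + |t - y| := abs_sub_le x t y
      have a2 : (2:ℝ)^l * |t - y| ≤ 1 := by
        calc (2:ℝ)^l * |t - y| ≤ (2:ℝ)^l * ((2:ℝ)^l)⁻¹ := by gcongr
          _ = 1 := by field_simp
      have a3 : (2:ℝ)^l * |x - t| ≤ v := by
        rw [hv, abs_mul, abs_of_pos hk]
        gcongr
        norm_num
      have a4 : (2:ℝ)^l * |x - y| ≤ (2:ℝ)^l * (|x - t| + |t - y|) := by gcongr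
      nlinarith
    calc _ ≤ 1 * (2 ^ k * (C / (1 + v) ^ 7)) := by
          gcongr
          · exact hψ.norm_le t
          · exact hΦ.norm_le _
      _ = 32 * C / (2 * (1 + v)) ^ 5 * 2 ^ k * ((1 + v) ^ 2)⁻¹ := by
          field_simp
          ring
      _ ≤ _ := by rw [hD]; gcongr
  refine (norm_integral_le_of_norm_le (hint.const_mul _) (Filter.Eventually.of_forall h2)).trans ?_
  rw [integral_const_mul]
  have e : ∫ t : ℝ, ((1 + |(2:ℝ)^k * (x - t)|) ^ 2)⁻¹ = (2^k)⁻¹ * ∫ u : ℝ, ((1 + |u|) ^ 2)⁻¹ := by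
    rw [integral_sub_left_eq_self (fun t : ℝ => ((1 + |(2:ℝ)^k * t|) ^ 2)⁻¹) volume x,
      Measure.integral_comp_mul_left (fun t : ℝ => ((1 + |t|) ^ 2)⁻¹)]
    simp
  rw [e, hD]
  apply le_of_eq
  field_simp

/-- Littlewood-Paley pieces of atoms, with both fine and coarse frequencies. -/
lemma exists_LPop_atom_bound {φ₀ : ℝ → ℂ} (hs : ContDiff ℝ (⊤ : ℕ∞) φ₀)
    (hc : HasCompactSupport φ₀) :
    ∃ C : ℝ, 0 < C ∧ ∀ (k l : ℕ) (y : ℝ) (ψ : ℝ → ℂ), IsDyadicAtom l y ψ → ∀ x : ℝ,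
      ‖LPop φ₀ k ψ x‖ ≤
        C * ((4:ℝ)^(l-k))⁻¹ / (1 + (2:ℝ)^(min k l) * |x - y|) ^ 5 := by
  obtain ⟨C, hC, hK⟩ := exists_decayKernel_lpProfile hs hc
  set J := ∫ u : ℝ, ((1 + |u|) ^ 2)⁻¹
  have hJ : 0 ≤ J := integral_nonneg fun u => by positivity
  refine ⟨32 * C * J + 2 * C, by positivity, fun k l y ψ hψ x => ?_⟩
  rw [LPop_apply]
  rcases le_total k l with h | h
  · refine (kernel_coarse_bound (hK k) hC h hψ x).trans ?_
    rw [min_eq_left h]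
    have : (1:ℝ) ≤ 1 + 2^k * |x - y| := by
      have : (0:ℝ) ≤ 2^k * |x - y| := by positivity
      linarith
    gcongr
    · have : 0 ≤ 32 * C * J := by positivity
      linarith
    · norm_num
  · refine (kernel_fine_bound (hK k) hC h hψ x).trans ?_
    rw [min_eq_right h, Nat.sub_eq_zero_of_le h]
    simp only [pow_zero, inv_one, mul_one]
    gcongr
    linarith

lemma sum_comp_le_of_injOn {ι : Type*} {S : Finset ι} {g : ι → ℕ} (hg : Set.InjOn g S)
    {F : ℕ → ℝ} {B : ℝ} (hF : ∀ i, 0 ≤ F i) (hB : ∀ n, ∑ i ∈ Finset.range n, F i ≤ B) :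
    ∑ μ ∈ S, F (g μ) ≤ B := by
  classical
  rw [← Finset.sum_image hg]
  refine le_trans ?_ (hB ((S.image g).sup id + 1))
  refine Finset.sum_le_sum_of_subset_of_nonneg (fun i hi => ?_) (fun i _ _ => hF i)
  exact Finset.mem_range_succ_iff.mpr (Finset.le_sup (f := id) hi)

lemma sum_int_floor_le (S : Finset ℤ) (z : ℝ) {F : ℕ → ℝ} {B : ℝ} (hF : ∀ i, 0 ≤ F i)
    (hB : ∀ n, ∑ i ∈ Finset.range n, F i ≤ B) :
    ∑ μ ∈ S, F ⌊|(μ:ℝ) - z|⌋₊ ≤ 2 * B := by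
  classical
  rw [← Finset.sum_filter_add_sum_filter_not S (fun μ : ℤ => z ≤ (μ:ℝ)), two_mul]
  have aux : ∀ μ μ' : ℤ, ⌊|(μ:ℝ) - z|⌋₊ = ⌊|(μ':ℝ) - z|⌋₊ →
      |(|(μ:ℝ) - z| - |(μ':ℝ) - z|)| < 1 := by
    intro μ μ' h
    have h1 := Nat.floor_le (abs_nonneg ((μ:ℝ) - z))
    have h2 := Nat.lt_floor_add_one |(μ:ℝ) - z|
    have h3 := Nat.floor_le (abs_nonneg ((μ':ℝ) - z))
    have h4 := Nat.lt_floor_add_one |(μ':ℝ) - z|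
    rw [h] at h1 h2
    rw [abs_lt]; constructor <;> linarith
  have aux2 : ∀ μ μ' : ℤ, |(μ:ℝ) - μ'| < 1 → μ = μ' := by
    intro μ μ' h
    have : |μ - μ'| < 1 := by exact_mod_cast h
    have := Int.abs_lt_one_iff.mp this
    omega
  refine add_le_add (sum_comp_le_of_injOn ?_ hF hB) (sum_comp_le_of_injOn ?_ hF hB)
  · intro μ hμ μ' hμ' h
    have h1 : z ≤ (μ:ℝ) := (Finset.mem_filter.mp hμ).2
    have h2 : z ≤ (μ':ℝ) := (Finset.mem_filter.mp hμ').2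
    have := aux μ μ' h
    rw [abs_of_nonneg (sub_nonneg.mpr h1), abs_of_nonneg (sub_nonneg.mpr h2)] at this
    exact aux2 _ _ (by convert this using 2; ring)
  · intro μ hμ μ' hμ' h
    have h1 : (μ:ℝ) < z := not_le.mp (Finset.mem_filter.mp hμ).2
    have h2 : (μ':ℝ) < z := not_le.mp (Finset.mem_filter.mp hμ').2
    have := aux μ μ' h
    rw [abs_of_neg (sub_neg.mpr h1), abs_of_neg (sub_neg.mpr h2)] at this
    exact aux2 _ _ (by rw [abs_sub_comm]; convert this using 2; ring)

lemma sum_range_inv_one_add_mul_sq_le {θ : ℝ} (hθ : 0 < θ) (n : ℕ) :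
    ∑ i ∈ Finset.range n, ((1 + θ * i) ^ 2)⁻¹ ≤ 1 + 1 / θ := by
  have key : ∀ n : ℕ, ∑ i ∈ Finset.range (n + 1), ((1 + θ * i) ^ 2)⁻¹ ≤
      1 + 1 / θ * (1 - (1 + θ * n)⁻¹) := by
    intro n
    induction n with
    | zero => simp
    | succ n ih =>
      rw [Finset.sum_range_succ]
      have : ((1 + θ * (n + 1 : ℕ)) ^ 2)⁻¹ ≤
          1 / θ * ((1 + θ * n)⁻¹ - (1 + θ * (n + 1 : ℕ))⁻¹) := by
        have e : 1 / θ * ((1 + θ * n)⁻¹ - (1 + θ * (n + 1 : ℕ))⁻¹) =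
            ((1 + θ * n) * (1 + θ * (n + 1 : ℕ)))⁻¹ := by
          push_cast
          field_simp
          ring
        rw [e]
        gcongr
        rw [sq]
        gcongr
        simp
      linarith [mul_sub (1 / θ) 1 ((1 + θ * n)⁻¹)]
  rcases n with _ | n
  · simp; positivity
  · refine (key n).trans ?_
    have : 1 / θ * (1 - (1 + θ * n)⁻¹) ≤ 1 / θ * 1 := by
      gcongr
      have : 0 ≤ (1 + θ * n)⁻¹ := by positivity
      linarith
    linarith

/-- A Riemann sum bound for the lattice sums of an inverse square. -/
lemma sum_int_inv_one_add_mul_sq_le {θ : ℝ} (hθ : 0 < θ) (S : Finset ℤ) (z : ℝ) :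
    ∑ μ ∈ S, ((1 + θ * |(μ:ℝ) - z|) ^ 2)⁻¹ ≤ 2 * (1 + 1 / θ) := by
  refine le_trans (Finset.sum_le_sum fun μ _ => ?_)
    (sum_int_floor_le S z (F := fun i => ((1 + θ * i) ^ 2)⁻¹) (fun i => by positivity)
      (sum_range_inv_one_add_mul_sq_le hθ))
  gcongr
  exact Nat.floor_le (abs_nonneg _)

lemma sum_int_geom_le {ρ : ℝ} (h0 : 0 ≤ ρ) (h1 : ρ < 1) (S : Finset ℤ) (k : ℤ) :
    ∑ v ∈ S, ρ ^ (v - k).natAbs ≤ 2 * (1 - ρ)⁻¹ := by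
  have := sum_int_floor_le S (k:ℝ) (F := fun i => ρ ^ i) (B := (1 - ρ)⁻¹) (fun i => by positivity)
    (fun n => by
      simpa using geom_sum_Ico_le_of_lt_one (m := 0) (n := n) h0 h1)
  refine le_trans (le_of_eq (Finset.sum_congr rfl fun v _ => ?_)) this
  congr 1
  have : |(v:ℝ) - k| = ((v - k).natAbs : ℝ) := by
    rw [Nat.cast_natAbs]; push_cast; rfl
  rw [this, Nat.floor_natCast]

/-- Jensen's inequality with unnormalized weights. -/
lemma rpow_sum_mul_le {ι : Type*} {q : ℝ} (hq : 1 ≤ q) (S : Finset ι) {w f : ι → ℝ}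
    (hw : ∀ i, 0 ≤ w i) (hf : ∀ i, 0 ≤ f i) {Ω : ℝ} (hΩ : ∑ i ∈ S, w i ≤ Ω) :
    (∑ i ∈ S, w i * f i) ^ q ≤ Ω ^ (q - 1) * ∑ i ∈ S, w i * f i ^ q := by
  have hq0 : 0 < q := by linarith
  have h := Real.inner_le_weight_mul_Lp_of_nonneg S hq w f hw hf
  have hs : 0 ≤ ∑ i ∈ S, w i := Finset.sum_nonneg fun i _ => hw i
  have hs2 : 0 ≤ ∑ i ∈ S, w i * f i ^ q :=
    Finset.sum_nonneg fun i _ => mul_nonneg (hw i) (rpow_nonneg (hf i) _)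
  calc (∑ i ∈ S, w i * f i) ^ q
      ≤ ((∑ i ∈ S, w i) ^ (1 - q⁻¹) * (∑ i ∈ S, w i * f i ^ q) ^ q⁻¹) ^ q := by
        gcongr
        exact Finset.sum_nonneg fun i _ => mul_nonneg (hw i) (hf i)
    _ = (∑ i ∈ S, w i) ^ (q - 1) * ∑ i ∈ S, w i * f i ^ q := by
        rw [mul_rpow (by positivity) (by positivity), ← rpow_mul hs, ← rpow_mul hs2,
          inv_mul_cancel₀ hq0.ne', rpow_one]
        congr 2
        field_simp
    _ ≤ _ := by
        gcongr

lemma sum_geom_rpow_le {q : ℝ} (hq : 1 < q) (J : Finset ℕ) :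
    (∑ j ∈ J, (2:ℝ) ^ (-(j:ℝ) / q)) ^ q ≤
      ((1 - (2:ℝ) ^ (-1 / q))⁻¹) ^ q * ∑ j ∈ J, (2:ℝ) ^ (-(j:ℝ)) := by
  have hq0 : 0 < q := by linarith
  rcases J.eq_empty_or_nonempty with rfl | hJ
  · simp [zero_rpow hq0.ne']
  set ρ := (2:ℝ) ^ (-1 / q) with hρ
  have h0 : 0 < ρ := by positivity
  have h1 : ρ < 1 := Real.rpow_lt_one_of_one_lt_of_neg (by norm_num) (by
    rw [neg_div]; exact neg_neg_of_pos (by positivity))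
  have e : ∀ j : ℕ, (2:ℝ) ^ (-(j:ℝ) / q) = ρ ^ j := by
    intro j
    rw [hρ, ← rpow_natCast, ← rpow_mul (by norm_num)]
    congr 1; ring
  have hsub : J ⊆ Finset.Ico (J.min' hJ) (J.max' hJ + 1) := fun j hj =>
    Finset.mem_Ico.mpr ⟨J.min'_le j hj, Nat.lt_succ_of_le (J.le_max' j hj)⟩
  have h2 : ∑ j ∈ J, (2:ℝ) ^ (-(j:ℝ) / q) ≤ (1 - ρ)⁻¹ * (2:ℝ) ^ (-(J.min' hJ:ℝ) / q) := by
    simp only [e]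
    calc _ ≤ ∑ j ∈ Finset.Ico (J.min' hJ) (J.max' hJ + 1), ρ ^ j :=
          Finset.sum_le_sum_of_subset_of_nonneg hsub fun i _ _ => by positivity
      _ ≤ ρ ^ (J.min' hJ) / (1 - ρ) := geom_sum_Ico_le_of_lt_one h0.le h1
      _ = _ := by rw [div_eq_inv_mul]
  have h3 : 0 ≤ (1 - ρ)⁻¹ := inv_nonneg.mpr (by linarith)
  calc _ ≤ ((1 - ρ)⁻¹ * (2:ℝ) ^ (-(J.min' hJ:ℝ) / q)) ^ q := by gcongr
    _ = ((1 - ρ)⁻¹) ^ q * (2:ℝ) ^ (-(J.min' hJ:ℝ)) := by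
        rw [mul_rpow h3 (by positivity), ← rpow_mul (by norm_num)]
        congr 2; field_simp
    _ ≤ _ := by
        gcongr
        exact Finset.single_le_sum (f := fun j : ℕ => (2:ℝ) ^ (-(j:ℝ)))
          (fun j _ => by positivity) (J.min'_mem hJ)

/-- Superposition of profiles peaked at `κ j`, whose heights form a lacunary sequence on every
level set of `κ`. -/
lemma sum_rpow_peaks_le {q : ℝ} (hq : 1 < q) {ρ : ℝ} (h0 : 0 < ρ) (h1 : ρ < 1) :
    ∃ C : ℝ, 0 < C ∧ ∀ (A : Finset ℕ) (κ : ℕ → ℤ) (S : Finset ℕ),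
      ∑ k ∈ S, (∑ j ∈ A, (2:ℝ) ^ (((κ j:ℝ) - j) / q) * ρ ^ ((κ j - k).natAbs)) ^ q ≤
        C * ∑ j ∈ A, (2:ℝ) ^ ((κ j:ℝ) - j) := by
  classical
  have hq0 : 0 < q := by linarith
  set Ω := 2 * (1 - ρ)⁻¹ with hΩ
  have hΩ0 : 0 < Ω := by
    have : 0 < (1 - ρ)⁻¹ := inv_pos.mpr (by linarith)
    positivity
  set G := ((1 - (2:ℝ) ^ (-1 / q))⁻¹) ^ q with hG
  have hG0 : 0 < G := by
    have : (2:ℝ) ^ (-1 / q) < 1 := Real.rpow_lt_one_of_one_lt_of_neg (by norm_num) (by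
      rw [neg_div]; exact neg_neg_of_pos (by positivity))
    have : 0 < (1 - (2:ℝ) ^ (-1 / q))⁻¹ := inv_pos.mpr (by linarith)
    positivity
  refine ⟨Ω ^ (q - 1) * (G * Ω), by positivity, fun A κ S => ?_⟩
  set V : ℤ → ℝ := fun v => ∑ j ∈ A with κ j = v, (2:ℝ) ^ (((κ j:ℝ) - j) / q) with hV
  have hV0 : ∀ v, 0 ≤ V v := fun v => Finset.sum_nonneg fun j _ => by positivity
  have hVq : ∀ v, V v ^ q ≤ G * ∑ j ∈ A with κ j = v, (2:ℝ) ^ ((κ j:ℝ) - j) := by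
    intro v
    have e1 : V v = (2:ℝ) ^ ((v:ℝ) / q) * ∑ j ∈ A with κ j = v, (2:ℝ) ^ (-(j:ℝ) / q) := by
      rw [hV, Finset.mul_sum]
      refine Finset.sum_congr rfl fun j hj => ?_
      rw [(Finset.mem_filter.mp hj).2, ← rpow_add (by norm_num)]
      congr 1; ring
    have e2 : ∑ j ∈ A with κ j = v, (2:ℝ) ^ ((κ j:ℝ) - j) =
        (2:ℝ) ^ (v:ℝ) * ∑ j ∈ A with κ j = v, (2:ℝ) ^ (-(j:ℝ)) := by
      rw [Finset.mul_sum]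
      refine Finset.sum_congr rfl fun j hj => ?_
      rw [(Finset.mem_filter.mp hj).2, ← rpow_add (by norm_num)]
      congr 1
    rw [e1, e2, mul_rpow (by positivity) (Finset.sum_nonneg fun j _ => by positivity),
      ← rpow_mul (by norm_num), div_mul_cancel₀ _ hq0.ne']
    have := sum_geom_rpow_le hq (A.filter fun j => κ j = v)
    calc _ ≤ (2:ℝ) ^ (v:ℝ) * (G * ∑ j ∈ A with κ j = v, (2:ℝ) ^ (-(j:ℝ))) := by gcongr
      _ = _ := by ring
  have step : ∀ k ∈ S, (∑ j ∈ A, (2:ℝ) ^ (((κ j:ℝ) - j) / q) * ρ ^ ((κ j - k).natAbs)) ^ q ≤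
      Ω ^ (q - 1) * ∑ v ∈ A.image κ, ρ ^ ((v - k).natAbs) * V v ^ q := by
    intro k _
    have e : ∑ j ∈ A, (2:ℝ) ^ (((κ j:ℝ) - j) / q) * ρ ^ ((κ j - k).natAbs) =
        ∑ v ∈ A.image κ, ρ ^ ((v - k).natAbs) * V v := by
      rw [← Finset.sum_fiberwise_of_maps_to (g := κ) (t := A.image κ)
        (fun j hj => Finset.mem_image_of_mem κ hj)]
      refine Finset.sum_congr rfl fun v _ => ?_
      rw [hV, Finset.mul_sum]
      refine Finset.sum_congr rfl fun j hj => ?_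
      rw [(Finset.mem_filter.mp hj).2, mul_comm]
    rw [e]
    exact rpow_sum_mul_le hq.le _ (fun v => by positivity) hV0 (sum_int_geom_le h0.le h1 _ _)
  refine (Finset.sum_le_sum step).trans ?_
  rw [← Finset.mul_sum, mul_assoc]
  gcongr
  rw [Finset.sum_comm]
  calc ∑ v ∈ A.image κ, ∑ k ∈ S, ρ ^ ((v - k).natAbs) * V v ^ q
      ≤ ∑ v ∈ A.image κ, Ω * (G * ∑ j ∈ A with κ j = v, (2:ℝ) ^ ((κ j:ℝ) - j)) := by
        refine Finset.sum_le_sum fun v _ => ?_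
        rw [← Finset.sum_mul]
        refine mul_le_mul ?_ (hVq v) (rpow_nonneg (hV0 v) _) hΩ0.le
        have := sum_int_geom_le h0.le h1 (S.map Nat.castEmbedding) v
        rw [Finset.sum_map] at this
        refine le_trans (le_of_eq (Finset.sum_congr rfl fun k _ => ?_)) this
        simp only [Nat.castEmbedding_apply]
        rw [← Int.natAbs_neg]; congr 2; ring
    _ = _ := by
        rw [← Finset.sum_fiberwise_of_maps_to (g := κ) (t := A.image κ)
          (fun j hj => Finset.mem_image_of_mem κ hj), ← Finset.mul_sum, ← Finset.mul_sum]
        ring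

/-- Distance to the shifted lattice `ℤ + 1/2`. -/
def halfDist (t : ℝ) : ℝ := |Int.fract t - 1 / 2|

lemma halfDist_nonneg (t : ℝ) : 0 ≤ halfDist t := abs_nonneg _

lemma halfDist_le_half (t : ℝ) : halfDist t ≤ 1 / 2 := by
  have h1 := Int.fract_nonneg t
  have h2 := Int.fract_lt_one t
  rw [halfDist, abs_le]; constructor <;> linarith

lemma halfDist_le (t : ℝ) (ν : ℤ) : halfDist t ≤ |(ν:ℝ) - (t - 1 / 2)| := by
  have h1 := Int.fract_nonneg t
  have h2 := Int.fract_lt_one t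
  have h3 := Int.floor_add_fract t
  have h4 := halfDist_le_half t
  rcases lt_trichotomy ν ⌊t⌋ with h | h | h
  · have : (ν:ℝ) + 1 ≤ ⌊t⌋ := by exact_mod_cast h
    rw [abs_of_neg] <;> linarith
  · rw [h, halfDist, abs_sub_comm]
    apply le_of_eq; congr 1; linarith
  · have : (⌊t⌋:ℝ) + 1 ≤ ν := by exact_mod_cast h
    exact h4.trans (le_trans (by linarith) (le_abs_self _))

/-- A truncated version of `1 / halfDist`. -/
def peak (L : ℕ) (t : ℝ) : ℝ := (((2:ℝ) ^ (2 * L))⁻¹ + halfDist t)⁻¹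

lemma peak_pos (L : ℕ) (t : ℝ) : 0 < peak L t := by
  have := halfDist_nonneg t
  unfold peak; positivity

/-- The centres of the atoms. -/
def centre (K j : ℕ) (ν : ℤ) : ℝ := 2 ^ K * (ν + 1 / 2) / 2 ^ j

lemma sum_lattice_le (K j β : ℕ) (x : ℝ) :
    ∑ ν ∈ Finset.range (2 ^ j), ((1 + (2:ℝ) ^ β * |x - centre K j ν|) ^ 5)⁻¹ ≤
      (1 + 2 ^ K) * (1 + |x|)⁻¹ * (2 * (1 + 2 ^ j / 2 ^ β) *
        ((1 + 2 ^ β / 2 ^ j * halfDist (2 ^ j * x / 2 ^ K)) ^ 2)⁻¹) := by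
  set θ : ℝ := 2 ^ β / 2 ^ j with hθ
  have hθ0 : 0 < θ := by positivity
  set z : ℝ := 2 ^ j * x / 2 ^ K - 1 / 2 with hz
  set D := halfDist (2 ^ j * x / 2 ^ K) with hD
  have hD0 : 0 ≤ D := halfDist_nonneg _
  have key : ∀ ν ∈ Finset.range (2 ^ j), ((1 + (2:ℝ) ^ β * |x - centre K j ν|) ^ 5)⁻¹ ≤
      (1 + 2 ^ K) * (1 + |x|)⁻¹ * (((1 + θ * D) ^ 2)⁻¹ *
        ((1 + θ * |((ν:ℤ):ℝ) - z|) ^ 2)⁻¹) := by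
    intro ν hν
    have hν' : (ν:ℝ) + 1 ≤ 2 ^ j := by
      have := Finset.mem_range.mp hν
      exact_mod_cast this
    have hK1 : (1:ℝ) ≤ 2 ^ K := one_le_pow₀ (by norm_num)
    have h1 : θ * |((ν:ℤ):ℝ) - z| ≤ (2:ℝ) ^ β * |x - centre K j ν| := by
      have e : x - centre K j ν = 2 ^ K / 2 ^ j * (z - (ν:ℤ)) := by
        rw [centre, hz]; push_cast; field_simp; ring
      rw [e, abs_mul, abs_sub_comm (z:ℝ), abs_of_pos (by positivity : (0:ℝ) < 2 ^ K / 2 ^ j), hθ]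
      have : 2 ^ β / 2 ^ j * |((ν:ℤ):ℝ) - z| * 1 ≤ 2 ^ β / 2 ^ j * |((ν:ℤ):ℝ) - z| * 2 ^ K := by
        gcongr
      calc _ ≤ _ := by simpa using this
        _ = _ := by push_cast; ring
    have h2 : D ≤ |((ν:ℤ):ℝ) - z| := halfDist_le _ _
    have h2' : θ * D ≤ (2:ℝ) ^ β * |x - centre K j ν| := le_trans (by gcongr) h1
    have h3 : 1 + |x| ≤ (1 + 2 ^ K) * (1 + (2:ℝ) ^ β * |x - centre K j ν|) := by
      have hy : |centre K j ν| ≤ 2 ^ K := by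
        rw [centre, abs_of_nonneg (by positivity), div_le_iff₀ (by positivity)]
        push_cast
        gcongr; linarith
      have hx : |x| ≤ |x - centre K j ν| + |centre K j ν| := by
        simpa using abs_add_le (x - centre K j ν) (centre K j ν)
      have hb : (1:ℝ) ≤ 2 ^ β := one_le_pow₀ (by norm_num)
      nlinarith [abs_nonneg (x - centre K j ν),
        mul_le_mul_of_nonneg_right hb (abs_nonneg (x - centre K j ν)),
        mul_nonneg (by positivity : (0:ℝ) ≤ 2 ^ K)
          (mul_nonneg (by positivity : (0:ℝ) ≤ 2 ^ β) (abs_nonneg (x - centre K j ν)))]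
    set Q := 1 + (2:ℝ) ^ β * |x - centre K j ν| with hQ
    have hQ0 : 0 < Q := by positivity
    have e5 : (Q ^ 5)⁻¹ = Q⁻¹ * ((Q ^ 2)⁻¹ * (Q ^ 2)⁻¹) := by
      rw [← mul_inv, ← mul_inv]; ring_nf
    rw [e5]
    have h4 : Q⁻¹ ≤ (1 + 2 ^ K) * (1 + |x|)⁻¹ := by
      rw [inv_le_iff_one_le_mul₀ hQ0]
      have : 1 ≤ (1 + |x|)⁻¹ * ((1 + 2 ^ K) * Q) := by
        rw [← div_eq_inv_mul, one_le_div (by positivity)]; exact h3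
      linarith
    have h5 : (Q ^ 2)⁻¹ ≤ ((1 + θ * D) ^ 2)⁻¹ := by
      gcongr; linarith
    have h6 : (Q ^ 2)⁻¹ ≤ ((1 + θ * |((ν:ℤ):ℝ) - z|) ^ 2)⁻¹ := by
      gcongr; linarith
    gcongr
  refine (Finset.sum_le_sum key).trans ?_
  rw [← Finset.mul_sum, ← Finset.mul_sum]
  refine mul_le_mul_of_nonneg_left ?_ (by positivity)
  have := sum_int_inv_one_add_mul_sq_le hθ0 ((Finset.range (2 ^ j)).map Nat.castEmbedding) z
  rw [Finset.sum_map] at this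
  simp only [Nat.castEmbedding_apply] at this
  rw [mul_comm (((1 + θ * D) ^ 2)⁻¹)]
  refine mul_le_mul_of_nonneg_right (this.trans (le_of_eq ?_)) (by positivity)
  rw [hθ, one_div, inv_div]

lemma sum_telescope_le {D : ℝ} (hD : 0 ≤ D) (M : ℕ) :
    ∑ m ∈ Finset.range M, (2:ℝ) ^ m * ((1 + 2 ^ m * D) ^ 2)⁻¹ ≤
      2 * (((2:ℝ) ^ M)⁻¹ + D)⁻¹ := by
  induction M with
  | zero => simp; positivity
  | succ M ih =>
    rw [Finset.sum_range_succ]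
    set a : ℝ := 2 ^ M with ha
    have ha0 : 0 < a := by positivity
    have e1 : (a⁻¹ + D)⁻¹ = a / (1 + a * D) := by field_simp
    have e2 : (((2:ℝ) ^ (M + 1))⁻¹ + D)⁻¹ = 2 * a / (1 + 2 * a * D) := by
      rw [pow_succ, ← ha]; field_simp
    rw [e1] at ih
    rw [e2]
    have : a * ((1 + a * D) ^ 2)⁻¹ ≤ 2 * (2 * a / (1 + 2 * a * D) - a / (1 + a * D)) := by
      have e3 : 2 * (2 * a / (1 + 2 * a * D) - a / (1 + a * D)) =
          a * (2 / ((1 + 2 * a * D) * (1 + a * D))) := by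
        field_simp; ring
      rw [e3]
      gcongr
      rw [← one_div, div_le_div_iff₀ (by positivity) (by positivity)]
      nlinarith [mul_nonneg ha0.le hD, mul_nonneg (mul_nonneg ha0.le hD) (mul_nonneg ha0.le hD)]
    linarith

/-- The size at relative frequency `τ` of a superposition of atoms at the relative frequencies
`L, …, 2 L - 1`. -/
lemma sum_relative_levels_le (L : ℕ) (hL : 1 ≤ L) (τ : ℤ) {D : ℝ} (hD : 0 ≤ D) :
    ∑ m ∈ Finset.Ico L (2 * L), (2:ℝ) ^ m * ((4:ℝ) ^ ((m:ℤ) - τ).toNat)⁻¹ *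
      ((1 + ((2:ℝ) ^ (min τ m))⁻¹) * ((1 + (2:ℝ) ^ (min τ m) * D) ^ 2)⁻¹) ≤
    8 * min ((2:ℝ) ^ τ) (((2:ℝ) ^ (2 * L))⁻¹ + D)⁻¹ := by
  rw [← Finset.sum_filter_add_sum_filter_not _ (fun m : ℕ => (m:ℤ) ≤ τ)]
  have hT : (0:ℝ) < 2 ^ τ := by positivity
  set X := (((2:ℝ) ^ (2 * L))⁻¹ + D)⁻¹ with hX
  have hX0 : 0 < X := by positivity
  have hlow : ∑ m ∈ (Finset.Ico L (2 * L)).filter (fun m : ℕ => (m:ℤ) ≤ τ),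
      (2:ℝ) ^ m * ((4:ℝ) ^ ((m:ℤ) - τ).toNat)⁻¹ *
      ((1 + ((2:ℝ) ^ (min τ m))⁻¹) * ((1 + (2:ℝ) ^ (min τ m) * D) ^ 2)⁻¹) ≤
      6 * min ((2:ℝ) ^ τ) X := by
    have h1 : ∀ m ∈ (Finset.Ico L (2 * L)).filter (fun m : ℕ => (m:ℤ) ≤ τ),
      (2:ℝ) ^ m * ((4:ℝ) ^ ((m:ℤ) - τ).toNat)⁻¹ *
      ((1 + ((2:ℝ) ^ (min τ m))⁻¹) * ((1 + (2:ℝ) ^ (min τ m) * D) ^ 2)⁻¹) ≤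
      (3/2) * ((2:ℝ) ^ m * ((1 + 2 ^ m * D) ^ 2)⁻¹) := by
      intro m hm
      obtain ⟨hm1, hm2⟩ := Finset.mem_filter.mp hm
      have hm3 := (Finset.mem_Ico.mp hm1).1
      rw [min_eq_right hm2, Int.toNat_of_nonpos (by omega), zpow_natCast]
      have : ((2:ℝ) ^ m)⁻¹ ≤ 1 / 2 := by
        rw [one_div]; gcongr
        calc (2:ℝ) = 2 ^ 1 := by norm_num
          _ ≤ 2 ^ m := by gcongr; norm_num; omega
      calc _ ≤ (2:ℝ) ^ m * ((4:ℝ) ^ 0)⁻¹ * ((1 + 1 / 2) * ((1 + 2 ^ m * D) ^ 2)⁻¹) := by gcongr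
        _ = _ := by norm_num; ring
    refine (Finset.sum_le_sum h1).trans ?_
    rw [← Finset.mul_sum]
    have hsub : (Finset.Ico L (2 * L)).filter (fun m : ℕ => (m:ℤ) ≤ τ) ⊆ Finset.range (2 * L) := by
      intro m hm
      obtain ⟨hm1, hm2⟩ := Finset.mem_filter.mp hm
      have := Finset.mem_Ico.mp hm1
      simp; omega
    have hsub' : (Finset.Ico L (2 * L)).filter (fun m : ℕ => (m:ℤ) ≤ τ) ⊆
        Finset.range (τ.toNat + 1) := by
      intro m hm
      obtain ⟨hm1, hm2⟩ := Finset.mem_filter.mp hm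
      simp; omega
    have b1 := (Finset.sum_le_sum_of_subset_of_nonneg hsub (f := fun m : ℕ =>
      (2:ℝ) ^ m * ((1 + 2 ^ m * D) ^ 2)⁻¹) (fun i _ _ => by positivity)).trans
      (sum_telescope_le hD (2 * L))
    rw [← hX] at b1
    rcases lt_or_ge τ 0 with hτ | hτ
    · rw [Finset.filter_false_of_mem]
      · rw [Finset.sum_empty, mul_zero]; positivity
      · intro m _; omega
    have b2 := (Finset.sum_le_sum_of_subset_of_nonneg hsub' (f := fun m : ℕ =>
      (2:ℝ) ^ m * ((1 + 2 ^ m * D) ^ 2)⁻¹) (fun i _ _ => by positivity)).trans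
      (sum_telescope_le hD (τ.toNat + 1))
    have b3 : (((2:ℝ) ^ (τ.toNat + 1))⁻¹ + D)⁻¹ ≤ 2 * 2 ^ τ := by
      have e : (2:ℝ) ^ τ = 2 ^ τ.toNat := by
        rw [← zpow_natCast, Int.toNat_of_nonneg hτ]
      rw [e]
      calc _ ≤ (((2:ℝ) ^ (τ.toNat + 1))⁻¹)⁻¹ := by
            gcongr; linarith
        _ = _ := by rw [inv_inv]; ring
    rw [mul_min_of_nonneg _ _ (by norm_num : (0:ℝ) ≤ 6)]
    exact le_min (by linarith) (by linarith)
  have hhigh : ∑ m ∈ (Finset.Ico L (2 * L)).filter (fun m : ℕ => ¬ (m:ℤ) ≤ τ),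
      (2:ℝ) ^ m * ((4:ℝ) ^ ((m:ℤ) - τ).toNat)⁻¹ *
      ((1 + ((2:ℝ) ^ (min τ m))⁻¹) * ((1 + (2:ℝ) ^ (min τ m) * D) ^ 2)⁻¹) ≤
      2 * min ((2:ℝ) ^ τ) X := by
    set H := (Finset.Ico L (2 * L)).filter (fun m : ℕ => ¬ (m:ℤ) ≤ τ) with hH
    rcases H.eq_empty_or_nonempty with hE | ⟨m₀, hm₀⟩
    · rw [hE, Finset.sum_empty]; positivity
    have hτL : τ < (2 * L : ℕ) := by
      obtain ⟨h1, h2⟩ := Finset.mem_filter.mp hm₀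
      have := Finset.mem_Ico.mp h1
      omega
    have h1 : ∀ m ∈ H, (2:ℝ) ^ m * ((4:ℝ) ^ ((m:ℤ) - τ).toNat)⁻¹ *
      ((1 + ((2:ℝ) ^ (min τ m))⁻¹) * ((1 + (2:ℝ) ^ (min τ m) * D) ^ 2)⁻¹) =
      ((2:ℝ) ^ τ * ((1 + (2:ℝ) ^ τ * D) ^ 2)⁻¹) * ((2 ^ τ + 1) * ((2:ℝ) ^ m)⁻¹) := by
      intro m hm
      obtain ⟨hm1, hm2⟩ := Finset.mem_filter.mp hm
      rw [min_eq_left (by omega)]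
      have e : (4:ℝ) ^ ((m:ℤ) - τ).toNat = (2 ^ m) ^ 2 / (2 ^ τ) ^ 2 := by
        rw [← zpow_natCast, Int.toNat_of_nonneg (by omega), zpow_sub₀ (by norm_num), zpow_natCast,
          show (4:ℝ) = 2 ^ 2 by norm_num, ← pow_mul, ← pow_mul, mul_comm 2 m]
        congr 1
        rw [← zpow_natCast, ← zpow_natCast, ← zpow_mul, ← zpow_mul, mul_comm]
      rw [e]
      have : (2:ℝ) ^ m ≠ 0 := by positivity
      field_simp
    rw [Finset.sum_congr rfl h1, ← Finset.mul_sum, ← Finset.mul_sum]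
    have h2 : (2 ^ τ + 1) * ∑ m ∈ H, ((2:ℝ) ^ m)⁻¹ ≤ 2 := by
      have hs : H ⊆ Finset.Ico ((max 0 τ).toNat + 1) (2 * L + 1) := by
        intro m hm
        obtain ⟨hm1, hm2⟩ := Finset.mem_filter.mp hm
        have := Finset.mem_Ico.mp hm1
        rw [Finset.mem_Ico]; omega
      have h3 : ∑ m ∈ H, ((2:ℝ) ^ m)⁻¹ ≤ ((2:ℝ) ^ (max 0 τ).toNat)⁻¹ := by
        calc _ ≤ ∑ m ∈ Finset.Ico ((max 0 τ).toNat + 1) (2 * L + 1), ((1:ℝ) / 2) ^ m := by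
              refine (Finset.sum_le_sum_of_subset_of_nonneg hs fun i _ _ => by positivity).trans
                (le_of_eq (Finset.sum_congr rfl fun i _ => ?_))
              rw [one_div, inv_pow]
          _ ≤ ((1:ℝ) / 2) ^ ((max 0 τ).toNat + 1) / (1 - 1 / 2) :=
              geom_sum_Ico_le_of_lt_one (by norm_num) (by norm_num)
          _ = _ := by rw [pow_succ, one_div, inv_pow]; ring
      have h4 : (2:ℝ) ^ (max 0 τ).toNat = 2 ^ (max 0 τ) := by
        rw [← zpow_natCast, Int.toNat_of_nonneg (le_max_left _ _)]
      rw [h4] at h3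
      have h5 : (2:ℝ) ^ τ ≤ 2 ^ (max 0 τ) := by gcongr; norm_num; exact le_max_right _ _
      have h6 : (1:ℝ) ≤ 2 ^ (max 0 τ) := one_le_zpow₀ (by norm_num) (le_max_left _ _)
      calc _ ≤ (2 ^ (max 0 τ) + 2 ^ (max 0 τ)) * ((2:ℝ) ^ (max 0 τ))⁻¹ := by
            gcongr
        _ = 2 := by
            have : (2:ℝ) ^ (max 0 τ) ≠ 0 := by positivity
            field_simp; norm_num
    have h7 : (2:ℝ) ^ τ * ((1 + (2:ℝ) ^ τ * D) ^ 2)⁻¹ ≤ min ((2:ℝ) ^ τ) X := by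
      have hTD : 0 ≤ (2:ℝ) ^ τ * D := by positivity
      refine le_min ?_ ?_
      · calc _ ≤ (2:ℝ) ^ τ * (1 ^ 2)⁻¹ := by gcongr; linarith
          _ = _ := by simp
      · have hTL : (2:ℝ) ^ τ ≤ 2 ^ (2 * L) := by
          rw [← zpow_natCast]; gcongr; norm_num
        calc (2:ℝ) ^ τ * ((1 + (2:ℝ) ^ τ * D) ^ 2)⁻¹ ≤ (2:ℝ) ^ τ * (1 + (2:ℝ) ^ τ * D)⁻¹ := by
              gcongr; nlinarith
          _ = (((2:ℝ) ^ τ)⁻¹ + D)⁻¹ := by field_simp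
          _ ≤ X := by
              rw [hX]; gcongr
    calc _ ≤ min ((2:ℝ) ^ τ) X * 2 := by gcongr
      _ = _ := mul_comm _ _
  linarith

lemma LPop_sum {φ₀ : ℝ → ℂ} (hs : ContDiff ℝ (⊤ : ℕ∞) φ₀) (hc : HasCompactSupport φ₀)
    {ι : Type*} (S : Finset ι) (c : ι → ℂ) (g : ι → ℝ → ℂ) (hg : ∀ i ∈ S, Integrable (g i))
    (k : ℕ) (x : ℝ) :
    LPop φ₀ k (fun t => ∑ i ∈ S, c i * g i t) x = ∑ i ∈ S, c i * LPop φ₀ k (g i) x := by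
  obtain ⟨C, -, hK⟩ := exists_decayKernel_lpProfile hs hc
  simp only [LPop_apply, Finset.sum_mul, mul_assoc]
  rw [integral_finsetSum _ fun i hi => (integrable_mul_kernel (hK k) (hg i hi) k x).const_mul (c i)]
  exact Finset.sum_congr rfl fun i _ => integral_const_mul _ _

/-- A superposition of `L` consecutive generations of atoms above each level in `A`. -/
def atomSum (q : ℝ) (L : ℕ) (A : Finset ℕ) (a : ℕ → ℕ → ℕ → ℝ → ℂ) : ℝ → ℂ := fun t =>
  ∑ j ∈ A, (((2:ℝ) ^ ((j:ℝ) * (1 - 1 / q)) : ℝ) : ℂ) *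
    ∑ m ∈ Finset.Ico L (2 * L), (2:ℂ) ^ m * ∑ ν ∈ Finset.range (2 ^ j), 1 * a j m ν t

lemma rpow_mul_min_le_peak {q : ℝ} (hq : 1 < q) (τ : ℤ) {j : ℕ} {X : ℝ} {κ : ℤ}
    (h2 : X ≤ 2 * (2:ℝ) ^ (κ - j)) :
    (2:ℝ) ^ (-(τ:ℝ) * (1 - 1 / q)) * min ((2:ℝ) ^ τ) X ≤
      2 * ((2:ℝ) ^ (((κ:ℝ) - j) / q) *
        ((2:ℝ) ^ (-min (1 / q) (1 - 1 / q))) ^ (κ - (τ + j)).natAbs) := by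
  have hq0 : 0 < q := by linarith
  set b := min (1 / q) (1 - 1 / q) with hb
  have e0 : ((2:ℝ) ^ (-b)) ^ (κ - (τ + j)).natAbs = 2 ^ (-b * |(κ:ℝ) - (τ + j)|) := by
    rw [← rpow_natCast, ← rpow_mul (by norm_num), Nat.cast_natAbs]
    push_cast; rfl
  rw [e0, ← rpow_add (by norm_num)]
  have eτ : (2:ℝ) ^ τ = 2 ^ (τ:ℝ) := (rpow_intCast _ _).symm
  have eκ : (2:ℝ) ^ (κ - j) = 2 ^ ((κ:ℝ) - j) := by rw [← rpow_intCast]; push_cast; rfl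
  rw [eκ] at h2
  rw [eτ]
  rcases le_total (κ:ℝ) (τ + j) with h | h
  · calc _ ≤ (2:ℝ) ^ (-(τ:ℝ) * (1 - 1 / q)) * (2 * (2:ℝ) ^ ((κ:ℝ) - j)) := by
          gcongr; exact (min_le_right _ _).trans h2
      _ = 2 * (2:ℝ) ^ (-(τ:ℝ) * (1 - 1 / q) + ((κ:ℝ) - j)) := by
          rw [rpow_add (by norm_num)]; ring
      _ ≤ _ := by
          refine mul_le_mul_of_nonneg_left
            (rpow_le_rpow_of_exponent_le (by norm_num) ?_) (by norm_num)
          rw [abs_of_nonpos (by linarith)]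
          have : b ≤ 1 - 1 / q := min_le_right _ _
          have h3 : b * (τ + j - κ) ≤ (1 - 1 / q) * (τ + j - κ) :=
            mul_le_mul_of_nonneg_right this (by linarith)
          have e : ((κ:ℝ) - j) / q = (κ - j) * (1 / q) := by ring
          rw [e]; linarith
  · calc _ ≤ (2:ℝ) ^ (-(τ:ℝ) * (1 - 1 / q)) * (2:ℝ) ^ (τ:ℝ) := by
          gcongr; exact min_le_left _ _
      _ = (2:ℝ) ^ (-(τ:ℝ) * (1 - 1 / q) + τ) := by
          rw [rpow_add (by norm_num)]
      _ ≤ (2:ℝ) ^ (((κ:ℝ) - j) / q + -b * |(κ:ℝ) - (τ + j)|) := by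
          refine rpow_le_rpow_of_exponent_le (by norm_num) ?_
          rw [abs_of_nonneg (by linarith)]
          have : b ≤ 1 / q := min_le_left _ _
          have h3 : b * (κ - (τ + j)) ≤ (1 / q) * (κ - (τ + j)) :=
            mul_le_mul_of_nonneg_right this (by linarith)
          have e : ((κ:ℝ) - j) / q = (κ - j) * (1 / q) := by ring
          rw [e]; linarith
      _ ≤ _ := by
          have : 0 < (2:ℝ) ^ (((κ:ℝ) - j) / q + -b * |(κ:ℝ) - (τ + j)|) := by positivity
          linarith

lemma exists_dyadic_exponent {X : ℝ} (hX : 0 < X) (j : ℕ) :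
    ∃ κ : ℤ, (2:ℝ) ^ (κ - j) ≤ X ∧ X ≤ 2 * (2:ℝ) ^ (κ - j) := by
  obtain ⟨n, h1, h2⟩ := exists_mem_Ico_zpow (x := X) (y := (2:ℝ)) hX (by norm_num)
  refine ⟨n + j, by simpa using h1, ?_⟩
  have : (2:ℝ) ^ (n + 1) = 2 * 2 ^ (n + (j:ℤ) - j) := by
    rw [zpow_add_one₀ (by norm_num)]; ring_nf
  rw [← this]; exact h2.le

lemma exists_atomSum_LPop_bound {q : ℝ} {φ₀ : ℝ → ℂ} (hs : ContDiff ℝ (⊤ : ℕ∞) φ₀)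
    (hc : HasCompactSupport φ₀) (K : ℕ) :
    ∃ C : ℝ, 0 < C ∧ ∀ (L : ℕ) (A : Finset ℕ) (a : ℕ → ℕ → ℕ → ℝ → ℂ), 1 ≤ L →
      (∀ j ∈ A, ∀ m ν : ℕ, IsDyadicAtom (j + m) (centre K j ν) (a j m ν)) → ∀ (k : ℕ) (x : ℝ),
      (2:ℝ) ^ ((k:ℝ) * (-1 + 1 / q)) * ‖LPop φ₀ k (atomSum q L A a) x‖ ≤
        C * (1 + |x|)⁻¹ * ∑ j ∈ A, (2:ℝ) ^ (-(((k:ℤ) - j : ℤ):ℝ) * (1 - 1 / q)) *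
          min ((2:ℝ) ^ ((k:ℤ) - j)) (peak L (2 ^ j * x / 2 ^ K)) := by
  obtain ⟨C, hC, hK⟩ := exists_LPop_atom_bound hs hc
  refine ⟨C * (1 + 2 ^ K) * 16, by positivity, fun L A a hL ha k x => ?_⟩
  have hint : ∀ j ∈ A, ∀ m ν, Integrable (a j m ν) := fun j hj m ν => (ha j hj m ν).integrable
  have h2 : ∀ j ∈ A, ∀ m, Integrable fun t => ∑ ν ∈ Finset.range (2 ^ j), 1 * a j m ν t := by
    intro j hj m
    exact integrable_finsetSum _ fun ν _ => (hint j hj m ν).const_mul 1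
  have h3 : ∀ j ∈ A, Integrable fun t => ∑ m ∈ Finset.Ico L (2 * L),
      (2:ℂ) ^ m * ∑ ν ∈ Finset.range (2 ^ j), 1 * a j m ν t := by
    intro j hj
    exact integrable_finsetSum _ fun m _ => (h2 j hj m).const_mul _
  unfold atomSum
  rw [LPop_sum hs hc A _ _ h3]
  have hnorm : ‖∑ j ∈ A, (((2:ℝ) ^ ((j:ℝ) * (1 - 1 / q)) : ℝ) : ℂ) *
      LPop φ₀ k (fun t => ∑ m ∈ Finset.Ico L (2 * L),
        (2:ℂ) ^ m * ∑ ν ∈ Finset.range (2 ^ j), 1 * a j m ν t) x‖ ≤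
      ∑ j ∈ A, (2:ℝ) ^ ((j:ℝ) * (1 - 1 / q)) *
        (C * (1 + 2 ^ K) * 16 * (1 + |x|)⁻¹ *
          min ((2:ℝ) ^ ((k:ℤ) - j)) (peak L (2 ^ j * x / 2 ^ K))) := by
    refine (norm_sum_le _ _).trans (Finset.sum_le_sum fun j hj => ?_)
    rw [norm_mul, Complex.norm_real, norm_of_nonneg (by positivity)]
    gcongr
    rw [LPop_sum hs hc _ _ _ (fun m _ => h2 j hj m)]
    have hm : ∀ m ∈ Finset.Ico L (2 * L), ‖(2:ℂ) ^ m * LPop φ₀ k (fun t =>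
        ∑ ν ∈ Finset.range (2 ^ j), 1 * a j m ν t) x‖ ≤ (C * (1 + 2 ^ K) * 2 * (1 + |x|)⁻¹) *
        ((2:ℝ) ^ m * ((4:ℝ) ^ ((m:ℤ) - ((k:ℤ) - j)).toNat)⁻¹ *
      ((1 + ((2:ℝ) ^ (min ((k:ℤ) - j) m))⁻¹) * ((1 + (2:ℝ) ^ (min ((k:ℤ) - j) m) *
        halfDist (2 ^ j * x / 2 ^ K)) ^ 2)⁻¹)) := by
      intro m _
      rw [norm_mul, norm_pow, Complex.norm_ofNat, LPop_sum hs hc _ _ _ (fun ν _ => hint j hj m ν)]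
      have h4 : ‖∑ ν ∈ Finset.range (2 ^ j), 1 * LPop φ₀ k (a j m ν) x‖ ≤
          C * ((4:ℝ) ^ (j + m - k))⁻¹ * ∑ ν ∈ Finset.range (2 ^ j),
            ((1 + (2:ℝ) ^ (min k (j + m)) * |x - centre K j ν|) ^ 5)⁻¹ := by
        rw [Finset.mul_sum]
        refine (norm_sum_le _ _).trans (Finset.sum_le_sum fun ν _ => ?_)
        rw [one_mul, ← div_eq_mul_inv]
        exact hK k (j + m) _ _ (ha j hj m ν) x
      have h5 := sum_lattice_le K j (min k (j + m)) x
      have e1 : j + m - k = ((m:ℤ) - ((k:ℤ) - j)).toNat := by omega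
      have e2 : (2:ℝ) ^ (min k (j + m)) / 2 ^ j = (2:ℝ) ^ (min ((k:ℤ) - j) m) := by
        rw [← zpow_natCast, ← zpow_natCast, ← zpow_sub₀ (by norm_num)]
        congr 1; omega
      have e3 : (2:ℝ) ^ j / 2 ^ (min k (j + m)) = ((2:ℝ) ^ (min ((k:ℤ) - j) m))⁻¹ := by
        rw [← e2, inv_div]
      rw [e2, e3] at h5
      rw [e1] at h4
      calc _ ≤ (2:ℝ) ^ m * (C * ((4:ℝ) ^ ((m:ℤ) - ((k:ℤ) - j)).toNat)⁻¹ *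
            ((1 + 2 ^ K) * (1 + |x|)⁻¹ *
        (2 * (1 + (2 ^ min ((k:ℤ) - j) m)⁻¹) * ((1 + (2:ℝ) ^ min ((k:ℤ) - j) m *
          halfDist (2 ^ j * x / 2 ^ K)) ^ 2)⁻¹))) := by
            gcongr
            exact h4.trans (mul_le_mul_of_nonneg_left h5 (by positivity))
        _ = _ := by ring
    refine (norm_sum_le _ _).trans ((Finset.sum_le_sum hm).trans ?_)
    rw [← Finset.mul_sum]
    have h6 := sum_relative_levels_le L hL ((k:ℤ) - j) (halfDist_nonneg (2 ^ j * x / 2 ^ K))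
    calc _ ≤ (C * (1 + 2 ^ K) * 2 * (1 + |x|)⁻¹) * (8 * min ((2:ℝ) ^ ((k:ℤ) - j))
            (peak L (2 ^ j * x / 2 ^ K))) := mul_le_mul_of_nonneg_left h6 (by positivity)
      _ = _ := by ring
  calc _ ≤ _ := mul_le_mul_of_nonneg_left hnorm (by positivity)
    _ = _ := by
      rw [Finset.mul_sum, Finset.mul_sum]
      refine Finset.sum_congr rfl fun j _ => ?_
      have : (2:ℝ) ^ (-(((k:ℤ) - j : ℤ):ℝ) * (1 - 1 / q)) =
          (2:ℝ) ^ ((k:ℝ) * (-1 + 1 / q)) * (2:ℝ) ^ ((j:ℝ) * (1 - 1 / q)) := by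
        rw [← rpow_add (by norm_num)]; push_cast; congr 1; ring
      rw [this]; ring

/-- Pointwise control of the square function of a superposition of atoms. -/
lemma exists_atomSum_sum_bound {q : ℝ} (hq : 1 < q) {φ₀ : ℝ → ℂ}
    (hs : ContDiff ℝ (⊤ : ℕ∞) φ₀) (hc : HasCompactSupport φ₀) (K : ℕ) :
    ∃ C : ℝ, 0 < C ∧ ∀ (L : ℕ) (A : Finset ℕ) (a : ℕ → ℕ → ℕ → ℝ → ℂ), 1 ≤ L →
      (∀ j ∈ A, ∀ m ν : ℕ, IsDyadicAtom (j + m) (centre K j ν) (a j m ν)) → ∀ (S : Finset ℕ) (x : ℝ),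
      ∑ k ∈ S, (2:ℝ) ^ ((k:ℝ) * (-1 + 1 / q) * q) * ‖LPop φ₀ k (atomSum q L A a) x‖ ^ q ≤
        C * ((1 + |x|)⁻¹) ^ q * ∑ j ∈ A, peak L (2 ^ j * x / 2 ^ K) := by
  have hq0 : 0 < q := by linarith
  have hqi : 0 < 1 / q := by positivity
  have hqi1 : 1 / q < 1 := by rw [div_lt_one hq0]; exact hq
  obtain ⟨C₁, hC₁, h₁⟩ := exists_atomSum_LPop_bound (q := q) hs hc K
  set ρ := (2:ℝ) ^ (-min (1 / q) (1 - 1 / q)) with hρ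
  have hρ0 : 0 < ρ := by positivity
  have hρ1 : ρ < 1 := Real.rpow_lt_one_of_one_lt_of_neg (by norm_num) (by
    have : 0 < min (1 / q) (1 - 1 / q) := lt_min hqi (by linarith)
    linarith)
  obtain ⟨C₂, hC₂, h₂⟩ := sum_rpow_peaks_le hq hρ0 hρ1
  refine ⟨(C₁ * 2) ^ q * C₂, by positivity, fun L A a hL ha S x => ?_⟩
  choose κ hκ1 hκ2 using fun j : ℕ => exists_dyadic_exponent (peak_pos L (2 ^ j * x / 2 ^ K)) j
  have hk : ∀ k ∈ S, (2:ℝ) ^ ((k:ℝ) * (-1 + 1 / q) * q) * ‖LPop φ₀ k (atomSum q L A a) x‖ ^ q ≤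
      ((C₁ * 2) ^ q * ((1 + |x|)⁻¹) ^ q) *
        (∑ j ∈ A, (2:ℝ) ^ (((κ j:ℝ) - j) / q) * ρ ^ ((κ j - k).natAbs)) ^ q := by
    intro k _
    have h0 : 0 ≤ ∑ j ∈ A, (2:ℝ) ^ (((κ j:ℝ) - j) / q) * ρ ^ ((κ j - k).natAbs) :=
      Finset.sum_nonneg fun j _ => by positivity
    rw [← mul_rpow (by positivity) (by positivity), ← mul_rpow (by positivity) h0,
      rpow_mul (by norm_num), ← mul_rpow (by positivity) (by positivity)]
    refine rpow_le_rpow (by positivity) ?_ hq0.le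
    refine (h₁ L A a hL ha k x).trans ?_
    calc _ ≤ C₁ * (1 + |x|)⁻¹ * ∑ j ∈ A, 2 * ((2:ℝ) ^ (((κ j:ℝ) - j) / q) *
          ρ ^ ((κ j - k).natAbs)) := by
          refine mul_le_mul_of_nonneg_left (Finset.sum_le_sum fun j hj => ?_) (by positivity)
          have := rpow_mul_min_le_peak hq ((k:ℤ) - j) (hκ2 j)
          rwa [sub_add_cancel] at this
      _ = _ := by rw [← Finset.mul_sum]; ring
  refine (Finset.sum_le_sum hk).trans ?_
  rw [← Finset.mul_sum]
  calc _ ≤ ((C₁ * 2) ^ q * ((1 + |x|)⁻¹) ^ q) * (C₂ * ∑ j ∈ A, (2:ℝ) ^ ((κ j:ℝ) - j)) := by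
        gcongr; exact h₂ A κ S
    _ ≤ ((C₁ * 2) ^ q * ((1 + |x|)⁻¹) ^ q) * (C₂ * ∑ j ∈ A, peak L (2 ^ j * x / 2 ^ K)) := by
        gcongr with j hj
        refine le_trans (le_of_eq ?_) (hκ1 j)
        rw [← rpow_intCast]; push_cast; rfl
    _ = _ := by ring

lemma lintegral_comp_pos_mul {c : ℝ} (hc : 0 < c) {f : ℝ → ℝ≥0∞} (hf : Measurable f) :
    ∫⁻ u, f (c * u) = ENNReal.ofReal c⁻¹ * ∫⁻ u, f u := by
  have h := lintegral_map (μ := volume) hf (measurable_const_mul c)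
  rw [Real.map_volume_mul_left hc.ne', lintegral_smul_measure, abs_of_pos (inv_pos.mpr hc)] at h
  exact h.symm

lemma setLIntegral_Ico_of_periodic {H : ℝ → ℝ≥0∞} (hH : Function.Periodic H 1) (i : ℤ) :
    ∫⁻ u in Set.Ico (i:ℝ) (i + 1), H u = ∫⁻ u in Set.Ico (0:ℝ) 1, H u := by
  rw [← lintegral_indicator measurableSet_Ico, ← lintegral_indicator measurableSet_Ico,
    ← lintegral_add_right_eq_self _ (i:ℝ)]
  congr 1; ext x
  have e : H (x + i) = H x := by simpa using (hH.int_mul i) x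
  simp only [Set.indicator, Set.mem_Ico, e]
  congr 1
  simp only [le_add_iff_nonneg_left, eq_iff_iff]
  constructor <;> rintro ⟨h1, h2⟩ <;> exact ⟨by linarith, by linarith⟩

lemma setLIntegral_Ico_floor {H : ℝ → ℝ≥0∞} (hm : Measurable H) (hH : Function.Periodic H 1)
    (Φ : ℤ → ℝ≥0∞) (N : ℕ) :
    ∫⁻ u in Set.Ico (0:ℝ) N, Φ ⌊u⌋ * H u =
      (∑ i ∈ Finset.range N, Φ i) * ∫⁻ u in Set.Ico (0:ℝ) 1, H u := by
  induction N with
  | zero => simp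
  | succ N ih =>
    have hu : Set.Ico (0:ℝ) ((N + 1 : ℕ):ℝ) = Set.Ico (0:ℝ) N ∪ Set.Ico (N:ℝ) (N + 1) := by
      push_cast
      rw [Set.Ico_union_Ico_eq_Ico (by positivity) (by linarith)]
    rw [hu, lintegral_union measurableSet_Ico
      (Set.disjoint_left.mpr fun x h1 h2 => absurd h1.2 (not_lt.mpr h2.1)), ih,
      Finset.sum_range_succ, add_mul]
    congr 1
    have h1 : ∫⁻ u in Set.Ico (N:ℝ) (N + 1), Φ ⌊u⌋ * H u =
        ∫⁻ u in Set.Ico (N:ℝ) (N + 1), H u * Φ N := by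
      refine setLIntegral_congr_fun measurableSet_Ico fun u hu => ?_
      have : ⌊u⌋ = (N:ℤ) := Int.floor_eq_iff.mpr (by simpa using hu)
      simp only [this, mul_comm]
    have h2 := setLIntegral_Ico_of_periodic (H := fun u => H u * Φ N)
      (fun u => by simp only [hH u]) N
    simp only [Int.cast_natCast] at h2
    rw [h1, h2, lintegral_mul_const _ hm, mul_comm]

/-- A function of the first `d` binary digits is independent of the remaining digits. -/
lemma setLIntegral_digits_mul {H : ℝ → ℝ≥0∞} (hm : Measurable H) (hH : Function.Periodic H 1)
    (Φ : ℤ → ℝ≥0∞) (d : ℕ) :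
    ∫⁻ u in Set.Ico (0:ℝ) 1, Φ ⌊(2:ℝ) ^ d * u⌋ * H (2 ^ d * u) =
      ENNReal.ofReal ((2 ^ d)⁻¹) * (∑ i ∈ Finset.range (2 ^ d), Φ i) *
        ∫⁻ u in Set.Ico (0:ℝ) 1, H u := by
  have hΦ : Measurable fun u : ℝ => Φ ⌊u⌋ := (measurable_from_top (f := Φ)).comp Int.measurable_floor
  rw [mul_assoc, ← setLIntegral_Ico_floor hm hH, ← lintegral_indicator measurableSet_Ico,
    ← lintegral_indicator measurableSet_Ico, ← lintegral_comp_pos_mul (by positivity)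
      (f := Set.indicator _ fun u => Φ ⌊u⌋ * H u) ((hΦ.mul hm).indicator measurableSet_Ico)]
  congr 1; ext u
  simp only [Set.indicator, Set.mem_Ico]
  congr 1
  have : (0:ℝ) < 2 ^ d := by positivity
  simp only [Nat.cast_pow, Nat.cast_ofNat, eq_iff_iff]
  rw [mul_nonneg_iff_of_pos_left this, mul_lt_iff_lt_one_right this]

lemma setLIntegral_dilate {H : ℝ → ℝ≥0∞} (hm : Measurable H) (hH : Function.Periodic H 1) (a : ℕ) :
    ∫⁻ u in Set.Ico (0:ℝ) 1, H (2 ^ a * u) = ∫⁻ u in Set.Ico (0:ℝ) 1, H u := by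
  have := setLIntegral_digits_mul hm hH (fun _ => 1) a
  simp only [one_mul, Finset.sum_const, Finset.card_range, nsmul_eq_mul, mul_one] at this
  rw [this]
  have h : ENNReal.ofReal ((2 ^ a)⁻¹) * ((2 ^ a : ℕ) : ℝ≥0∞) = 1 := by
    rw [← ENNReal.ofReal_natCast, ← ENNReal.ofReal_mul (by positivity)]
    simp
  rw [h, one_mul]

lemma Function.Periodic.comp_nat_dilate {β : Type*} {H : ℝ → β} (hH : Function.Periodic H 1) (a : ℕ) :
    Function.Periodic (fun u => H (2 ^ a * u)) 1 := by
  intro u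
  have := (hH.nat_mul (2 ^ a)) (2 ^ a * u)
  simp only [mul_one, Nat.cast_pow, Nat.cast_ofNat] at this
  simp only [mul_add, mul_one, this]

/-- Functions of disjoint blocks of binary digits are independent. -/
lemma setLIntegral_prod_digits (F : ℝ → ℝ≥0∞) (hF : Function.Periodic F 1)
    (d : ℕ) (Φ : ℤ → ℝ≥0∞) (hΦ : ∀ u, F u = Φ ⌊(2:ℝ) ^ d * u⌋) (B : Finset ℕ)
    (hB : ∀ i ∈ B, ∀ j ∈ B, i < j → i + d ≤ j) :
    ∫⁻ u in Set.Ico (0:ℝ) 1, ∏ j ∈ B, F (2 ^ j * u) =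
      (ENNReal.ofReal ((2 ^ d)⁻¹) * ∑ i ∈ Finset.range (2 ^ d), Φ i) ^ B.card := by
  have hFm : Measurable F := by
    rw [funext hΦ]
    exact (measurable_from_top (f := Φ)).comp
      (Int.measurable_floor.comp (measurable_const_mul ((2:ℝ) ^ d)))
  induction B using Finset.induction_on_min with
  | empty => simp
  | insert a s ha ih =>
    have has : a ∉ s := fun h => (ha a h).false
    set H : ℝ → ℝ≥0∞ := fun u => ∏ j ∈ s, F (2 ^ (j - (a + d)) * u) with hH
    have hHm : Measurable H := Finset.measurable_prod _ fun j _ =>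
      hFm.comp (measurable_const_mul _)
    have hHp : Function.Periodic H 1 := fun u =>
      Finset.prod_congr rfl fun j _ => (hF.comp_nat_dilate (j - (a + d))) u
    have hs : ∀ u, ∏ j ∈ s, F (2 ^ j * u) = H (2 ^ (a + d) * u) := by
      intro u
      refine Finset.prod_congr rfl fun j hj => ?_
      rw [← mul_assoc, ← pow_add]
      congr 3
      have := hB a (Finset.mem_insert_self _ _) j (Finset.mem_insert_of_mem hj) (ha j hj)
      omega
    have ih' := ih fun i hi j hj => hB i (Finset.mem_insert_of_mem hi) j (Finset.mem_insert_of_mem hj)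
    simp only [hs] at ih'
    rw [setLIntegral_dilate hHm hHp] at ih'
    simp only [Finset.prod_insert has, hs]
    have h1 := setLIntegral_dilate (H := fun u => F u * H (2 ^ d * u))
      (hFm.mul (hHm.comp (measurable_const_mul _)))
      (fun u => by simp only [hF u, hHp.comp_nat_dilate d u]) a
    have e : ∀ u : ℝ, F (2 ^ a * u) * H (2 ^ (a + d) * u) =
        (fun u => F u * H (2 ^ d * u)) (2 ^ a * u) := by
      intro u
      simp only [← mul_assoc, ← pow_add, add_comm d a]
    simp only [e]
    rw [h1]
    simp only [hΦ]
    rw [setLIntegral_digits_mul hHm hHp, ih', Finset.card_insert_of_notMem has, pow_succ, mul_comm]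

lemma halfDist_sub_le (t v : ℝ) : halfDist v ≤ halfDist t + |t - v| := by
  refine (halfDist_le v ⌊t⌋).trans ?_
  have h : halfDist t = |(⌊t⌋:ℝ) - (t - 1 / 2)| := by
    rw [halfDist, ← abs_neg]
    congr 1
    have := Int.floor_add_fract t
    linarith
  rw [h]
  have e : (⌊t⌋:ℝ) - (v - 1 / 2) = ((⌊t⌋:ℝ) - (t - 1 / 2)) + (t - v) := by ring
  rw [e]
  exact abs_add_le _ _

lemma peak_periodic (L : ℕ) : Function.Periodic (peak L) 1 := by
  intro t
  simp only [peak, halfDist, Int.fract_add_one]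

lemma measurable_peak (L : ℕ) : Measurable (peak L) := by
  unfold peak halfDist
  have : Measurable fun t : ℝ => Int.fract t := measurable_fract
  fun_prop

lemma peak_le_pow (L : ℕ) (t : ℝ) : peak L t ≤ 2 ^ (2 * L) := by
  have h := halfDist_nonneg t
  rw [peak]
  calc _ ≤ (((2:ℝ) ^ (2 * L))⁻¹)⁻¹ := by gcongr; linarith
    _ = _ := inv_inv _

lemma peak_le_two_mul_peak_floor (L : ℕ) (t : ℝ) :
    peak L t ≤ 2 * peak L ((⌊(2:ℝ) ^ (2 * L) * t⌋:ℝ) / 2 ^ (2 * L)) := by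
  set N : ℝ := 2 ^ (2 * L) with hN
  have hN0 : 0 < N := by positivity
  set v : ℝ := (⌊N * t⌋:ℝ) / N with hv
  have h1 : |t - v| ≤ N⁻¹ := by
    have a := Int.floor_le (N * t)
    have b := Int.lt_floor_add_one (N * t)
    have e : t - v = (N * t - ⌊N * t⌋) * N⁻¹ := by rw [hv]; field_simp
    rw [e, abs_of_nonneg (mul_nonneg (by linarith) (by positivity))]
    exact mul_le_of_le_one_left (by positivity) (by linarith)
  have h2 := halfDist_sub_le t v
  have h3 := halfDist_nonneg t
  have h4 := halfDist_nonneg v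
  rw [peak, peak, ← hN]
  have : N⁻¹ + halfDist v ≤ 2 * (N⁻¹ + halfDist t) := by linarith
  calc (N⁻¹ + halfDist t)⁻¹ = 2 * (2 * (N⁻¹ + halfDist t))⁻¹ := by
        rw [mul_inv]; ring
    _ ≤ _ := by gcongr

lemma sum_peak_grid_le (L : ℕ) (hL : 1 ≤ L) :
    ∑ i ∈ Finset.range (2 ^ (2 * L)), 2 * peak L ((i:ℝ) / 2 ^ (2 * L)) ≤
      2 ^ (2 * L) * (12 * L) := by
  set M : ℕ := 2 ^ (2 * L) with hM
  have hMr : ((2:ℝ) ^ (2 * L)) = M := by rw [hM]; push_cast; rfl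
  have hM0 : 0 < M := by positivity
  have hM0' : (0:ℝ) < M := by exact_mod_cast hM0
  set F : ℕ → ℝ := fun i => if i < M then ((i:ℝ) + 1)⁻¹ else 0 with hF
  have hharm : ∑ i ∈ Finset.range M, ((i:ℝ) + 1)⁻¹ ≤ 3 * L := by
    have h := harmonic_le_one_add_log M
    have e : ((harmonic M : ℚ):ℝ) = ∑ i ∈ Finset.range M, ((i:ℝ) + 1)⁻¹ := by
      simp [harmonic]
    rw [e] at h
    have h2 : Real.log M ≤ 2 * L := by
      rw [← hMr, Real.log_pow]
      have : Real.log 2 ≤ 1 := by linarith [Real.log_two_lt_d9]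
      push_cast
      nlinarith [(Nat.cast_nonneg L : (0:ℝ) ≤ L)]
    have : (1:ℝ) ≤ L := by exact_mod_cast hL
    linarith
  have hFB : ∀ n, ∑ i ∈ Finset.range n, F i ≤ 3 * L := by
    intro n
    refine le_trans ?_ hharm
    simp only [hF, ← Finset.sum_filter]
    refine Finset.sum_le_sum_of_subset_of_nonneg (fun i hi => ?_) fun i _ _ => by positivity
    simp only [Finset.mem_filter] at hi
    exact Finset.mem_range.mpr hi.2
  have key := sum_int_floor_le ((Finset.range M).map Nat.castEmbedding) ((M:ℝ) / 2) (F := F)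
    (fun i => by simp only [hF]; split_ifs <;> positivity) hFB
  rw [Finset.sum_map] at key
  have hterm : ∀ i ∈ Finset.range M, 2 * peak L ((i:ℝ) / 2 ^ (2 * L)) ≤
      2 * M * F ⌊|(((Nat.castEmbedding i : ℤ)):ℝ) - (M:ℝ) / 2|⌋₊ := by
    intro i hi
    have hiM : (i:ℝ) < M := by exact_mod_cast Finset.mem_range.mp hi
    have h0 : (0:ℝ) ≤ i := by positivity
    have hfr : Int.fract ((i:ℝ) / M) = (i:ℝ) / M :=
      Int.fract_eq_self.mpr ⟨by positivity, by rwa [div_lt_one hM0']⟩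
    simp only [Nat.castEmbedding_apply, Int.cast_natCast]
    set a := |(i:ℝ) - (M:ℝ) / 2| with ha
    have ha0 : 0 ≤ a := abs_nonneg _
    have haM : a < M := by rw [ha, abs_lt]; constructor <;> linarith
    have hfl : ⌊a⌋₊ < M := (Nat.floor_lt ha0).mpr haM
    simp only [hF, if_pos hfl]
    have e : peak L ((i:ℝ) / M) = M * (a + 1)⁻¹ := by
      rw [peak, halfDist, hfr, hMr]
      have : (i:ℝ) / M - 1 / 2 = ((i:ℝ) - M / 2) * (M:ℝ)⁻¹ := by field_simp
      rw [this, abs_mul, abs_of_pos (inv_pos.mpr hM0'), ← ha]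
      field_simp; ring
    rw [hMr, e, mul_assoc 2 (M:ℝ)]
    gcongr
    exact Nat.floor_le ha0
  calc _ ≤ ∑ i ∈ Finset.range M, 2 * M * F ⌊|(((Nat.castEmbedding i : ℤ)):ℝ) - (M:ℝ) / 2|⌋₊ :=
        Finset.sum_le_sum hterm
    _ ≤ 2 * M * (2 * (3 * L)) := by
        rw [← Finset.mul_sum]
        exact mul_le_mul_of_nonneg_left key (by positivity)
    _ = _ := by rw [hMr]; ring

/-- Exponential moments of sums of peaks over separated levels. -/
lemma setLIntegral_exp_peak_le (L : ℕ) (hL : 1 ≤ L) (B : Finset ℕ)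
    (hB : ∀ i ∈ B, ∀ j ∈ B, i < j → i + 2 * L ≤ j) :
    ∫⁻ u in Set.Ico (0:ℝ) 1, ENNReal.ofReal (exp ((2 * 2 ^ (2 * L))⁻¹ *
        ∑ j ∈ B, peak L (2 ^ j * u))) ≤
      ENNReal.ofReal (exp ((2 * 2 ^ (2 * L))⁻¹ * (24 * L * B.card))) := by
  set lam : ℝ := (2 * 2 ^ (2 * L))⁻¹ with hlam
  have hlam0 : 0 < lam := by positivity
  set Φ : ℤ → ℝ≥0∞ := fun i => ENNReal.ofReal (exp (lam * (2 * peak L ((i:ℝ) / 2 ^ (2 * L))))) with hΦ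
  set F : ℝ → ℝ≥0∞ := fun u => Φ ⌊(2:ℝ) ^ (2 * L) * u⌋ with hF
  have hFp : Function.Periodic F 1 := by
    intro u
    simp only [hF, hΦ]
    have e : (2:ℝ) ^ (2 * L) * (u + 1) = (2:ℝ) ^ (2 * L) * u + ((2 ^ (2 * L) : ℤ) : ℝ) := by
      push_cast; ring
    rw [e, Int.floor_add_intCast]
    congr 4
    push_cast
    rw [add_div, div_self (by positivity)]
    exact peak_periodic L _
  have h1 := setLIntegral_prod_digits F hFp (2 * L) Φ (fun u => rfl) B hB
  have h2 : ENNReal.ofReal ((2 ^ (2 * L))⁻¹) * ∑ i ∈ Finset.range (2 ^ (2 * L)), Φ i ≤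
      ENNReal.ofReal (exp (lam * (24 * L))) := by
    simp only [hΦ, Int.cast_natCast]
    rw [← ENNReal.ofReal_sum_of_nonneg fun i _ => (exp_pos _).le,
      ← ENNReal.ofReal_mul (by positivity)]
    apply ENNReal.ofReal_le_ofReal
    have h3 : ∀ i ∈ Finset.range (2 ^ (2 * L)), exp (lam * (2 * peak L ((i:ℝ) / 2 ^ (2 * L)))) ≤
        1 + 2 * lam * (2 * peak L ((i:ℝ) / 2 ^ (2 * L))) := by
      intro i _
      set y := lam * (2 * peak L ((i:ℝ) / 2 ^ (2 * L))) with hy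
      have hy0 : 0 ≤ y := by have := peak_pos L ((i:ℝ) / 2 ^ (2 * L)); positivity
      have hy1 : y ≤ 1 := by
        have := peak_le_pow L ((i:ℝ) / 2 ^ (2 * L))
        calc y ≤ lam * (2 * 2 ^ (2 * L)) := by rw [hy]; gcongr
          _ = 1 := by rw [hlam]; field_simp
      have := (abs_le.mp (Real.abs_exp_sub_one_sub_id_le (x := y)
        (by rwa [abs_of_nonneg hy0]))).2
      have hsq : y ^ 2 ≤ y := by nlinarith
      have : 2 * lam * (2 * peak L ((i:ℝ) / 2 ^ (2 * L))) = 2 * y := by rw [hy]; ring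
      linarith
    calc _ ≤ ((2:ℝ) ^ (2 * L))⁻¹ * (2 ^ (2 * L) + 2 * lam * (2 ^ (2 * L) * (12 * L))) := by
          refine mul_le_mul_of_nonneg_left ((Finset.sum_le_sum h3).trans ?_) (by positivity)
          rw [Finset.sum_add_distrib, ← Finset.mul_sum]
          simp only [Finset.sum_const, Finset.card_range, nsmul_eq_mul, mul_one]
          push_cast
          have := sum_peak_grid_le L hL
          gcongr
      _ = lam * (24 * L) + 1 := by field_simp; ring
      _ ≤ _ := add_one_le_exp _
  calc _ ≤ ∫⁻ u in Set.Ico (0:ℝ) 1, ∏ j ∈ B, F (2 ^ j * u) := by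
        refine lintegral_mono fun u => ?_
        simp only [Finset.mul_sum, exp_sum]
        rw [ENNReal.ofReal_prod_of_nonneg fun i _ => (exp_pos _).le]
        refine Finset.prod_le_prod' fun j _ => ?_
        simp only [hF, hΦ]
        gcongr
        exact peak_le_two_mul_peak_floor L _
    _ ≤ (ENNReal.ofReal (exp (lam * (24 * L)))) ^ B.card := by
        rw [h1]; gcongr
    _ = _ := by
        rw [← ENNReal.ofReal_pow (exp_pos _).le, ← exp_nat_mul]
        congr 2; ring

lemma rpow_le_add_exp {r y κ : ℝ} (hr : 0 < r) (hy : 0 ≤ y) (hκ : 0 ≤ κ) :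
    y ^ r ≤ (2 * κ) ^ r + (2 * r) ^ r * (exp (-κ) * exp y) := by
  rcases le_total y (2 * κ) with h | h
  · have : y ^ r ≤ (2 * κ) ^ r := by gcongr
    have h2 : 0 ≤ (2 * r) ^ r * (exp (-κ) * exp y) := by positivity
    linarith
  · have h1 : y ≤ 2 * r * exp (y / (2 * r)) := by
      have := add_one_le_exp (y / (2 * r))
      have e : y = 2 * r * (y / (2 * r)) := by field_simp
      calc y = 2 * r * (y / (2 * r)) := e
        _ ≤ _ := by gcongr; linarith
    have h2 : y ^ r ≤ (2 * r) ^ r * exp (y / 2) := by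
      calc y ^ r ≤ (2 * r * exp (y / (2 * r))) ^ r := by gcongr
        _ = _ := by
          rw [mul_rpow (by positivity) (exp_pos _).le, ← exp_mul]
          congr 2; field_simp
    have h3 : exp (y / 2) ≤ exp (-κ) * exp y := by
      rw [← exp_add]; gcongr; linarith
    have h4 : 0 ≤ (2 * κ) ^ r := by positivity
    have h5 : (2 * r) ^ r * exp (y / 2) ≤ (2 * r) ^ r * (exp (-κ) * exp y) := by gcongr
    linarith

lemma setLIntegral_rpow_peak_separated_le {r : ℝ} (hr : 1 ≤ r) (L : ℕ) (hL : 1 ≤ L) (B : Finset ℕ)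
    (hB : ∀ i ∈ B, ∀ j ∈ B, i < j → i + 2 * L ≤ j) :
    ∫⁻ u in Set.Ico (0:ℝ) 1, ENNReal.ofReal ((∑ j ∈ B, peak L (2 ^ j * u)) ^ r) ≤
      ENNReal.ofReal (2 * ((48 + 4 * r) * (L * B.card + 2 ^ (2 * L))) ^ r) := by
  have hr0 : 0 < r := by linarith
  set lam : ℝ := (2 * 2 ^ (2 * L))⁻¹ with hlam
  have hlam0 : 0 < lam := by positivity
  set κ : ℝ := lam * (24 * L * B.card) with hκ
  have hκ0 : 0 ≤ κ := by positivity
  have hexp := setLIntegral_exp_peak_le L hL B hB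
  rw [← hlam, ← hκ] at hexp
  have hpt : ∀ u : ℝ, ENNReal.ofReal ((∑ j ∈ B, peak L (2 ^ j * u)) ^ r) ≤
      ENNReal.ofReal ((lam⁻¹ * (2 * κ)) ^ r) + ENNReal.ofReal ((lam⁻¹ * (2 * r)) ^ r * exp (-κ)) *
        ENNReal.ofReal (exp (lam * ∑ j ∈ B, peak L (2 ^ j * u))) := by
    intro u
    have hS : 0 ≤ ∑ j ∈ B, peak L (2 ^ j * u) := Finset.sum_nonneg fun j _ => (peak_pos L _).le
    rw [← ENNReal.ofReal_mul (by positivity), ← ENNReal.ofReal_add (by positivity) (by positivity)]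
    apply ENNReal.ofReal_le_ofReal
    set S := ∑ j ∈ B, peak L (2 ^ j * u)
    have h := rpow_le_add_exp hr0 (by positivity : 0 ≤ lam * S) hκ0
    have e : S ^ r = lam⁻¹ ^ r * (lam * S) ^ r := by
      rw [← mul_rpow (by positivity) (by positivity)]
      congr 1; field_simp
    rw [e, mul_rpow (x := lam⁻¹) (y := 2 * κ) (by positivity) (by positivity),
      mul_rpow (x := lam⁻¹) (y := 2 * r) (by positivity) (by positivity)]
    calc _ ≤ lam⁻¹ ^ r * ((2 * κ) ^ r + (2 * r) ^ r * (exp (-κ) * exp (lam * S))) := by gcongr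
      _ = _ := by ring
  have hmS : Measurable fun u : ℝ => ENNReal.ofReal (exp (lam * ∑ j ∈ B, peak L (2 ^ j * u))) := by
    have : ∀ j ∈ B, Measurable fun u : ℝ => peak L (2 ^ j * u) :=
      fun j _ => (measurable_peak L).comp (measurable_const_mul _)
    have := Finset.measurable_sum B this
    fun_prop
  calc _ ≤ ∫⁻ u in Set.Ico (0:ℝ) 1, (ENNReal.ofReal ((lam⁻¹ * (2 * κ)) ^ r) +
        ENNReal.ofReal ((lam⁻¹ * (2 * r)) ^ r * exp (-κ)) *
        ENNReal.ofReal (exp (lam * ∑ j ∈ B, peak L (2 ^ j * u)))) := lintegral_mono hpt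
    _ = ENNReal.ofReal ((lam⁻¹ * (2 * κ)) ^ r) + ENNReal.ofReal ((lam⁻¹ * (2 * r)) ^ r * exp (-κ)) *
        ∫⁻ u in Set.Ico (0:ℝ) 1, ENNReal.ofReal (exp (lam * ∑ j ∈ B, peak L (2 ^ j * u))) := by
        rw [lintegral_add_left measurable_const, lintegral_const_mul _ hmS]
        simp
    _ ≤ ENNReal.ofReal ((lam⁻¹ * (2 * κ)) ^ r) + ENNReal.ofReal ((lam⁻¹ * (2 * r)) ^ r * exp (-κ)) *
        ENNReal.ofReal (exp κ) := by gcongr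
    _ = ENNReal.ofReal ((lam⁻¹ * (2 * κ)) ^ r + (lam⁻¹ * (2 * r)) ^ r) := by
        rw [← ENNReal.ofReal_mul (by positivity), ← ENNReal.ofReal_add (by positivity) (by positivity),
          mul_assoc, ← exp_add, neg_add_cancel, exp_zero, mul_one]
    _ ≤ _ := by
        apply ENNReal.ofReal_le_ofReal
        have e1 : lam⁻¹ * (2 * κ) = 48 * (L * B.card) := by
          rw [hκ]; field_simp; ring
        have e2 : lam⁻¹ * (2 * r) = 4 * r * 2 ^ (2 * L) := by
          rw [hlam, inv_inv]; ring
        rw [e1, e2]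
        have hn : (0:ℝ) ≤ L * B.card := by positivity
        have hp : (0:ℝ) ≤ 2 ^ (2 * L) := by positivity
        set Z := (48 + 4 * r) * ((L:ℝ) * B.card + 2 ^ (2 * L)) with hZ
        have h1 : (48 * ((L:ℝ) * B.card)) ^ r ≤ Z ^ r := by
          refine rpow_le_rpow (by positivity) ?_ hr0.le
          rw [hZ]; nlinarith [mul_nonneg hr0.le hn, mul_nonneg hr0.le hp]
        have h2 : (4 * r * 2 ^ (2 * L)) ^ r ≤ Z ^ r := by
          refine rpow_le_rpow (by positivity) ?_ hr0.le
          rw [hZ]; nlinarith [mul_nonneg hr0.le hn, mul_nonneg hr0.le hp]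
        linarith

/-- The moments of a sum of at most `n` peaks are governed by the mean. -/
lemma exists_setLIntegral_rpow_peak_le {r : ℝ} (hr : 1 ≤ r) :
    ∃ C : ℝ, 0 < C ∧ ∀ (L n : ℕ) (A : Finset ℕ), 1 ≤ L → 1 ≤ n → A.card ≤ n →
      2 ^ (2 * L) ≤ 4 * n →
      ∫⁻ u in Set.Ico (0:ℝ) 1, ENNReal.ofReal ((∑ j ∈ A, peak L (2 ^ j * u)) ^ r) ≤
        ENNReal.ofReal (C * ((L:ℝ) * n) ^ r) := by
  have hr0 : 0 < r := by linarith
  refine ⟨2 * ((48 + 4 * r) * 8) ^ r * 2 ^ r, by positivity, fun L n A hL hn hAn hLn => ?_⟩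
  have hL0 : (0:ℝ) < L := by exact_mod_cast hL
  have hn0 : (0:ℝ) < n := by exact_mod_cast hn
  set d := 2 * L with hd
  have hd0 : 0 < d := by omega
  set cls : ℕ → Finset ℕ := fun b => A.filter fun j => j % d = b with hcls
  set w : ℕ → ℝ := fun b => (n:ℝ) / d + (cls b).card with hw
  have hdr : (0:ℝ) < d := by exact_mod_cast hd0
  have hw0 : ∀ b, 0 < w b := fun b => by simp only [hw]; positivity
  have hmaps : ∀ j ∈ A, j % d ∈ Finset.range d := fun j _ =>
    Finset.mem_range.mpr (Nat.mod_lt _ hd0)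
  have hwsum : ∑ b ∈ Finset.range d, w b ≤ 2 * n := by
    simp only [hw]
    rw [Finset.sum_add_distrib, Finset.sum_const, Finset.card_range, nsmul_eq_mul,
      mul_div_cancel₀ _ hdr.ne', two_mul]
    have : ∑ b ∈ Finset.range d, ((cls b).card:ℝ) = A.card := by
      rw [Finset.card_eq_sum_card_fiberwise hmaps]; push_cast; rfl
    rw [this]
    have : (A.card:ℝ) ≤ n := by exact_mod_cast hAn
    linarith
  have hpt : ∀ u : ℝ, ENNReal.ofReal ((∑ j ∈ A, peak L (2 ^ j * u)) ^ r) ≤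
      ∑ b ∈ Finset.range d, ENNReal.ofReal ((2 * n) ^ (r - 1) * (w b * (w b)⁻¹ ^ r)) *
        ENNReal.ofReal ((∑ j ∈ cls b, peak L (2 ^ j * u)) ^ r) := by
    intro u
    have hS : ∀ b, 0 ≤ ∑ j ∈ cls b, peak L (2 ^ j * u) := fun b =>
      Finset.sum_nonneg fun j _ => (peak_pos L _).le
    have h1 := rpow_sum_mul_le hr (Finset.range d) (w := w)
      (f := fun b => (w b)⁻¹ * ∑ j ∈ cls b, peak L (2 ^ j * u)) (fun b => (hw0 b).le)
      (fun b => mul_nonneg (inv_nonneg.mpr (hw0 b).le) (hS b)) hwsum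
    have e1 : ∑ b ∈ Finset.range d, w b * ((w b)⁻¹ * ∑ j ∈ cls b, peak L (2 ^ j * u)) =
        ∑ j ∈ A, peak L (2 ^ j * u) := by
      rw [← Finset.sum_fiberwise_of_maps_to hmaps]
      refine Finset.sum_congr rfl fun b _ => ?_
      rw [← mul_assoc, mul_inv_cancel₀ (hw0 b).ne', one_mul]
    rw [e1] at h1
    refine (ENNReal.ofReal_le_ofReal h1).trans (le_of_eq ?_)
    rw [Finset.mul_sum, ENNReal.ofReal_sum_of_nonneg]
    · refine Finset.sum_congr rfl fun b _ => ?_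
      have := (hw0 b).le
      rw [← ENNReal.ofReal_mul (by positivity), mul_rpow (by positivity) (hS b)]
      congr 1; ring
    · intro b _
      have := (hw0 b).le
      have := hS b
      positivity
  have hmeas : ∀ b, Measurable fun u : ℝ =>
      ENNReal.ofReal ((∑ j ∈ cls b, peak L (2 ^ j * u)) ^ r) := by
    intro b
    have : ∀ j ∈ cls b, Measurable fun u : ℝ => peak L (2 ^ j * u) :=
      fun j _ => (measurable_peak L).comp (measurable_const_mul _)
    have := Finset.measurable_sum (cls b) this
    fun_prop
  have hsep : ∀ b, ∀ i ∈ cls b, ∀ j ∈ cls b, i < j → i + 2 * L ≤ j := by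
    intro b i hi j hj hij
    have h1 := (Finset.mem_filter.mp hi).2
    have h2 := (Finset.mem_filter.mp hj).2
    have h3 := Nat.div_add_mod i d
    have h4 := Nat.div_add_mod j d
    have h5 : i / d < j / d := by
      by_contra! h
      have := Nat.mul_le_mul_left d h
      omega
    have h6 := Nat.mul_le_mul_left d h5
    rw [Nat.mul_succ] at h6
    omega
  calc _ ≤ ∫⁻ u in Set.Ico (0:ℝ) 1, ∑ b ∈ Finset.range d,
        ENNReal.ofReal ((2 * n) ^ (r - 1) * (w b * (w b)⁻¹ ^ r)) *
        ENNReal.ofReal ((∑ j ∈ cls b, peak L (2 ^ j * u)) ^ r) := lintegral_mono hpt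
    _ = ∑ b ∈ Finset.range d, ENNReal.ofReal ((2 * n) ^ (r - 1) * (w b * (w b)⁻¹ ^ r)) *
        ∫⁻ u in Set.Ico (0:ℝ) 1, ENNReal.ofReal ((∑ j ∈ cls b, peak L (2 ^ j * u)) ^ r) := by
        rw [lintegral_finsetSum _ fun b _ => (hmeas b).const_mul _]
        exact Finset.sum_congr rfl fun b _ => lintegral_const_mul _ (hmeas b)
    _ ≤ ∑ b ∈ Finset.range d, ENNReal.ofReal ((2 * n) ^ (r - 1) *
          (2 * ((48 + 4 * r) * 8 * L) ^ r) * w b) := by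
        refine Finset.sum_le_sum fun b _ => ?_
        have hwb := hw0 b
        refine (mul_le_mul_right (setLIntegral_rpow_peak_separated_le hr L hL _ (hsep b)) _).trans ?_
        rw [← ENNReal.ofReal_mul (by positivity)]
        apply ENNReal.ofReal_le_ofReal
        have h8 : (L:ℝ) * (cls b).card + 2 ^ (2 * L) ≤ 8 * L * w b := by
          have h1 : (2:ℝ) ^ (2 * L) ≤ 4 * n := by exact_mod_cast hLn
          have h2 : 8 * (L:ℝ) * (n / d) = 4 * n := by
            rw [hd]; push_cast; field_simp; norm_num
          simp only [hw, mul_add]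
          have : (0:ℝ) ≤ L * (cls b).card := by positivity
          linarith
        have h9 : 2 * ((48 + 4 * r) * ((L:ℝ) * (cls b).card + 2 ^ (2 * L))) ^ r ≤
            2 * ((48 + 4 * r) * 8 * L * w b) ^ r := by
          refine mul_le_mul_of_nonneg_left (rpow_le_rpow (by positivity) ?_ hr0.le) (by norm_num)
          calc (48 + 4 * r) * ((L:ℝ) * (cls b).card + 2 ^ (2 * L)) ≤
              (48 + 4 * r) * (8 * L * w b) := by gcongr
            _ = _ := by ring
        calc _ ≤ (2 * n) ^ (r - 1) * (w b * (w b)⁻¹ ^ r) *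
              (2 * ((48 + 4 * r) * 8 * L * w b) ^ r) := by gcongr
          _ = _ := by
            rw [mul_rpow (by positivity) hwb.le, inv_rpow hwb.le]
            have : w b ^ r ≠ 0 := by positivity
            field_simp
    _ ≤ _ := by
        rw [← ENNReal.ofReal_sum_of_nonneg fun b _ => by have := hw0 b; positivity, ← Finset.mul_sum]
        apply ENNReal.ofReal_le_ofReal
        calc _ ≤ (2 * n) ^ (r - 1) * (2 * ((48 + 4 * r) * 8 * L) ^ r) * (2 * n) := by gcongr
          _ = ((2 * n) ^ (r - 1) * (2 * n) ^ (1:ℝ)) * (2 * ((48 + 4 * r) * 8 * L) ^ r) := by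
            rw [rpow_one]; ring
          _ = _ := by
            rw [← rpow_add (by positivity), sub_add_cancel, mul_rpow (by norm_num) hn0.le,
              mul_rpow (by positivity) hL0.le, mul_rpow hL0.le hn0.le]
            ring

lemma summable_int_inv_one_add_abs_rpow {p : ℝ} (hp : 1 < p) :
    Summable fun i : ℤ => (2 * (1 + |(i:ℝ)|)⁻¹) ^ p := by
  have hp0 : 0 < p := by linarith
  have h1 : Summable fun i : ℤ => (if i = 0 then (1:ℝ) else 0) :=
    summable_of_ne_finset_zero (s := {0}) fun i hi => by
      rw [if_neg (by simpa using hi)]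
  have h2 := ((Real.summable_abs_int_rpow hp).add h1).mul_left ((2:ℝ) ^ p)
  refine Summable.of_nonneg_of_le (fun i => by positivity) (fun i => ?_) h2
  rw [mul_rpow (by norm_num) (by positivity)]
  gcongr
  by_cases hi : i = 0
  · subst hi
    simp [zero_rpow (neg_ne_zero.mpr hp0.ne')]
  · rw [if_neg hi, add_zero, rpow_neg (abs_nonneg _), inv_rpow (by positivity)]
    have : 0 < |(i:ℝ)| := abs_pos.mpr (by exact_mod_cast hi)
    gcongr
    linarith

lemma exists_lintegral_weight_mul_periodic_le {p : ℝ} (hp : 1 < p) :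
    ∃ W : ℝ, 0 < W ∧ ∀ H : ℝ → ℝ≥0∞, Measurable H → Function.Periodic H 1 →
      ∫⁻ u, ENNReal.ofReal (((1 + |u|)⁻¹) ^ p) * H u ≤
        ENNReal.ofReal W * ∫⁻ u in Set.Ico (0:ℝ) 1, H u := by
  have hs := summable_int_inv_one_add_abs_rpow hp
  have hp0 : 0 < p := by linarith
  refine ⟨∑' i : ℤ, (2 * (1 + |(i:ℝ)|)⁻¹) ^ p, hs.tsum_pos (fun i => by positivity) 0 (by positivity),
    fun H hm hH => ?_⟩
  rw [← setLIntegral_univ, ← iUnion_Ico_intCast ℝ, lintegral_iUnion (fun i => measurableSet_Ico)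
    (Set.pairwise_disjoint_Ico_intCast ℝ), ENNReal.ofReal_tsum_of_nonneg (fun i => by positivity) hs,
    ← ENNReal.tsum_mul_right]
  refine ENNReal.tsum_le_tsum fun i => ?_
  calc _ ≤ ∫⁻ u in Set.Ico (i:ℝ) (i + 1), ENNReal.ofReal ((2 * (1 + |(i:ℝ)|)⁻¹) ^ p) * H u := by
        refine setLIntegral_mono' measurableSet_Ico fun u hu => ?_
        gcongr
        rw [← div_eq_mul_inv, inv_eq_one_div, div_le_div_iff₀ (by positivity) (by positivity)]
        have h1 : |(i:ℝ)| ≤ |u| + 1 := by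
          have h2 : |(i:ℝ)| ≤ |u| + |(i:ℝ) - u| := by
            simpa using abs_add_le u ((i:ℝ) - u)
          have h3 : |(i:ℝ) - u| ≤ 1 := by
            rw [abs_le]; constructor <;> linarith [hu.1, hu.2]
          linarith
        linarith [abs_nonneg u]
    _ = _ := by
        rw [lintegral_const_mul _ hm, setLIntegral_Ico_of_periodic hH]

lemma exists_FNorm_atomSum_le {p q : ℝ} (hq : 1 < q) (hqp : q < p) {φ₀ : ℝ → ℂ}
    (hs : ContDiff ℝ (⊤ : ℕ∞) φ₀) (hc : HasCompactSupport φ₀) (K : ℕ) :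
    ∃ C : ℝ, 0 < C ∧ ∀ (L n : ℕ) (A : Finset ℕ) (a : ℕ → ℕ → ℕ → ℝ → ℂ), 1 ≤ L → 1 ≤ n →
      A.card ≤ n → 2 ^ (2 * L) ≤ 4 * n →
      (∀ j ∈ A, ∀ m ν : ℕ, IsDyadicAtom (j + m) (centre K j ν) (a j m ν)) →
      FNorm φ₀ p q (-1 + 1 / q) (atomSum q L A a) ≤ ENNReal.ofReal (C * ((L:ℝ) * n) ^ (1 / q)) := by
  have hq0 : 0 < q := by linarith
  have hp0 : 0 < p := by linarith
  have hr : 1 ≤ p / q := by rw [le_div_iff₀ hq0]; linarith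
  have hr0 : 0 < p / q := by positivity
  obtain ⟨C₁, hC₁, h₁⟩ := exists_atomSum_sum_bound hq hs hc K
  obtain ⟨C₂, hC₂, h₂⟩ := exists_setLIntegral_rpow_peak_le hr
  obtain ⟨W, hW, h₃⟩ := exists_lintegral_weight_mul_periodic_le (p := p) (by linarith)
  refine ⟨(C₁ ^ (p / q) * 2 ^ K * W * C₂) ^ (1 / p), by positivity,
    fun L n A a hL hn hA hLn ha => ?_⟩
  set T : ℝ → ℝ := fun u => ∑ j ∈ A, peak L (2 ^ j * u) with hT
  have hT0 : ∀ u, 0 ≤ T u := fun u => Finset.sum_nonneg fun j _ => (peak_pos L _).le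
  have hTm : Measurable T := Finset.measurable_sum _ fun j _ =>
    (measurable_peak L).comp (measurable_const_mul _)
  have hTp : Function.Periodic T 1 := fun u => Finset.sum_congr rfl fun j _ =>
    (peak_periodic L).comp_nat_dilate j u
  set H : ℝ → ℝ≥0∞ := fun u => ENNReal.ofReal (T u ^ (p / q)) with hH
  have hHm : Measurable H := by fun_prop
  have hHp : Function.Periodic H 1 := fun u => by simp only [hH, hTp u]
  have hinner : ∀ x : ℝ, (∑' k : ℕ, ENNReal.ofReal ((2:ℝ) ^ ((k:ℝ) * (-1 + 1 / q) * q)) *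
      (ENNReal.ofReal ‖LPop φ₀ k (atomSum q L A a) x‖) ^ q) ^ (p / q) ≤
      ENNReal.ofReal (C₁ ^ (p / q)) * (ENNReal.ofReal (((1 + |x|)⁻¹) ^ p) *
        ENNReal.ofReal ((T ((2 ^ K)⁻¹ * x)) ^ (p / q))) := by
    intro x
    have e0 : ∑ j ∈ A, peak L (2 ^ j * x / 2 ^ K) = T ((2 ^ K)⁻¹ * x) := by
      refine Finset.sum_congr rfl fun j _ => ?_
      congr 1; field_simp
    have h4 : ∑' k : ℕ, ENNReal.ofReal ((2:ℝ) ^ ((k:ℝ) * (-1 + 1 / q) * q)) *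
        (ENNReal.ofReal ‖LPop φ₀ k (atomSum q L A a) x‖) ^ q ≤
        ENNReal.ofReal (C₁ * ((1 + |x|)⁻¹) ^ q * T ((2 ^ K)⁻¹ * x)) := by
      rw [ENNReal.tsum_eq_iSup_sum]
      refine iSup_le fun S => ?_
      have h5 := h₁ L A a hL ha S x
      rw [e0] at h5
      refine le_trans (le_of_eq ?_) (ENNReal.ofReal_le_ofReal h5)
      rw [ENNReal.ofReal_sum_of_nonneg fun k _ => by positivity]
      refine Finset.sum_congr rfl fun k _ => ?_
      rw [ENNReal.ofReal_mul (by positivity), ENNReal.ofReal_rpow_of_nonneg (norm_nonneg _) hq0.le]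
    have hTx := hT0 ((2 ^ K)⁻¹ * x)
    refine (ENNReal.rpow_le_rpow h4 hr0.le).trans (le_of_eq ?_)
    rw [ENNReal.ofReal_rpow_of_nonneg (by positivity) hr0.le, ← ENNReal.ofReal_mul (by positivity),
      ← ENNReal.ofReal_mul (by positivity), mul_rpow (by positivity) hTx,
      mul_rpow hC₁.le (by positivity), ← rpow_mul (by positivity), mul_div_cancel₀ _ hq0.ne']
    congr 1; ring
  have hmeas : Measurable fun x : ℝ => ENNReal.ofReal (((1 + |x|)⁻¹) ^ p) * H ((2 ^ K)⁻¹ * x) := by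
    fun_prop
  have hint : ∫⁻ x, ENNReal.ofReal (((1 + |x|)⁻¹) ^ p) * H ((2 ^ K)⁻¹ * x) ≤
      ENNReal.ofReal (2 ^ K * (W * (C₂ * ((L:ℝ) * n) ^ (p / q)))) := by
    have hK : (1:ℝ) ≤ 2 ^ K := one_le_pow₀ (by norm_num)
    have h6 := lintegral_comp_pos_mul (c := (2:ℝ) ^ K) (by positivity) hmeas
    have h7 : ∫⁻ x, ENNReal.ofReal (((1 + |x|)⁻¹) ^ p) * H ((2 ^ K)⁻¹ * x) =
        ENNReal.ofReal (2 ^ K) * ∫⁻ u, ENNReal.ofReal (((1 + |2 ^ K * u|)⁻¹) ^ p) *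
          H ((2 ^ K)⁻¹ * (2 ^ K * u)) := by
      rw [h6, ← mul_assoc, ← ENNReal.ofReal_mul (by positivity), mul_inv_cancel₀ (by positivity),
        ENNReal.ofReal_one, one_mul]
    rw [h7, ENNReal.ofReal_mul (by positivity)]
    gcongr
    calc _ ≤ ∫⁻ u, ENNReal.ofReal (((1 + |u|)⁻¹) ^ p) * H u := by
          refine lintegral_mono fun u => ?_
          rw [← mul_assoc, inv_mul_cancel₀ (by positivity), one_mul]
          have hu : |u| ≤ |2 ^ K * u| := by
            rw [abs_mul]
            exact le_mul_of_one_le_left (abs_nonneg u) (hK.trans (le_abs_self _))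
          generalize |2 ^ K * u| = v at hu ⊢
          have hv : 0 ≤ v := (abs_nonneg u).trans hu
          gcongr
      _ ≤ ENNReal.ofReal W * ∫⁻ u in Set.Ico (0:ℝ) 1, H u := h₃ H hHm hHp
      _ ≤ ENNReal.ofReal W * ENNReal.ofReal (C₂ * ((L:ℝ) * n) ^ (p / q)) := by
          gcongr; exact h₂ L n A hL hn hA hLn
      _ = _ := (ENNReal.ofReal_mul hW.le).symm
  unfold FNorm
  calc _ ≤ (∫⁻ x, ENNReal.ofReal (C₁ ^ (p / q)) * (ENNReal.ofReal (((1 + |x|)⁻¹) ^ p) *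
        H ((2 ^ K)⁻¹ * x))) ^ (1 / p) := by
        gcongr with x; exact hinner x
    _ ≤ (ENNReal.ofReal (C₁ ^ (p / q)) *
        ENNReal.ofReal (2 ^ K * (W * (C₂ * ((L:ℝ) * n) ^ (p / q))))) ^ (1 / p) := by
        rw [lintegral_const_mul _ hmeas]
        gcongr
    _ = _ := by
        have hLn0 : (0:ℝ) ≤ (L:ℝ) * n := by positivity
        rw [← ENNReal.ofReal_mul (by positivity),
          ENNReal.ofReal_rpow_of_nonneg (by positivity) (by positivity)]
        congr 1
        have e : C₁ ^ (p / q) * (2 ^ K * (W * (C₂ * ((L:ℝ) * n) ^ (p / q)))) =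
            (C₁ ^ (p / q) * 2 ^ K * W * C₂) * ((L:ℝ) * n) ^ (p / q) := by ring
        rw [e, mul_rpow (by positivity) (by positivity), ← rpow_mul hLn0]
        congr 2; field_simp

lemma haarFn_eq (j : ℕ) (μ : ℤ) (t : ℝ) : haarFn j μ t = haarFn 0 0 ((2:ℝ) ^ j * t - μ) := by
  have h2 : (0:ℝ) < 2 ^ j := by positivity
  have e1 : ∀ z : ℝ, (2:ℝ) ^ (-(j:ℤ)) * z ≤ t ↔ z - μ ≤ (2:ℝ) ^ j * t - μ := fun z => by
    rw [zpow_neg, zpow_natCast, inv_mul_le_iff₀ h2]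
    constructor <;> intro h <;> linarith
  have e2 : ∀ z : ℝ, t < (2:ℝ) ^ (-(j:ℤ)) * z ↔ (2:ℝ) ^ j * t - μ < z - μ := fun z => by
    rw [zpow_neg, zpow_natCast, lt_inv_mul_iff₀ h2]
    constructor <;> intro h <;> linarith
  unfold haarFn
  simp only [Set.indicator_apply, Set.mem_Ico, e1, e2]
  simp [add_sub_cancel_left]

lemma haarFn_zero_eq : haarFn 0 0 = fun t =>
    (Set.Ico (0:ℝ) (1/2)).indicator (fun _ => (1:ℂ)) t
      - (Set.Ico (1/2:ℝ) 1).indicator (fun _ => (1:ℂ)) t := by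
  ext t; simp [haarFn]

lemma measurable_haarFn (j : ℕ) (μ : ℤ) : Measurable (haarFn j μ) := by
  unfold haarFn
  exact (measurable_const.indicator measurableSet_Ico).sub
    (measurable_const.indicator measurableSet_Ico)

lemma integral_haarFn_zero_mul {Ψ : ℝ → ℂ} (hΨ : Continuous Ψ) :
    ∫ t, haarFn 0 0 t * Ψ t = (∫ t in (0:ℝ)..(1/2), Ψ t) - ∫ t in (1/2:ℝ)..1, Ψ t := by
  rw [intervalIntegral.integral_of_le (by norm_num), intervalIntegral.integral_of_le (by norm_num),
    ← integral_Ico_eq_integral_Ioc, ← integral_Ico_eq_integral_Ioc,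
    ← integral_indicator measurableSet_Ico, ← integral_indicator measurableSet_Ico,
    ← integral_sub]
  · refine integral_congr_ae (Filter.Eventually.of_forall fun t => ?_)
    simp only [haarFn_zero_eq, Set.indicator_apply, sub_mul, ite_mul, one_mul, zero_mul]
  all_goals
    rw [integrable_indicator_iff measurableSet_Ico]
    exact (hΨ.continuousOn.integrableOn_Icc).mono_set Set.Ico_subset_Icc_self

lemma isDyadicAtom_haarFn (j : ℕ) (μ : ℤ) : IsDyadicAtom j (μ / 2 ^ j) (haarFn j μ) where
  measurable := measurable_haarFn j μ
  norm_le t := by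
    rw [haarFn_eq, haarFn_zero_eq]
    simp only [Set.indicator_apply, Set.mem_Ico]
    split_ifs <;> norm_num
  eq_zero t ht := by
    have h2 : (0:ℝ) < 2 ^ j := by positivity
    have h : 1 < |(2:ℝ) ^ j * t - μ| := by
      have e : (2:ℝ) ^ j * t - μ = 2 ^ j * (t - μ / 2 ^ j) := by field_simp
      rw [e, abs_mul, abs_of_pos h2]
      calc (1:ℝ) = 2 ^ j * (2 ^ j)⁻¹ := by field_simp
        _ < _ := by gcongr
    rw [haarFn_eq, haarFn_zero_eq]
    generalize (2:ℝ) ^ j * t - μ = u at h ⊢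
    beta_reduce
    rcases lt_abs.mp h with h | h
    · rw [Set.indicator_of_notMem (by rw [Set.mem_Ico]; rintro ⟨_, _⟩; linarith),
        Set.indicator_of_notMem (by rw [Set.mem_Ico]; rintro ⟨_, _⟩; linarith), sub_zero]
    · rw [Set.indicator_of_notMem (by rw [Set.mem_Ico]; rintro ⟨_, _⟩; linarith),
        Set.indicator_of_notMem (by rw [Set.mem_Ico]; rintro ⟨_, _⟩; linarith), sub_zero]
  integral_eq_zero := by
    have e : ∀ t, haarFn j μ t = haarFn 0 0 ((2:ℝ) ^ j * t - μ) := haarFn_eq j μ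
    have h0 := integral_haarFn_zero_mul (Ψ := fun _ => 1) continuous_const
    simp only [mul_one, intervalIntegral.integral_const] at h0
    simp only [e]
    rw [Measure.integral_comp_mul_left (fun u => haarFn 0 0 (u - μ)) ((2:ℝ) ^ j),
      integral_sub_right_eq_self (haarFn 0 0) (μ:ℝ), h0]
    norm_num

lemma LPop_haarFn (φ₀ : ℝ → ℂ) (j : ℕ) (μ : ℤ) (x : ℝ) :
    LPop φ₀ (j + 1) (haarFn j μ) x = LPop φ₀ 1 (haarFn 0 0) ((2:ℝ) ^ j * x - μ) := by
  rw [LPop_apply, LPop_apply]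
  have e0 : lpProfile φ₀ (j + 1) = lpProfile φ₀ 1 := by simp [lpProfile]
  rw [e0]
  set F : ℝ → ℂ := fun u => haarFn 0 0 (u - μ) *
    ((2:ℂ) ^ 1 * lpProfile φ₀ 1 ((2:ℝ) ^ 1 * (2 ^ j * x - u))) with hF
  have e : ∀ t, haarFn j μ t * ((2:ℂ) ^ (j + 1) * lpProfile φ₀ 1 ((2:ℝ) ^ (j + 1) * (x - t))) =
      (2:ℂ) ^ j * F (2 ^ j * t) := fun t => by
    rw [hF, haarFn_eq j μ t]
    have : (2:ℝ) ^ (j + 1) * (x - t) = (2:ℝ) ^ 1 * (2 ^ j * x - 2 ^ j * t) := by ring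
    simp only [this]
    ring
  simp only [e]
  rw [integral_const_mul, Measure.integral_comp_mul_left F ((2:ℝ) ^ j), abs_of_pos (by positivity),
    Complex.real_smul, ← mul_assoc]
  push_cast
  rw [mul_inv_cancel₀ (pow_ne_zero _ two_ne_zero), one_mul, ← integral_add_right_eq_self F (μ:ℝ)]
  refine integral_congr_ae (Filter.Eventually.of_forall fun u => ?_)
  simp only [hF, add_sub_cancel_right]
  have : (2:ℝ) ^ j * x - (u + μ) = 2 ^ j * x - μ - u := by ring
  rw [this]

lemma eq_zero_of_periodic_of_tendsto {Ψ : ℝ → ℂ} {c : ℝ} (hc : 0 < c)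
    (hp : Function.Periodic Ψ c) (ht : Filter.Tendsto Ψ Filter.atTop (nhds 0)) (x : ℝ) :
    Ψ x = 0 := by
  have h1 : Filter.Tendsto (fun n : ℕ => Ψ (x + n * c)) Filter.atTop (nhds 0) := by
    refine ht.comp (Filter.tendsto_atTop_add_const_left _ _ ?_)
    exact Filter.Tendsto.atTop_mul_const hc tendsto_natCast_atTop_atTop
  have h2 : ∀ n : ℕ, Ψ (x + n * c) = Ψ x := fun n => hp.nat_mul n x
  simp only [h2] at h1
  exact tendsto_nhds_unique tendsto_const_nhds h1

lemma lpProfile_one_ne_zero {φ₀ : ℝ → ℂ} (hs : ContDiff ℝ (⊤ : ℕ∞) φ₀)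
    (hc : HasCompactSupport φ₀) (hone : ∀ ξ : ℝ, |ξ| ≤ 4/3 → φ₀ ξ = 1)
    (hzero : ∀ ξ : ℝ, 3/2 ≤ |ξ| → φ₀ ξ = 0) : lpProfile φ₀ 1 ≠ 0 := by
  intro h
  set g := (hasCompactSupport_lpDiff hc).toSchwartzMap (contDiff_lpDiff hs) with hg
  have h1 : (𝓕⁻ g : SchwartzMap ℝ ℂ) = 0 := by
    ext x
    have : 𝓕⁻ (fun ξ => φ₀ ξ - φ₀ (2 * ξ)) x = 0 := by simpa [lpProfile] using congrFun h x
    rw [SchwartzMap.fourierInv_coe]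
    exact this
  have h2 : g = 0 := by
    rw [← FourierTransform.fourier_fourierInv_eq (F := SchwartzMap ℝ ℂ) g, h1]
    simp
  have h3 : g 1 = 1 := by
    change φ₀ 1 - φ₀ (2 * 1) = 1
    rw [hone 1 (by norm_num), hzero (2 * 1) (by norm_num), sub_zero]
  rw [h2] at h3
  simp at h3

lemma exists_LPop_haarFn_zero_ne_zero {φ₀ : ℝ → ℂ} (hs : ContDiff ℝ (⊤ : ℕ∞) φ₀)
    (hc : HasCompactSupport φ₀) (hone : ∀ ξ : ℝ, |ξ| ≤ 4/3 → φ₀ ξ = 1)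
    (hzero : ∀ ξ : ℝ, 3/2 ≤ |ξ| → φ₀ ξ = 0) :
    Continuous (LPop φ₀ 1 (haarFn 0 0)) ∧ ∃ x, LPop φ₀ 1 (haarFn 0 0) x ≠ 0 := by
  obtain ⟨C, hC, hker⟩ := exists_decayKernel_lpProfile hs hc
  set Ψ : ℝ → ℂ := fun u => (2:ℂ) ^ 1 * lpProfile φ₀ 1 ((2:ℝ) ^ 1 * u) with hΨ
  have hΨc : Continuous Ψ := by
    have := (hker 1).continuous
    fun_prop
  set F : ℝ → ℂ := fun x => ∫ u in (0:ℝ)..x, Ψ u with hF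
  have hFd : ∀ x, HasDerivAt F (Ψ x) x := fun x =>
    intervalIntegral.integral_hasDerivAt_right (hΨc.intervalIntegrable _ _)
      hΨc.aestronglyMeasurable.stronglyMeasurableAtFilter hΨc.continuousAt
  have hFc : Continuous F := continuous_iff_continuousAt.mpr fun x => (hFd x).continuousAt
  have hsub : ∀ a b, ∫ u in a..b, Ψ u = F b - F a := fun a b =>
    (intervalIntegral.integral_interval_sub_left (hΨc.intervalIntegrable _ _)
      (hΨc.intervalIntegrable _ _)).symm
  have hG : LPop φ₀ 1 (haarFn 0 0) = fun x => F x - 2 * F (x - 1/2) + F (x - 1) := by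
    ext x
    rw [LPop_apply]
    have := integral_haarFn_zero_mul (Ψ := fun t => Ψ (x - t)) (by fun_prop)
    refine this.trans ?_
    rw [intervalIntegral.integral_comp_sub_left, intervalIntegral.integral_comp_sub_left,
      hsub, hsub, sub_zero]
    ring
  refine ⟨by rw [hG]; fun_prop, ?_⟩
  by_contra! hall
  have hd2 : ∀ x, Ψ x - 2 * Ψ (x - 1/2) + Ψ (x - 1) = 0 := fun x => by
    have h1 : HasDerivAt (fun x => F x - 2 * F (x - 1/2) + F (x - 1))
        (Ψ x - 2 * Ψ (x - 1/2) + Ψ (x - 1)) x :=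
      ((hFd x).sub (((hFd _).comp_sub_const x (1/2)).const_mul 2)).add ((hFd _).comp_sub_const x 1)
    rw [← hG, show LPop φ₀ 1 (haarFn 0 0) = fun _ => 0 from funext hall] at h1
    exact h1.unique (hasDerivAt_const x (0:ℂ))
  have ht : Filter.Tendsto Ψ Filter.atTop (nhds 0) := by
    have h0 : Filter.Tendsto (fun x : ℝ => 2 * C / x) Filter.atTop (nhds 0) :=
      tendsto_const_nhds.div_atTop Filter.tendsto_id
    refine squeeze_zero_norm' ?_ h0
    filter_upwards [Filter.eventually_gt_atTop 0] with x hx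
    have h1 := (hker 1).norm_le ((2:ℝ) ^ 1 * x)
    have h2 : x ≤ (1 + |(2:ℝ) ^ 1 * x|) ^ 7 := by
      rw [abs_of_pos (by positivity)]
      calc x ≤ (1 + 2 ^ 1 * x) ^ 1 := by linarith
        _ ≤ _ := pow_le_pow_right₀ (by nlinarith) (by norm_num)
    have h3 : ‖lpProfile φ₀ 1 ((2:ℝ) ^ 1 * x)‖ ≤ C / x := h1.trans (by gcongr)
    rw [pow_one] at h3
    rw [hΨ, norm_mul, norm_pow, Complex.norm_ofNat, pow_one (2:ℝ), mul_div_assoc]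
    exact mul_le_mul_of_nonneg_left h3 (by norm_num)
  have ht' : ∀ c : ℝ, Filter.Tendsto (fun x => Ψ (x + c)) Filter.atTop (nhds 0) := fun c =>
    ht.comp (Filter.tendsto_atTop_add_const_right _ _ Filter.tendsto_id)
  have hd : ∀ x, Ψ (x + 1/2) - Ψ x = 0 :=
    eq_zero_of_periodic_of_tendsto (c := 1/2) (by norm_num)
      (fun x => by
        have := hd2 (x + 1/2 + 1/2)
        have e1 : x + 1/2 + 1/2 - 1/2 = x + 1/2 := by ring
        have e2 : x + 1/2 + 1/2 - 1 = x := by ring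
        rw [e1, e2] at this
        linear_combination this)
      (by simpa using (ht' (1/2)).sub ht)
  have hz := eq_zero_of_periodic_of_tendsto (c := 1/2) (by norm_num)
    (fun x => sub_eq_zero.mp (hd x)) ht
  refine lpProfile_one_ne_zero hs hc hone hzero (funext fun x => ?_)
  have := hz (x / 2)
  simp only [hΨ, pow_one, mul_eq_zero, OfNat.ofNat_ne_zero, false_or] at this
  rw [mul_div_cancel₀ x (by norm_num)] at this
  exact this

lemma exists_LPop_haarFn_lower {φ₀ : ℝ → ℂ} (hs : ContDiff ℝ (⊤ : ℕ∞) φ₀)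
    (hc : HasCompactSupport φ₀) (hone : ∀ ξ : ℝ, |ξ| ≤ 4/3 → φ₀ ξ = 1)
    (hzero : ∀ ξ : ℝ, 3/2 ≤ |ξ| → φ₀ ξ = 0) :
    ∃ γ x₀ r : ℝ, 0 < γ ∧ 0 < r ∧ r ≤ 1/4 ∧ ∀ (j : ℕ) (μ : ℤ) (x : ℝ),
      |(2:ℝ) ^ j * x - μ - x₀| ≤ r → γ ≤ ‖LPop φ₀ (j + 1) (haarFn j μ) x‖ := by
  obtain ⟨hcont, x₀, hx₀⟩ := exists_LPop_haarFn_zero_ne_zero hs hc hone hzero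
  have hpos : 0 < ‖LPop φ₀ 1 (haarFn 0 0) x₀‖ := norm_pos_iff.mpr hx₀
  have hev : ∀ᶠ y in nhds x₀, ‖LPop φ₀ 1 (haarFn 0 0) x₀‖ / 2 < ‖LPop φ₀ 1 (haarFn 0 0) y‖ :=
    hcont.norm.continuousAt.eventually (lt_mem_nhds (by linarith))
  obtain ⟨ε, hε, hb⟩ := Metric.eventually_nhds_iff.mp hev
  refine ⟨‖LPop φ₀ 1 (haarFn 0 0) x₀‖ / 2, x₀, min (ε / 2) (1/4), half_pos hpos, by positivity, min_le_right _ _,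
    fun j μ x hx => ?_⟩
  rw [LPop_haarFn φ₀ j]
  refine (hb ?_).le
  rw [Real.dist_eq]
  exact (hx.trans (min_le_left _ _)).trans_lt (by linarith)

/-- Normalised distance `1 + 2^{min(j,i)} |y - y'|` between the left endpoints of two dyadic
intervals of levels `j` and `i`. -/
def haarSep (e e' : ℕ × ℤ) : ℝ :=
  1 + (2:ℝ) ^ min e.1 e'.1 * |(e.2:ℝ) / 2 ^ e.1 - (e'.2:ℝ) / 2 ^ e'.1|

lemma one_le_haarSep (e e' : ℕ × ℤ) : 1 ≤ haarSep e e' := by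
  unfold haarSep
  have : (0:ℝ) ≤ (2:ℝ) ^ min e.1 e'.1 * |(e.2:ℝ) / 2 ^ e.1 - (e'.2:ℝ) / 2 ^ e'.1| := by positivity
  linarith

lemma haarSep_comm (e e' : ℕ × ℤ) : haarSep e e' = haarSep e' e := by
  unfold haarSep; rw [min_comm, abs_sub_comm]

lemma haarSep_of_fst_eq {e e' : ℕ × ℤ} (h : e.1 = e'.1) :
    haarSep e e' = 1 + |(e'.2:ℝ) - e.2| := by
  unfold haarSep
  rw [← h, min_self, ← sub_div, abs_div, abs_of_pos (by positivity : (0:ℝ) < 2 ^ e.1),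
    mul_div_cancel₀ _ (by positivity), abs_sub_comm]

lemma sum_level_inv_haarSep_sq_le (S : Finset (ℕ × ℤ)) (i : ℕ) (hS : ∀ e' ∈ S, e'.1 = i)
    (e : ℕ × ℤ) : ∑ e' ∈ S, (haarSep e e' ^ 2)⁻¹ ≤ 4 * 2 ^ (i - e.1) := by
  have hinj : Set.InjOn Prod.snd (S : Set (ℕ × ℤ)) := fun a ha b hb hab =>
    Prod.ext ((hS a ha).trans (hS b hb).symm) hab
  have h := sum_int_inv_one_add_mul_sq_le (θ := ((2:ℝ) ^ (i - e.1))⁻¹) (by positivity)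
    (S.image Prod.snd) (2 ^ i * ((e.2:ℝ) / 2 ^ e.1))
  rw [Finset.sum_image hinj] at h
  refine le_trans (le_of_eq (Finset.sum_congr rfl fun e' he' => ?_)) (h.trans ?_)
  · unfold haarSep
    rw [hS e' he']
    congr 3
    have e1 : (2:ℝ) ^ i = 2 ^ min e.1 i * 2 ^ (i - e.1) := by
      rw [← pow_add]; congr 1; omega
    have e2 : (e.2:ℝ) / 2 ^ e.1 - (e'.2:ℝ) / 2 ^ i =
        (2 ^ i)⁻¹ * (2 ^ i * ((e.2:ℝ) / 2 ^ e.1) - e'.2) := by field_simp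
    rw [e2, abs_mul, abs_of_pos (by positivity : (0:ℝ) < (2 ^ i)⁻¹), abs_sub_comm, ← mul_assoc]
    congr 1
    rw [e1]; field_simp
  · have : (1:ℝ) ≤ 2 ^ (i - e.1) := one_le_pow₀ (by norm_num)
    rw [one_div, inv_inv]; linarith

/-- Levels of `E` are `K`-separated and positions on each level are `2^{K-1}`-separated. -/
structure IsSeparated (K : ℕ) (E : Finset (ℕ × ℤ)) : Prop where
  level : ∀ e ∈ E, ∀ e' ∈ E, e.1 ≠ e'.1 → K ≤ ((e'.1:ℤ) - e.1).natAbs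
  position : ∀ e ∈ E, ∀ e' ∈ E, e ≠ e' → e.1 = e'.1 → (2:ℝ) ^ (K - 1) ≤ |(e'.2:ℝ) - e.2|

lemma sum_erase_mul_inv_haarSep_le {ρ : ℝ} (h0 : 0 < ρ) (h1 : ρ < 1) {K : ℕ} {E : Finset (ℕ × ℤ)}
    (hE : IsSeparated K E) {ω : ℕ → ℕ → ℝ} (hω0 : ∀ j i, 0 ≤ ω j i)
    (hω : ∀ j i, ω j i * 2 ^ (i - j) ≤ (ρ ^ 2) ^ ((i:ℤ) - j).natAbs) {e : ℕ × ℤ} (he : e ∈ E) :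
    ∑ e' ∈ E.erase e, ω e.1 e'.1 * (haarSep e e' ^ 3)⁻¹ ≤
      8 * (1 - ρ)⁻¹ * max (((2:ℝ) ^ (K - 1))⁻¹) (ρ ^ K) := by
  set ε := max (((2:ℝ) ^ (K - 1))⁻¹) (ρ ^ K) with hε
  have hε0 : 0 ≤ ε := le_max_of_le_right (by positivity)
  have hpt : ∀ e' ∈ E.erase e, ω e.1 e'.1 * (haarSep e e' ^ 3)⁻¹ ≤
      ε * ((ρ ^ ((e'.1:ℤ) - e.1).natAbs * (2 ^ (e'.1 - e.1))⁻¹) * (haarSep e e' ^ 2)⁻¹) := by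
    intro e' he'
    obtain ⟨hne, he'E⟩ := Finset.mem_erase.mp he'
    have hs := one_le_haarSep e e'
    have hs0 : 0 < haarSep e e' := by linarith
    have hωle : ω e.1 e'.1 ≤ (ρ ^ 2) ^ ((e'.1:ℤ) - e.1).natAbs * (2 ^ (e'.1 - e.1))⁻¹ := by
      rw [← div_eq_mul_inv, le_div_iff₀ (by positivity)]; exact hω _ _
    have hsplit : (haarSep e e' ^ 3)⁻¹ = (haarSep e e')⁻¹ * (haarSep e e' ^ 2)⁻¹ := by
      rw [← mul_inv]; congr 1; ring
    rw [hsplit, ← mul_assoc, ← mul_assoc]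
    refine mul_le_mul_of_nonneg_right ?_ (by positivity)
    by_cases hl : e.1 = e'.1
    · have h2 : (haarSep e e')⁻¹ ≤ ε := by
        refine le_trans (inv_anti₀ (by positivity) ?_) (le_max_left _ _)
        rw [haarSep_of_fst_eq hl]
        linarith [hE.position e he e' he'E hne.symm hl]
      rw [← hl] at hωle ⊢
      simp only [sub_self, Int.natAbs_zero, Nat.sub_self, pow_zero, inv_one, mul_one] at hωle ⊢
      calc _ ≤ 1 * (haarSep e e')⁻¹ := by gcongr
        _ ≤ _ := by linarith
    · have hd := hE.level e he e' he'E hl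
      have h3 : (ρ ^ 2) ^ ((e'.1:ℤ) - e.1).natAbs ≤ ε * ρ ^ ((e'.1:ℤ) - e.1).natAbs := by
        rw [← pow_mul, mul_comm 2, pow_mul, sq]
        gcongr
        exact (pow_le_pow_of_le_one h0.le h1.le hd).trans (le_max_right _ _)
      calc ω e.1 e'.1 * (haarSep e e')⁻¹ ≤ ω e.1 e'.1 * 1 :=
            mul_le_mul_of_nonneg_left (inv_le_one_of_one_le₀ hs) (hω0 _ _)
        _ = ω e.1 e'.1 := mul_one _
        _ ≤ _ := hωle
        _ ≤ ε * ρ ^ ((e'.1:ℤ) - e.1).natAbs * (2 ^ (e'.1 - e.1))⁻¹ :=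
            mul_le_mul_of_nonneg_right h3 (by positivity)
        _ = _ := by ring
  refine (Finset.sum_le_sum hpt).trans ?_
  rw [← Finset.mul_sum]
  have hfib : ∑ e' ∈ E.erase e, (ρ ^ ((e'.1:ℤ) - e.1).natAbs * (2 ^ (e'.1 - e.1))⁻¹) *
      (haarSep e e' ^ 2)⁻¹ ≤ 8 * (1 - ρ)⁻¹ := by
    rw [← Finset.sum_fiberwise_of_maps_to (t := (E.erase e).image Prod.fst)
      (fun x hx => Finset.mem_image_of_mem _ hx)]
    have hlev : ∀ i ∈ (E.erase e).image Prod.fst,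
        ∑ e' ∈ (E.erase e).filter (fun x => x.1 = i),
          (ρ ^ ((e'.1:ℤ) - e.1).natAbs * (2 ^ (e'.1 - e.1))⁻¹) * (haarSep e e' ^ 2)⁻¹ ≤
          4 * ρ ^ ((i:ℤ) - e.1).natAbs := by
      intro i _
      calc _ = ∑ e' ∈ (E.erase e).filter (fun x => x.1 = i),
            (ρ ^ ((i:ℤ) - e.1).natAbs * (2 ^ (i - e.1))⁻¹) * (haarSep e e' ^ 2)⁻¹ :=
            Finset.sum_congr rfl fun e' he' => by rw [(Finset.mem_filter.mp he').2]
        _ ≤ (ρ ^ ((i:ℤ) - e.1).natAbs * (2 ^ (i - e.1))⁻¹) * (4 * 2 ^ (i - e.1)) := by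
            rw [← Finset.mul_sum]
            refine mul_le_mul_of_nonneg_left (sum_level_inv_haarSep_sq_le _ i ?_ e) (by positivity)
            exact fun e' he' => (Finset.mem_filter.mp he').2
        _ = _ := by field_simp
    refine (Finset.sum_le_sum hlev).trans ?_
    rw [← Finset.mul_sum]
    have := sum_int_geom_le h0.le h1 (((E.erase e).image Prod.fst).image (fun i : ℕ => (i:ℤ))) e.1
    rw [Finset.sum_image (fun a _ b _ h => by exact_mod_cast h)] at this
    linarith
  calc _ ≤ ε * (8 * (1 - ρ)⁻¹) := mul_le_mul_of_nonneg_left hfib hε0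
    _ = _ := by ring

lemma schur_erase_le {ι : Type*} [DecidableEq ι] {q : ℝ} (hq : 1 ≤ q) (E : Finset ι)
    {B : ι → ι → ℝ} {w b : ι → ℝ} (hB : ∀ e i, 0 ≤ B e i) (hw : ∀ e, 0 ≤ w e) (hb : ∀ e, 0 ≤ b e)
    {σ : ℝ} (hσ : 0 < σ) (hrow : ∀ e ∈ E, ∑ i ∈ E.erase e, B e i ≤ σ)
    (hcol : ∀ i ∈ E, ∑ e ∈ E.erase i, w e * B e i ≤ σ * w i) :
    ∑ e ∈ E, w e * (∑ i ∈ E.erase e, B e i * b i) ^ q ≤ σ ^ q * ∑ e ∈ E, w e * b e ^ q := by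
  calc _ ≤ ∑ e ∈ E, w e * (σ ^ (q - 1) * ∑ i ∈ E.erase e, B e i * b i ^ q) :=
        Finset.sum_le_sum fun e he => mul_le_mul_of_nonneg_left
          (rpow_sum_mul_le hq _ (hB e) hb (hrow e he)) (hw e)
    _ = σ ^ (q - 1) * ∑ e ∈ E, ∑ i ∈ E.erase e, w e * B e i * b i ^ q := by
        simp only [Finset.mul_sum]
        exact Finset.sum_congr rfl fun e _ => Finset.sum_congr rfl fun i _ => by ring
    _ = σ ^ (q - 1) * ∑ i ∈ E, ∑ e ∈ E.erase i, w e * B e i * b i ^ q := by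
        congr 1
        refine Finset.sum_comm' fun e i => ?_
        simp only [Finset.mem_erase]
        tauto
    _ ≤ σ ^ (q - 1) * ∑ i ∈ E, σ * (w i * b i ^ q) := by
        refine mul_le_mul_of_nonneg_left (Finset.sum_le_sum fun i hi => ?_) (by positivity)
        rw [← Finset.sum_mul, ← mul_assoc]
        exact mul_le_mul_of_nonneg_right (hcol i hi) (rpow_nonneg (hb i) _)
    _ = _ := by
        rw [← Finset.mul_sum, ← mul_assoc]
        congr 1
        rw [← rpow_add_one hσ.ne']; congr 1; ring

/-- Off-diagonal weight between levels `j` and `i` in the smoothness scale `-α`. -/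
def levelWeight (α : ℝ) (j i : ℕ) : ℝ := (2:ℝ) ^ (((i:ℝ) - j) * α) * ((4:ℝ) ^ (i - j))⁻¹

lemma levelWeight_nonneg (α : ℝ) (j i : ℕ) : 0 ≤ levelWeight α j i := by
  unfold levelWeight; positivity

lemma levelWeight_mul_le (α : ℝ) (j i : ℕ) :
    levelWeight α j i * 2 ^ (i - j) ≤
      (((2:ℝ) ^ (-(min α (1 - α) / 2))) ^ 2) ^ ((i:ℤ) - j).natAbs := by
  set τ := min α (1 - α) with hτ
  have hτ1 : τ ≤ α := min_le_left _ _
  have hτ2 : τ ≤ 1 - α := min_le_right _ _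
  have e4 : ∀ d : ℕ, (4:ℝ) ^ d = (2:ℝ) ^ (2 * (d:ℝ)) := fun d => by
    rw [rpow_mul (by norm_num), rpow_natCast]; norm_num
  rw [← pow_mul, ← rpow_natCast ((2:ℝ) ^ (-(τ / 2))), ← rpow_mul (by norm_num)]
  unfold levelWeight
  rcases le_total j i with h | h
  · obtain ⟨d, rfl⟩ := Nat.exists_eq_add_of_le h
    have e1 : (((j + d : ℕ):ℤ) - j).natAbs = d := by omega
    rw [e1, Nat.add_sub_cancel_left, e4, ← rpow_natCast 2 d, ← rpow_neg (by norm_num),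
      ← rpow_add (by norm_num), ← rpow_add (by norm_num)]
    apply rpow_le_rpow_of_exponent_le (by norm_num)
    push_cast
    nlinarith [(Nat.cast_nonneg d : (0:ℝ) ≤ d)]
  · obtain ⟨d, rfl⟩ := Nat.exists_eq_add_of_le h
    have e1 : ((i:ℤ) - (i + d : ℕ)).natAbs = d := by omega
    rw [e1, Nat.sub_eq_zero_of_le h]
    simp only [pow_zero, inv_one, mul_one]
    apply rpow_le_rpow_of_exponent_le (by norm_num)
    push_cast
    nlinarith [(Nat.cast_nonneg d : (0:ℝ) ≤ d)]

lemma levelWeight_transpose_mul_le (α : ℝ) (i j : ℕ) :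
    (2 ^ i * ((2:ℝ) ^ j)⁻¹ * levelWeight α j i) * 2 ^ (j - i) ≤
      (((2:ℝ) ^ (-(min α (1 - α) / 2))) ^ 2) ^ ((j:ℤ) - i).natAbs := by
  set τ := min α (1 - α) with hτ
  have hτ1 : τ ≤ α := min_le_left _ _
  have hτ2 : τ ≤ 1 - α := min_le_right _ _
  have e4 : ∀ d : ℕ, (4:ℝ) ^ d = (2:ℝ) ^ (2 * (d:ℝ)) := fun d => by
    rw [rpow_mul (by norm_num), rpow_natCast]; norm_num
  rw [← pow_mul, ← rpow_natCast ((2:ℝ) ^ (-(τ / 2))), ← rpow_mul (by norm_num)]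
  unfold levelWeight
  rcases le_total j i with h | h
  · obtain ⟨d, rfl⟩ := Nat.exists_eq_add_of_le h
    have e1 : ((j:ℤ) - (j + d : ℕ)).natAbs = d := by omega
    rw [e1, Nat.add_sub_cancel_left, Nat.sub_eq_zero_of_le h, pow_zero, mul_one, e4, pow_add,
      mul_comm ((2:ℝ) ^ j), mul_assoc ((2:ℝ) ^ d), mul_inv_cancel₀ (by positivity), mul_one,
      ← rpow_natCast 2 d, ← rpow_neg (by norm_num),
      ← rpow_add (by norm_num), ← rpow_add (by norm_num)]
    apply rpow_le_rpow_of_exponent_le (by norm_num)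
    push_cast
    nlinarith [(Nat.cast_nonneg d : (0:ℝ) ≤ d)]
  · obtain ⟨d, rfl⟩ := Nat.exists_eq_add_of_le h
    have e1 : (((i + d : ℕ):ℤ) - i).natAbs = d := by omega
    have e2 : (2:ℝ) ^ i * (2 ^ (i + d))⁻¹ * ((2:ℝ) ^ (((i:ℝ) - (i + d : ℕ)) * α) * 1) * 2 ^ d =
        (2:ℝ) ^ (((i:ℝ) - (i + d : ℕ)) * α) := by
      rw [pow_add]; field_simp
    rw [e1, Nat.sub_eq_zero_of_le h, Nat.add_sub_cancel_left, pow_zero, inv_one, e2]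
    apply rpow_le_rpow_of_exponent_le (by norm_num)
    push_cast
    nlinarith [(Nat.cast_nonneg d : (0:ℝ) ≤ d)]

lemma exists_schur_haar_le {q α : ℝ} (hq : 1 ≤ q) (h0 : 0 < α) (h1 : α < 1) {ε : ℝ} (hε : 0 < ε) :
    ∃ K₀ : ℕ, ∀ K ≥ K₀, ∀ (E : Finset (ℕ × ℤ)) (b : ℕ × ℤ → ℝ), IsSeparated K E →
      (∀ e, 0 ≤ b e) →
      ∑ e ∈ E, ((2:ℝ) ^ e.1)⁻¹ * (∑ i ∈ E.erase e,
        (levelWeight α e.1 i.1 * (haarSep e i ^ 3)⁻¹) * b i) ^ q ≤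
      ε ^ q * ∑ e ∈ E, ((2:ℝ) ^ e.1)⁻¹ * b e ^ q := by
  set ρ : ℝ := (2:ℝ) ^ (-(min α (1 - α) / 2)) with hρ
  have hτ : 0 < min α (1 - α) := lt_min h0 (by linarith)
  have hρ0 : 0 < ρ := by positivity
  have hρ1 : ρ < 1 := rpow_lt_one_of_one_lt_of_neg (by norm_num) (by linarith)
  have hlim : Filter.Tendsto (fun K : ℕ => 8 * (1 - ρ)⁻¹ * max (((2:ℝ) ^ (K - 1))⁻¹) (ρ ^ K))
      Filter.atTop (nhds 0) := by
    have t1 : Filter.Tendsto (fun K : ℕ => ((2:ℝ) ^ (K - 1))⁻¹) Filter.atTop (nhds 0) :=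
      (tendsto_inv_atTop_zero.comp (tendsto_pow_atTop_atTop_of_one_lt (by norm_num))).comp
        (Filter.tendsto_sub_atTop_nat 1)
    have t2 := tendsto_pow_atTop_nhds_zero_of_lt_one hρ0.le hρ1
    simpa using (t1.max t2).const_mul (8 * (1 - ρ)⁻¹)
  obtain ⟨K₀, hK₀⟩ := Filter.eventually_atTop.mp (hlim.eventually (gt_mem_nhds hε))
  refine ⟨K₀, fun K hK E b hE hb => ?_⟩
  refine schur_erase_le hq E (fun e i => mul_nonneg (levelWeight_nonneg _ _ _) ?_)
    (fun e => by positivity) hb hε ?_ ?_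
  · have := one_le_haarSep e i
    positivity
  · intro e he
    exact (sum_erase_mul_inv_haarSep_le hρ0 hρ1 hE (levelWeight_nonneg α)
      (levelWeight_mul_le α) he).trans (hK₀ K hK).le
  · intro i hi
    have := (sum_erase_mul_inv_haarSep_le hρ0 hρ1 hE
      (ω := fun i j => 2 ^ i * ((2:ℝ) ^ j)⁻¹ * levelWeight α j i)
      (fun i j => mul_nonneg (by positivity) (levelWeight_nonneg _ _ _))
      (levelWeight_transpose_mul_le α) hi).trans (hK₀ K hK).le
    calc _ = (∑ e ∈ E.erase i, 2 ^ i.1 * ((2:ℝ) ^ e.1)⁻¹ * levelWeight α e.1 i.1 *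
          (haarSep i e ^ 3)⁻¹) * (2 ^ i.1)⁻¹ := by
          rw [Finset.sum_mul]
          refine Finset.sum_congr rfl fun e _ => ?_
          rw [haarSep_comm]; field_simp
      _ ≤ _ := mul_le_mul_of_nonneg_right this (by positivity)

lemma norm_LPop_haarFn_le {φ₀ : ℝ → ℂ} {C x₀ r : ℝ} (hC : 0 < C) (hr0 : 0 < r)
    (hb : ∀ (k l : ℕ) (y : ℝ) (ψ : ℝ → ℂ), IsDyadicAtom l y ψ → ∀ x : ℝ,
      ‖LPop φ₀ k ψ x‖ ≤ C * ((4:ℝ) ^ (l - k))⁻¹ / (1 + (2:ℝ) ^ (min k l) * |x - y|) ^ 5)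
    (e e' : ℕ × ℤ) {x : ℝ} (hx : |(2:ℝ) ^ e.1 * x - e.2 - x₀| ≤ r) :
    ‖LPop φ₀ (e.1 + 1) (haarFn e'.1 e'.2) x‖ ≤
      4 * C * (1 + (|x₀| + r)) ^ 3 * (((4:ℝ) ^ (e'.1 - e.1))⁻¹ * (haarSep e e' ^ 3)⁻¹) := by
  refine (hb _ _ _ _ (isDyadicAtom_haarFn e'.1 e'.2) x).trans ?_
  set R := |x₀| + r with hR
  have hR0 : 0 < R := by positivity
  set X := (2:ℝ) ^ min (e.1 + 1) e'.1 * |x - e'.2 / 2 ^ e'.1| with hX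
  have hX0 : 0 ≤ X := by positivity
  have hj : (0:ℝ) < 2 ^ e.1 := by positivity
  have hm : (2:ℝ) ^ min e.1 e'.1 ≤ 2 ^ e.1 := pow_le_pow_right₀ (by norm_num) (min_le_left _ _)
  have hm0 : (0:ℝ) < 2 ^ min e.1 e'.1 := by positivity
  have hxe : 2 ^ e.1 * |(e.2:ℝ) / 2 ^ e.1 - x| ≤ R := by
    rw [← abs_of_pos hj, ← abs_mul, abs_of_pos hj]
    have e1 : (2:ℝ) ^ e.1 * ((e.2:ℝ) / 2 ^ e.1 - x) = -(2 ^ e.1 * x - e.2) := by field_simp; ring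
    rw [e1, abs_neg]
    have : |(2:ℝ) ^ e.1 * x - e.2| ≤ |(2:ℝ) ^ e.1 * x - e.2 - x₀| + |x₀| := by
      simpa using abs_add_le ((2:ℝ) ^ e.1 * x - e.2 - x₀) x₀
    linarith
  have hsep : haarSep e e' ≤ (1 + R) * (1 + X) := by
    unfold haarSep
    have a1 := abs_sub_le ((e.2:ℝ) / 2 ^ e.1) x (e'.2 / 2 ^ e'.1)
    have a2 : (2:ℝ) ^ min e.1 e'.1 * |(e.2:ℝ) / 2 ^ e.1 - x| ≤ R :=
      (mul_le_mul_of_nonneg_right hm (abs_nonneg _)).trans hxe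
    have a3 : (2:ℝ) ^ min e.1 e'.1 * |x - e'.2 / 2 ^ e'.1| ≤ X := by
      refine mul_le_mul_of_nonneg_right (pow_le_pow_right₀ (by norm_num) ?_) (abs_nonneg _)
      exact min_le_min_right _ (Nat.le_succ _)
    have a4 := mul_le_mul_of_nonneg_left a1 hm0.le
    nlinarith
  have hs1 := one_le_haarSep e e'
  have hs0 : 0 < haarSep e e' := by linarith
  have h4 : ((4:ℝ) ^ (e'.1 - (e.1 + 1)))⁻¹ ≤ 4 * ((4:ℝ) ^ (e'.1 - e.1))⁻¹ := by
    rw [← div_eq_mul_inv, inv_eq_one_div, div_le_div_iff₀ (by positivity) (by positivity), one_mul,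
      ← pow_succ']
    exact pow_le_pow_right₀ (by norm_num) (by omega)
  have h5 : ((1 + X) ^ 5)⁻¹ ≤ (1 + R) ^ 3 * (haarSep e e' ^ 3)⁻¹ := by
    rw [← div_eq_mul_inv, inv_eq_one_div, div_le_div_iff₀ (by positivity) (by positivity), one_mul]
    calc haarSep e e' ^ 3 ≤ ((1 + R) * (1 + X)) ^ 3 := by gcongr
      _ = (1 + R) ^ 3 * (1 + X) ^ 3 := by ring
      _ ≤ _ := by
        gcongr
        · linarith
        · norm_num
  calc C * ((4:ℝ) ^ (e'.1 - (e.1 + 1)))⁻¹ / (1 + X) ^ 5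
      = C * (((4:ℝ) ^ (e'.1 - (e.1 + 1)))⁻¹ * ((1 + X) ^ 5)⁻¹) := by ring
    _ ≤ C * ((4 * ((4:ℝ) ^ (e'.1 - e.1))⁻¹) * ((1 + R) ^ 3 * (haarSep e e' ^ 3)⁻¹)) := by gcongr
    _ = _ := by ring

/-- A lower bound for the `L^p(ℓ^q)` quasi-norm through disjoint pieces on each level. -/
lemma FNorm_ge_of_pieces {p q s : ℝ} (hq : 0 < q) (hqp : q < p) {φ₀ : ℝ → ℂ} {g : ℝ → ℂ}
    (E : Finset (ℕ × ℤ)) {x₀ r : ℝ} (hr0 : 0 < r) (hr : r ≤ 1 / 4) {M : ℝ} (hM : 0 < M)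
    (hE : ∀ e ∈ E, |(e.2:ℝ) / 2 ^ e.1| ≤ M) {t : ℕ × ℤ → ℝ} (ht : ∀ e, 0 ≤ t e)
    (hg : ∀ e ∈ E, ∀ x : ℝ, |(2:ℝ) ^ e.1 * x - e.2 - x₀| ≤ r →
      t e ≤ (2:ℝ) ^ (((e.1 + 1 : ℕ):ℝ) * s) * ‖LPop φ₀ (e.1 + 1) g x‖) :
    ENNReal.ofReal ((2 * (M + (|x₀| + r))) ^ (1 / p - 1 / q) *
      (∑ e ∈ E, 2 * r * ((2:ℝ) ^ e.1)⁻¹ * t e ^ q) ^ (1 / q)) ≤ FNorm φ₀ p q s g := by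
  have hp : 0 < p := by linarith
  set R := |x₀| + r with hR
  have hR0 : 0 < R := by positivity
  set J : ℕ × ℤ → Set ℝ := fun e => {x | |(2:ℝ) ^ e.1 * x - e.2 - x₀| ≤ r} with hJ
  have hJeq : ∀ e, J e = Set.Icc ((2 ^ e.1)⁻¹ * (e.2 + x₀ - r)) ((2 ^ e.1)⁻¹ * (e.2 + x₀ + r)) := by
    intro e
    have h2 : (0:ℝ) < 2 ^ e.1 := by positivity
    ext x
    simp only [hJ, Set.mem_ofPred_eq, Set.mem_Icc, abs_le]
    rw [inv_mul_le_iff₀ h2, le_inv_mul_iff₀ h2]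
    constructor <;> rintro ⟨_, _⟩ <;> constructor <;> linarith
  have hJm : ∀ e, MeasurableSet (J e) := fun e => by rw [hJeq]; exact measurableSet_Icc
  have hJv : ∀ e, volume (J e) = ENNReal.ofReal (2 * r * ((2:ℝ) ^ e.1)⁻¹) := fun e => by
    rw [hJeq, Real.volume_Icc]; congr 1; ring
  set V : ℝ → ℝ≥0∞ := fun x => ∑ e ∈ E, (J e).indicator (fun _ => ENNReal.ofReal (t e ^ q)) x with hV
  have hVm : Measurable V := Finset.measurable_sum _ fun e _ =>
    measurable_const.indicator (hJm e)
  have hVint : ∫⁻ x, V x = ENNReal.ofReal (∑ e ∈ E, 2 * r * ((2:ℝ) ^ e.1)⁻¹ * t e ^ q) := by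
    rw [hV, lintegral_finsetSum _ fun e _ => measurable_const.indicator (hJm e),
      ENNReal.ofReal_sum_of_nonneg fun e _ => mul_nonneg (by positivity) (rpow_nonneg (ht e) _)]
    refine Finset.sum_congr rfl fun e _ => ?_
    rw [lintegral_indicator_const (hJm e), hJv, ← ENNReal.ofReal_mul (rpow_nonneg (ht e) _),
      mul_comm]
  have hpt : ∀ x, V x ≤ ∑' k : ℕ, ENNReal.ofReal ((2:ℝ) ^ ((k:ℝ) * s * q)) *
      (ENNReal.ofReal ‖LPop φ₀ k g x‖) ^ q := by
    intro x
    classical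
    set F : ℕ → ℝ≥0∞ := fun k => ENNReal.ofReal ((2:ℝ) ^ ((k:ℝ) * s * q)) *
      (ENNReal.ofReal ‖LPop φ₀ k g x‖) ^ q with hF
    have h1 : V x = ∑ e ∈ E.filter (fun e => x ∈ J e), ENNReal.ofReal (t e ^ q) := by
      simp only [hV, Set.indicator_apply, Finset.sum_filter]
    have h2 : ∀ e ∈ E.filter (fun e => x ∈ J e), ENNReal.ofReal (t e ^ q) ≤ F (e.1 + 1) := by
      intro e he
      obtain ⟨heE, hxe⟩ := Finset.mem_filter.mp he
      simp only [hF]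
      rw [ENNReal.ofReal_rpow_of_nonneg (norm_nonneg _) hq.le,
        ← ENNReal.ofReal_mul (by positivity)]
      apply ENNReal.ofReal_le_ofReal
      rw [rpow_mul (by norm_num), ← mul_rpow (by positivity) (norm_nonneg _)]
      exact rpow_le_rpow (ht e) (hg e heE x hxe) hq.le
    have hinj : Set.InjOn (fun e : ℕ × ℤ => e.1 + 1) (E.filter (fun e => x ∈ J e) : Set (ℕ × ℤ)) := by
      intro a ha b hb hab
      have h3 : a.1 = b.1 := Nat.succ_injective hab
      have ha' : |(2:ℝ) ^ a.1 * x - a.2 - x₀| ≤ r := (Finset.mem_filter.mp ha).2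
      have hb' : |(2:ℝ) ^ b.1 * x - b.2 - x₀| ≤ r := (Finset.mem_filter.mp hb).2
      rw [← h3] at hb'
      have h4 : |((a.2 - b.2 : ℤ):ℝ)| < 1 := by
        rw [abs_le] at ha' hb'
        push_cast
        rw [abs_lt]
        constructor <;> linarith
      have h5 : a.2 - b.2 = 0 := Int.abs_lt_one_iff.mp (by exact_mod_cast h4)
      exact Prod.ext h3 (by omega)
    rw [h1]
    calc _ ≤ ∑ e ∈ E.filter (fun e => x ∈ J e), F (e.1 + 1) := Finset.sum_le_sum h2
      _ = ∑ k ∈ (E.filter (fun e => x ∈ J e)).image (fun e => e.1 + 1), F k :=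
          (Finset.sum_image hinj).symm
      _ ≤ _ := ENNReal.sum_le_tsum _
  set Q : Set ℝ := Set.Icc (-(M + R)) (M + R) with hQ
  have hQv : volume Q = ENNReal.ofReal (2 * (M + R)) := by
    rw [hQ, Real.volume_Icc]; congr 1; ring
  have hsupp : ∀ x, V x = V x * Q.indicator 1 x := by
    intro x
    by_cases hx : x ∈ Q
    · simp [hx]
    · rw [Set.indicator_of_notMem hx, mul_zero]
      refine Finset.sum_eq_zero fun e he => Set.indicator_of_notMem (fun hxe => hx ?_) _
      have h2 : (1:ℝ) ≤ 2 ^ e.1 := one_le_pow₀ (by norm_num)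
      have hxe' : |(2:ℝ) ^ e.1 * x - e.2 - x₀| ≤ r := hxe
      have h3 : |x - (e.2:ℝ) / 2 ^ e.1| ≤ R := by
        have e1 : x - (e.2:ℝ) / 2 ^ e.1 = (2 ^ e.1)⁻¹ * (2 ^ e.1 * x - e.2) := by field_simp
        rw [e1, abs_mul, abs_of_pos (by positivity : (0:ℝ) < (2 ^ e.1)⁻¹)]
        have h4 : |(2:ℝ) ^ e.1 * x - e.2| ≤ |(2:ℝ) ^ e.1 * x - e.2 - x₀| + |x₀| := by
          simpa using abs_add_le ((2:ℝ) ^ e.1 * x - e.2 - x₀) x₀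
        calc _ ≤ 1 * |(2:ℝ) ^ e.1 * x - e.2| := by
              gcongr; exact inv_le_one_of_one_le₀ h2
          _ ≤ R := by linarith
      have h6 := hE e he
      rw [abs_le] at h3 h6
      exact ⟨by linarith, by linarith⟩
  have hpq : (p / q).HolderConjugate (p / (p - q)) := by
    rw [Real.holderConjugate_iff]
    refine ⟨by rw [lt_div_iff₀ hq]; linarith, ?_⟩
    have : p - q ≠ 0 := by linarith
    field_simp; ring
  have hHolder : ∫⁻ x, V x ≤ (∫⁻ x, V x ^ (p / q)) ^ (q / p) *
      ENNReal.ofReal (2 * (M + R)) ^ (1 - q / p) := by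
    have h := ENNReal.lintegral_mul_le_Lp_mul_Lq volume hpq hVm.aemeasurable
      ((measurable_one.indicator (measurableSet_Icc : MeasurableSet Q)).aemeasurable)
    calc ∫⁻ x, V x = ∫⁻ x, (V * Q.indicator (1 : ℝ → ℝ≥0∞)) x := lintegral_congr hsupp
      _ ≤ _ := h
      _ = _ := by
        have hr1 : 0 < p / (p - q) := div_pos hp (by linarith)
        have e1 : ∀ x, (Q.indicator (1 : ℝ → ℝ≥0∞) x) ^ (p / (p - q)) = Q.indicator 1 x := fun x => by
          by_cases hx : x ∈ Q
          · simp [hx]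
          · simp [hx, hr1]
        rw [← hQ]
        simp only [e1]
        rw [lintegral_indicator_one measurableSet_Icc, hQv]
        congr 2
        · field_simp
        · field_simp
  have hFge : (∫⁻ x, V x ^ (p / q)) ^ (1 / p) ≤ FNorm φ₀ p q s g := by
    unfold FNorm
    refine ENNReal.rpow_le_rpow (lintegral_mono fun x => ?_) (by positivity)
    exact ENNReal.rpow_le_rpow (hpt x) (by positivity)
  refine le_trans ?_ hFge
  set S := ∑ e ∈ E, 2 * r * ((2:ℝ) ^ e.1)⁻¹ * t e ^ q with hS
  have hS0 : 0 ≤ S := Finset.sum_nonneg fun e _ => mul_nonneg (by positivity) (rpow_nonneg (ht e) _)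
  rw [hVint] at hHolder
  set N := 2 * (M + R) with hN
  have hN0 : 0 < N := by positivity
  have h7 := ENNReal.rpow_le_rpow hHolder (by positivity : (0:ℝ) ≤ 1 / q)
  rw [ENNReal.ofReal_rpow_of_nonneg hS0 (by positivity),
    ENNReal.mul_rpow_of_nonneg _ _ (by positivity), ← ENNReal.rpow_mul, ← ENNReal.rpow_mul,
    ENNReal.ofReal_rpow_of_pos hN0] at h7
  have e1 : q / p * (1 / q) = 1 / p := by field_simp
  have e2 : (1 - q / p) * (1 / q) = -(1 / p - 1 / q) := by field_simp; ring
  rw [e1, e2] at h7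
  rw [ENNReal.ofReal_mul (by positivity)]
  calc _ ≤ ENNReal.ofReal (N ^ (1 / p - 1 / q)) * ((∫⁻ x, V x ^ (p / q)) ^ (1 / p) *
        ENNReal.ofReal (N ^ (-(1 / p - 1 / q)))) := by gcongr
    _ = _ := by
      rw [mul_comm, mul_assoc, ← ENNReal.ofReal_mul (by positivity), ← rpow_add hN0]
      simp

lemma exists_FNorm_haarSum_ge {p q : ℝ} (hq : 1 < q) (hqp : q < p) {φ₀ : ℝ → ℂ}
    (hs : ContDiff ℝ (⊤ : ℕ∞) φ₀) (hc : HasCompactSupport φ₀)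
    (hone : ∀ ξ : ℝ, |ξ| ≤ 4/3 → φ₀ ξ = 1) (hzero : ∀ ξ : ℝ, 3/2 ≤ |ξ| → φ₀ ξ = 0) :
    ∃ K₀ : ℕ, ∀ K ≥ K₀, ∃ κ : ℝ, 0 < κ ∧ ∀ (E : Finset (ℕ × ℤ)) (c : ℕ × ℤ → ℂ),
      IsSeparated K E → (∀ e ∈ E, |(e.2:ℝ) / 2 ^ e.1| ≤ 2 ^ K) →
      ENNReal.ofReal (κ * (∑ e ∈ E, ((2:ℝ) ^ e.1)⁻¹ *
        ((2:ℝ) ^ (-((e.1:ℝ) * (1 - 1 / q))) * ‖c e‖) ^ q) ^ (1 / q)) ≤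
      FNorm φ₀ p q (-1 + 1 / q) (fun x => ∑ e ∈ E, c e * haarFn e.1 e.2 x) := by
  have hq0 : 0 < q := by linarith
  set α := 1 - 1 / q with hα
  have hq1 : 1 / q < 1 := by rw [div_lt_one hq0]; exact hq
  have hα0 : 0 < α := by linarith
  have hα1 : α < 1 := by have : 0 < 1 / q := by positivity
                         linarith
  obtain ⟨γ, x₀, r, hγ, hr0, hr, hlow⟩ := exists_LPop_haarFn_lower hs hc hone hzero
  obtain ⟨C, hC, hat⟩ := exists_LPop_atom_bound hs hc
  set D := 4 * C * (1 + (|x₀| + r)) ^ 3 with hD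
  have hD0 : 0 < D := by positivity
  obtain ⟨K₀, hK₀⟩ := exists_schur_haar_le hq.le hα0 hα1 (ε := γ / (4 * D)) (by positivity)
  refine ⟨K₀, fun K hK => ⟨(2 * (2 ^ K + (|x₀| + r))) ^ (1 / p - 1 / q) *
    (2 * r * ((2:ℝ) ^ (-α)) ^ q * ((γ / 2) ^ q / 2)) ^ (1 / q), by positivity,
    fun E c hE hEM => ?_⟩⟩
  set b : ℕ × ℤ → ℝ := fun e => (2:ℝ) ^ (-((e.1:ℝ) * α)) * ‖c e‖ with hb
  have hb0 : ∀ e, 0 ≤ b e := fun e => by positivity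
  set u : ℕ × ℤ → ℝ := fun e => ∑ i ∈ E.erase e,
    (levelWeight α e.1 i.1 * (haarSep e i ^ 3)⁻¹) * b i with hu
  have hu0 : ∀ e, 0 ≤ u e := fun e => Finset.sum_nonneg fun i _ =>
    mul_nonneg (mul_nonneg (levelWeight_nonneg _ _ _)
      (inv_nonneg.mpr (pow_nonneg (by linarith [one_le_haarSep e i]) _))) (hb0 i)
  set m : ℕ × ℤ → ℝ := fun e => max 0 (γ * b e - D * u e) with hm
  have hm0 : ∀ e, 0 ≤ m e := fun e => le_max_left _ _
  set g : ℝ → ℂ := fun x => ∑ e ∈ E, c e * haarFn e.1 e.2 x with hg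
  have hpiece : ∀ e ∈ E, ∀ x : ℝ, |(2:ℝ) ^ e.1 * x - e.2 - x₀| ≤ r →
      (2:ℝ) ^ (-α) * m e ≤
        (2:ℝ) ^ (((e.1 + 1 : ℕ):ℝ) * (-1 + 1 / q)) * ‖LPop φ₀ (e.1 + 1) g x‖ := by
    intro e he x hx
    have e1 : (2:ℝ) ^ (((e.1 + 1 : ℕ):ℝ) * (-1 + 1 / q)) =
        (2:ℝ) ^ (-α) * (2:ℝ) ^ (-((e.1:ℝ) * α)) := by
      rw [← rpow_add (by norm_num)]; congr 1; rw [hα]; push_cast; ring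
    rw [e1, mul_assoc]
    refine mul_le_mul_of_nonneg_left (max_le (by positivity) ?_) (by positivity)
    have e2 : LPop φ₀ (e.1 + 1) g x =
        c e * LPop φ₀ (e.1 + 1) (haarFn e.1 e.2) x +
          ∑ i ∈ E.erase e, c i * LPop φ₀ (e.1 + 1) (haarFn i.1 i.2) x := by
      rw [Finset.add_sum_erase E (fun i => c i * LPop φ₀ (e.1 + 1) (haarFn i.1 i.2) x) he]
      exact LPop_sum hs hc E c (fun i => haarFn i.1 i.2)
        (fun i _ => (isDyadicAtom_haarFn i.1 i.2).integrable) (e.1 + 1) x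
    have h1 : ‖c e‖ * γ ≤ ‖c e * LPop φ₀ (e.1 + 1) (haarFn e.1 e.2) x‖ := by
      rw [norm_mul]; gcongr; exact hlow _ _ _ hx
    have h2 : (2:ℝ) ^ (-((e.1:ℝ) * α)) *
        ‖∑ i ∈ E.erase e, c i * LPop φ₀ (e.1 + 1) (haarFn i.1 i.2) x‖ ≤ D * u e := by
      rw [hu, Finset.mul_sum]
      refine (mul_le_mul_of_nonneg_left (norm_sum_le _ _) (by positivity)).trans ?_
      rw [Finset.mul_sum]
      refine Finset.sum_le_sum fun i _ => ?_
      rw [norm_mul]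
      have h3 := norm_LPop_haarFn_le hC hr0 hat e i hx
      have e3 : levelWeight α e.1 i.1 * (2:ℝ) ^ (-((i.1:ℝ) * α)) =
          (2:ℝ) ^ (-((e.1:ℝ) * α)) * ((4:ℝ) ^ (i.1 - e.1))⁻¹ := by
        unfold levelWeight
        rw [mul_right_comm, ← rpow_add (by norm_num)]
        congr 2; ring
      calc _ ≤ (2:ℝ) ^ (-((e.1:ℝ) * α)) * (‖c i‖ *
            (D * (((4:ℝ) ^ (i.1 - e.1))⁻¹ * (haarSep e i ^ 3)⁻¹))) := by gcongr
        _ = D * (haarSep e i ^ 3)⁻¹ * ‖c i‖ *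
            ((2:ℝ) ^ (-((e.1:ℝ) * α)) * ((4:ℝ) ^ (i.1 - e.1))⁻¹) := by ring
        _ = _ := by rw [← e3]; ring
    have h4 : ‖c e * LPop φ₀ (e.1 + 1) (haarFn e.1 e.2) x‖ ≤ ‖LPop φ₀ (e.1 + 1) g x‖ +
        ‖∑ i ∈ E.erase e, c i * LPop φ₀ (e.1 + 1) (haarFn i.1 i.2) x‖ := by
      rw [e2]
      exact norm_le_add_norm_add _ _
    have h5 := mul_le_mul_of_nonneg_left (h1.trans h4)
      (by positivity : 0 ≤ (2:ℝ) ^ (-((e.1:ℝ) * α)))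
    simp only [hb]
    rw [mul_add] at h5
    linarith
  have hmain := FNorm_ge_of_pieces (s := -1 + 1 / q) hq0 hqp E hr0 hr (by positivity) hEM
    (t := fun e => (2:ℝ) ^ (-α) * m e) (fun e => mul_nonneg (by positivity) (hm0 e)) hpiece
  refine le_trans (ENNReal.ofReal_le_ofReal ?_) hmain
  set S := ∑ e ∈ E, ((2:ℝ) ^ e.1)⁻¹ * b e ^ q with hS
  have hS0 : 0 ≤ S := Finset.sum_nonneg fun e _ => mul_nonneg (by positivity) (rpow_nonneg (hb0 e) _)
  have hschur := hK₀ K hK E b hE hb0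
  have hT : (γ / 2) ^ q / 2 * S ≤ ∑ e ∈ E, ((2:ℝ) ^ e.1)⁻¹ * m e ^ q := by
    have hpt : ∀ e ∈ E, ((2:ℝ) ^ e.1)⁻¹ * b e ^ q * γ ^ q ≤
        2 ^ q * (((2:ℝ) ^ e.1)⁻¹ * m e ^ q) + 2 ^ q * (D ^ q * (((2:ℝ) ^ e.1)⁻¹ * u e ^ q)) := by
      intro e _
      have h1 : γ * b e ≤ m e + D * u e := by
        have := le_max_right 0 (γ * b e - D * u e)
        change γ * b e - D * u e ≤ m e at this
        linarith
      have h2 : (γ * b e) ^ q ≤ 2 ^ q * (m e ^ q + (D * u e) ^ q) := by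
        have hDu : 0 ≤ D * u e := mul_nonneg hD0.le (hu0 e)
        have hme := hm0 e
        rcases le_total (m e) (D * u e) with h | h
        · calc (γ * b e) ^ q ≤ (2 * (D * u e)) ^ q :=
                rpow_le_rpow (mul_nonneg hγ.le (hb0 e)) (by linarith) hq0.le
            _ = 2 ^ q * (D * u e) ^ q := mul_rpow (by norm_num) hDu
            _ ≤ _ := mul_le_mul_of_nonneg_left (by linarith [rpow_nonneg hme q]) (by positivity)
        · calc (γ * b e) ^ q ≤ (2 * m e) ^ q :=
                rpow_le_rpow (mul_nonneg hγ.le (hb0 e)) (by linarith) hq0.le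
            _ = 2 ^ q * m e ^ q := mul_rpow (by norm_num) hme
            _ ≤ _ := mul_le_mul_of_nonneg_left (by linarith [rpow_nonneg hDu q]) (by positivity)
      rw [mul_rpow hγ.le (hb0 e), mul_rpow hD0.le (hu0 e)] at h2
      have h3 := mul_le_mul_of_nonneg_left h2 (by positivity : 0 ≤ ((2:ℝ) ^ e.1)⁻¹)
      linarith
    have hsum := Finset.sum_le_sum hpt
    rw [Finset.sum_add_distrib, ← Finset.sum_mul, ← Finset.mul_sum, ← Finset.mul_sum,
      ← Finset.mul_sum] at hsum
    have h4 : (2:ℝ) ^ q * (D ^ q * ∑ e ∈ E, ((2:ℝ) ^ e.1)⁻¹ * u e ^ q) ≤ γ ^ q / 2 * S := by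
      calc _ ≤ (2:ℝ) ^ q * (D ^ q * ((γ / (4 * D)) ^ q * S)) := by gcongr
        _ = (2 * (D * (γ / (4 * D)))) ^ q * S := by
            rw [mul_rpow (x := 2) (y := D * (γ / (4 * D))) (by norm_num) (by positivity),
              mul_rpow (x := D) (y := γ / (4 * D)) hD0.le (by positivity)]; ring
        _ = (γ * (1 / 2)) ^ q * S := by congr 2; field_simp; norm_num
        _ ≤ _ := by
            rw [mul_rpow hγ.le (by norm_num)]
            have : (1 / 2 : ℝ) ^ q ≤ 1 / 2 := by
              calc (1 / 2 : ℝ) ^ q ≤ (1 / 2 : ℝ) ^ (1:ℝ) :=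
                    rpow_le_rpow_of_exponent_ge (by norm_num) (by norm_num) hq.le
                _ = _ := rpow_one _
            refine mul_le_mul_of_nonneg_right ?_ hS0
            calc γ ^ q * (1 / 2) ^ q ≤ γ ^ q * (1 / 2) := by gcongr
              _ = _ := by ring
    have h5 : γ ^ q / 2 * S ≤ 2 ^ q * ∑ e ∈ E, ((2:ℝ) ^ e.1)⁻¹ * m e ^ q := by
      have e5 : (∑ e ∈ E, ((2:ℝ) ^ e.1)⁻¹ * b e ^ q) = S := rfl
      rw [e5] at hsum
      linarith
    rw [div_rpow hγ.le (by norm_num)]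
    have h2q : (0:ℝ) < 2 ^ q := by positivity
    calc γ ^ q / 2 ^ q / 2 * S = (γ ^ q / 2 * S) / 2 ^ q := by ring
      _ ≤ _ := by rw [div_le_iff₀ h2q]; linarith
  have hfin : 2 * r * ((2:ℝ) ^ (-α)) ^ q * ((γ / 2) ^ q / 2) * S ≤
      ∑ e ∈ E, 2 * r * ((2:ℝ) ^ e.1)⁻¹ * ((2:ℝ) ^ (-α) * m e) ^ q := by
    calc _ = 2 * r * ((2:ℝ) ^ (-α)) ^ q * ((γ / 2) ^ q / 2 * S) := by ring
      _ ≤ 2 * r * ((2:ℝ) ^ (-α)) ^ q * ∑ e ∈ E, ((2:ℝ) ^ e.1)⁻¹ * m e ^ q := by gcongr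
      _ = _ := by
          rw [Finset.mul_sum]
          refine Finset.sum_congr rfl fun e _ => ?_
          rw [mul_rpow (by positivity) (hm0 e)]; ring
  rw [mul_assoc, ← mul_rpow (by positivity) hS0]
  refine mul_le_mul_of_nonneg_left (rpow_le_rpow (by positivity) hfin (by positivity))
    (by positivity)

/-- The real-valued Haar function. -/
def haarReal (j : ℕ) (μ : ℤ) : ℝ → ℝ := fun x =>
  (Set.Ico ((2:ℝ)^(-(j:ℤ)) * μ) ((2:ℝ)^(-(j:ℤ)) * (μ + 1/2))).indicator (fun _ => (1:ℝ)) x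
  - (Set.Ico ((2:ℝ)^(-(j:ℤ)) * (μ + 1/2)) ((2:ℝ)^(-(j:ℤ)) * (μ + 1))).indicator (fun _ => (1:ℝ)) x

/-- The primitive of a Haar function. -/
def haarTent (j : ℕ) (μ : ℤ) (x : ℝ) : ℝ :=
  max 0 (((2:ℝ) ^ j)⁻¹ / 2 - |x - (μ + 1 / 2) / 2 ^ j|)

/-- The odd step function equal to `1` on `[-1/2, 0)` and `-1` on `(0, 1/2]`. -/
def oddStep (t : ℝ) : ℝ :=
  (Set.Icc (0:ℝ) (1 / 2)).indicator (fun _ => (1:ℝ)) (-t) -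
    (Set.Icc (0:ℝ) (1 / 2)).indicator (fun _ => (1:ℝ)) t

lemma haarFn_eq_ofReal (j : ℕ) (μ : ℤ) (x : ℝ) : haarFn j μ x = (haarReal j μ x : ℂ) := by
  simp only [haarFn, haarReal, Set.indicator_apply]
  split_ifs <;> simp

lemma measurable_haarReal (j : ℕ) (μ : ℤ) : Measurable (haarReal j μ) := by
  unfold haarReal
  exact (measurable_const.indicator measurableSet_Ico).sub
    (measurable_const.indicator measurableSet_Ico)

lemma abs_haarReal_le (j : ℕ) (μ : ℤ) (x : ℝ) : |haarReal j μ x| ≤ 1 := by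
  have := (isDyadicAtom_haarFn j μ).norm_le x
  rwa [haarFn_eq_ofReal, Complex.norm_real] at this

lemma measurable_oddStep : Measurable oddStep := by
  unfold oddStep
  exact ((measurable_const.indicator measurableSet_Icc).comp measurable_neg).sub
    (measurable_const.indicator measurableSet_Icc)

lemma integral_indicator_Ico_interval {u v a b : ℝ} (huv : u ≤ v) :
    (∫ t in u..v, (Set.Ico a b).indicator (fun _ => (1:ℝ)) t) =
      max 0 (min v b - max u a) := by
  rw [intervalIntegral.integral_of_le huv, integral_congr_ae
    (g := (Set.Ioc a b).indicator (fun _ => (1:ℝ)))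
    (ae_restrict_of_ae (indicator_ae_eq_of_ae_eq_set Ico_ae_eq_Ioc)),
    integral_indicator measurableSet_Ioc,
    Measure.restrict_restrict measurableSet_Ioc, Set.Ioc_inter_Ioc]
  simp [Measure.real, ENNReal.toReal_ofReal', max_comm, min_comm]

lemma intervalIntegral_haarReal (j : ℕ) (μ : ℤ) {u v : ℝ} (huv : u ≤ v) :
    (∫ t in u..v, haarReal j μ t) = haarTent j μ v - haarTent j μ u := by
  have hint : ∀ a b : ℝ, IntervalIntegrable
      ((Set.Ico a b).indicator (fun _ => (1:ℝ))) volume u v := by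
    intro a b
    refine (intervalIntegrable_const (c := (1:ℝ))).mono_fun
      (measurable_const.indicator measurableSet_Ico).aestronglyMeasurable
      (Filter.Eventually.of_forall fun x => ?_)
    simp only [Set.indicator_apply]
    split_ifs <;> simp
  unfold haarReal
  rw [intervalIntegral.integral_sub (hint _ _) (hint _ _), integral_indicator_Ico_interval huv,
    integral_indicator_Ico_interval huv]
  unfold haarTent
  have hz : (2:ℝ) ^ (-(j:ℤ)) = ((2:ℝ) ^ j)⁻¹ := by rw [zpow_neg, zpow_natCast]
  have hd : (0:ℝ) < ((2:ℝ) ^ j)⁻¹ := by positivity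
  have e1 : ((μ:ℝ) + 1 / 2) / 2 ^ j = ((2:ℝ) ^ j)⁻¹ * (μ + 1 / 2) := by ring
  rw [hz, e1]
  have e2 : ((2:ℝ) ^ j)⁻¹ * (μ:ℝ) = ((2:ℝ) ^ j)⁻¹ * (μ + 1 / 2) - ((2:ℝ) ^ j)⁻¹ / 2 := by ring
  have e3 : ((2:ℝ) ^ j)⁻¹ * ((μ:ℝ) + 1) =
      ((2:ℝ) ^ j)⁻¹ * (μ + 1 / 2) + ((2:ℝ) ^ j)⁻¹ / 2 := by ring
  rw [e2, e3]
  generalize ((2:ℝ) ^ j)⁻¹ * ((μ:ℝ) + 1 / 2) = c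
  generalize ((2:ℝ) ^ j)⁻¹ = d at *
  rw [abs_eq_max_neg, abs_eq_max_neg]
  grind

lemma integral_oddStep_mul_haarReal (j : ℕ) (μ : ℤ) {N : ℝ} (hN : 0 < N) (y : ℝ) :
    (∫ t, oddStep (N * (t - y)) * haarReal j μ t) =
      2 * haarTent j μ y - haarTent j μ (y - (2 * N)⁻¹) - haarTent j μ (y + (2 * N)⁻¹) := by
  have hw : 0 < (2 * N)⁻¹ := by positivity
  have hNw : N * (2 * N)⁻¹ = 1 / 2 := by field_simp
  set w := (2 * N)⁻¹ with hwd
  have hpt : ∀ t, oddStep (N * (t - y)) * haarReal j μ t =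
      (Set.Icc (y - w) y).indicator (haarReal j μ) t -
        (Set.Icc y (y + w)).indicator (haarReal j μ) t := by
    intro t
    have h1 : -(N * (t - y)) ∈ Set.Icc (0:ℝ) (1 / 2) ↔ t ∈ Set.Icc (y - w) y := by
      rw [← hNw]
      constructor
      · rintro ⟨h1, h2⟩
        constructor <;> nlinarith
      · rintro ⟨h1, h2⟩
        constructor <;> nlinarith
    have h2 : N * (t - y) ∈ Set.Icc (0:ℝ) (1 / 2) ↔ t ∈ Set.Icc y (y + w) := by
      rw [← hNw]
      constructor
      · rintro ⟨h1, h2⟩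
        constructor <;> nlinarith
      · rintro ⟨h1, h2⟩
        constructor <;> nlinarith
    simp only [oddStep, Set.indicator_apply, h1, h2]
    split_ifs <;> ring
  have hint : ∀ a b : ℝ, Integrable ((Set.Icc a b).indicator (haarReal j μ)) := by
    intro a b
    refine IntegrableOn.integrable_indicator ?_ measurableSet_Icc
    exact Measure.integrableOn_of_bounded (M := 1) (by simp)
      (measurable_haarReal j μ).aestronglyMeasurable
      (Filter.Eventually.of_forall fun x => abs_haarReal_le j μ x)
  simp_rw [hpt]
  rw [integral_sub (hint _ _) (hint _ _), integral_indicator measurableSet_Icc,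
    integral_indicator measurableSet_Icc, integral_Icc_eq_integral_Ioc,
    integral_Icc_eq_integral_Ioc, ← intervalIntegral.integral_of_le (by linarith),
    ← intervalIntegral.integral_of_le (by linarith), intervalIntegral_haarReal j μ (by linarith),
    intervalIntegral_haarReal j μ (by linarith)]
  ring

lemma haarTent_second_difference_le (j : ℕ) (μ : ℤ) (y : ℝ) {w : ℝ} (hw : 0 ≤ w) :
    2 * haarTent j μ y - haarTent j μ (y - w) - haarTent j μ (y + w) ≤ 2 * w := by
  unfold haarTent
  generalize ((2:ℝ) ^ j)⁻¹ / 2 = d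
  generalize ((μ:ℝ) + 1 / 2) / 2 ^ j = c
  simp only [abs_eq_max_neg]
  grind

lemma haarTent_second_difference_nonpos (j : ℕ) (μ : ℤ) {y w : ℝ} (hw : 0 ≤ w)
    (h : w ≤ |y - (μ + 1 / 2) / 2 ^ j|) :
    2 * haarTent j μ y - haarTent j μ (y - w) - haarTent j μ (y + w) ≤ 0 := by
  unfold haarTent
  generalize ((2:ℝ) ^ j)⁻¹ / 2 = d
  revert h
  generalize ((μ:ℝ) + 1 / 2) / 2 ^ j = c
  intro h
  simp only [abs_eq_max_neg] at *
  grind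

lemma haarTent_second_difference_left (j : ℕ) (μ : ℤ) {w : ℝ} (hw : 0 ≤ w)
    (h : w ≤ ((2:ℝ) ^ j)⁻¹ / 2) :
    2 * haarTent j μ (μ / 2 ^ j) - haarTent j μ (μ / 2 ^ j - w) -
      haarTent j μ (μ / 2 ^ j + w) = - w := by
  unfold haarTent
  have e : ((μ:ℝ) + 1 / 2) / 2 ^ j = μ / 2 ^ j + ((2:ℝ) ^ j)⁻¹ / 2 := by ring
  rw [e]
  revert h
  generalize ((2:ℝ) ^ j)⁻¹ / 2 = d
  generalize (μ:ℝ) / 2 ^ j = c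
  intro h
  simp only [abs_eq_max_neg]
  grind

lemma haarTent_intCast_div (j : ℕ) (μ k : ℤ) : haarTent j μ (k / 2 ^ j) = 0 := by
  unfold haarTent
  refine max_eq_left ?_
  have e : (k:ℝ) / 2 ^ j - (μ + 1 / 2) / 2 ^ j = (k - μ - 1 / 2) * ((2:ℝ) ^ j)⁻¹ := by ring
  rw [e, abs_mul, abs_of_pos (by positivity : 0 < ((2:ℝ) ^ j)⁻¹)]
  have : (1 / 2 : ℝ) ≤ |(k:ℝ) - μ - 1 / 2| := by
    rcases le_or_gt k μ with h | h
    · have : (k:ℝ) ≤ μ := by exact_mod_cast h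
      rw [abs_of_nonpos (by linarith)]; linarith
    · have : (μ:ℝ) + 1 ≤ k := by exact_mod_cast h
      rw [abs_of_nonneg (by linarith)]; linarith
  have hp : 0 < ((2:ℝ) ^ j)⁻¹ := by positivity
  nlinarith

lemma two_pow_mul_odd_inj {a b : ℕ} {x y : ℤ}
    (h : (2:ℤ) ^ a * (2 * x + 1) = 2 ^ b * (2 * y + 1)) : a = b ∧ x = y := by
  have key : ∀ (a c : ℕ) (x y : ℤ), (2:ℤ) ^ a * (2 * x + 1) = 2 ^ (a + c) * (2 * y + 1) →
      c = 0 ∧ x = y := by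
    intro a c x y h
    rw [pow_add, mul_assoc] at h
    have h2 := mul_left_cancel₀ (by positivity : (2:ℤ) ^ a ≠ 0) h
    rcases c with _ | c
    · exact ⟨rfl, by simpa using h2⟩
    · exfalso
      rw [pow_succ, mul_comm ((2:ℤ) ^ c) 2, mul_assoc] at h2
      omega
  rcases le_total a b with hab | hab
  · obtain ⟨c, rfl⟩ := Nat.exists_eq_add_of_le hab
    obtain ⟨h1, h2⟩ := key a c x y h
    exact ⟨by omega, h2⟩
  · obtain ⟨c, rfl⟩ := Nat.exists_eq_add_of_le hab
    obtain ⟨h1, h2⟩ := key b c y x h.symm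
    exact ⟨by omega, h2.symm⟩

lemma centre_eq_midpoint {K j j' : ℕ} {ν μ : ℤ}
    (h : centre K j ν = ((μ:ℝ) + 1 / 2) / 2 ^ j') : j = j' + K ∧ ν = μ := by
  unfold centre at h
  rw [div_eq_div_iff (by positivity) (by positivity)] at h
  have h2 : (2:ℝ) ^ (j' + K) * (2 * ν + 1) = 2 ^ j * (2 * μ + 1) := by
    rw [pow_add]; linear_combination 2 * h
  have h3 : (2:ℤ) ^ (j' + K) * (2 * ν + 1) = 2 ^ j * (2 * μ + 1) := by exact_mod_cast h2
  obtain ⟨h4, h5⟩ := two_pow_mul_odd_inj h3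
  exact ⟨h4.symm, h5⟩

lemma haarTent_second_difference_dyadic {j j' l : ℕ} (hjl : j ≤ l) (μ k : ℤ)
    (hne : (k:ℝ) / 2 ^ j ≠ ((μ:ℝ) + 1 / 2) / 2 ^ j') :
    2 * haarTent j' μ (k / 2 ^ j) - haarTent j' μ (k / 2 ^ j - (2 * 2 ^ l)⁻¹) -
      haarTent j' μ (k / 2 ^ j + (2 * 2 ^ l)⁻¹) ≤ 0 := by
  rcases le_or_gt j' l with h | h
  · refine haarTent_second_difference_nonpos j' μ (by positivity) ?_
    obtain ⟨a, rfl⟩ := Nat.exists_eq_add_of_le hjl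
    obtain ⟨b, hb⟩ := Nat.exists_eq_add_of_le h
    set n : ℤ := 2 * 2 ^ a * k - 2 ^ b * (2 * μ + 1) with hn
    have e : (k:ℝ) / 2 ^ j - ((μ:ℝ) + 1 / 2) / 2 ^ j' = (n:ℝ) * (2 * 2 ^ (j + a))⁻¹ := by
      have e1 : (k:ℝ) / 2 ^ j = (2 * 2 ^ a * k) * (2 * 2 ^ (j + a))⁻¹ := by
        rw [pow_add]; field_simp
      have e2 : ((μ:ℝ) + 1 / 2) / 2 ^ j' = (2 ^ b * (2 * μ + 1)) * (2 * 2 ^ (j + a))⁻¹ := by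
        rw [hb, pow_add]; field_simp
      rw [e1, e2, hn]; push_cast; ring
    have hn0 : n ≠ 0 := by
      intro h0
      rw [h0] at e
      exact hne (by simpa [sub_eq_zero] using e)
    rw [e, abs_mul, abs_of_pos (by positivity : (0:ℝ) < (2 * 2 ^ (j + a))⁻¹)]
    have : (1:ℝ) ≤ |(n:ℝ)| := by exact_mod_cast Int.one_le_abs hn0
    have hp : (0:ℝ) < (2 * 2 ^ (j + a))⁻¹ := by positivity
    nlinarith
  · obtain ⟨a, rfl⟩ := Nat.exists_eq_add_of_lt h
    obtain ⟨b, rfl⟩ := Nat.exists_eq_add_of_le hjl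
    have e1 : (k:ℝ) / 2 ^ j = ((k * 2 ^ (b + a + 1) : ℤ):ℝ) / 2 ^ (j + b + a + 1) := by
      push_cast
      rw [show j + b + a + 1 = j + (b + a + 1) by ring, pow_add 2 j]
      field_simp
    have e2 : ((2:ℝ) * 2 ^ (j + b))⁻¹ = ((2 ^ a : ℤ):ℝ) / 2 ^ (j + b + a + 1) := by
      push_cast
      rw [show j + b + a + 1 = (j + b) + 1 + a by ring, pow_add 2 (j + b + 1), pow_succ]
      field_simp
    rw [e1, e2, ← sub_div, ← add_div, ← Int.cast_sub, ← Int.cast_add, haarTent_intCast_div,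
      haarTent_intCast_div, haarTent_intCast_div]
    norm_num

lemma exists_contDiff_near_oddStep {η : ℝ} (hη : 0 < η) :
    ∃ ψ : ℝ → ℝ, ContDiff ℝ (⊤ : ℕ∞) ψ ∧ (∀ t, |ψ t| ≤ 1) ∧ (∀ t, 1 / 2 < |t| → ψ t = 0) ∧
      (∀ t, ψ (-t) = -ψ t) ∧ Integrable (fun t => ψ t - oddStep t) ∧
      (∫ t, |ψ t - oddStep t|) ≤ η := by
  set δ := min (η / 4) (1 / 8) with hδ
  have hδ0 : 0 < δ := lt_min (by positivity) (by norm_num)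
  have hδ1 : δ ≤ η / 4 := min_le_left _ _
  have hδ2 : δ ≤ 1 / 8 := min_le_right _ _
  let b : ContDiffBump (1 / 4 : ℝ) := ⟨1 / 4 - δ, 1 / 4, by linarith, by linarith⟩
  set χ : ℝ → ℝ := (Set.Icc (0:ℝ) (1 / 2)).indicator (fun _ => (1:ℝ)) with hχ
  have hb0 : ∀ t, 0 ≤ b t := fun t => b.nonneg
  have hb1 : ∀ t, b t ≤ 1 := fun t => b.le_one
  have hbz : ∀ t, t ∉ Set.Icc (0:ℝ) (1 / 2) → b t = 0 := by
    intro t ht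
    refine b.zero_of_le_dist ?_
    change (1 / 4 : ℝ) ≤ |t - 1 / 4|
    by_contra hcon
    push Not at hcon
    rw [abs_lt] at hcon
    exact ht ⟨by linarith, by linarith⟩
  have hbχ : ∀ t, b t ≤ χ t := by
    intro t
    by_cases ht : t ∈ Set.Icc (0:ℝ) (1 / 2)
    · rw [hχ, Set.indicator_of_mem ht]; exact hb1 t
    · rw [hbz t ht, hχ, Set.indicator_of_notMem ht]
  have hχi : Integrable χ :=
    (integrable_indicator_iff measurableSet_Icc).2 (by simp)
  have hd : Integrable (fun t => χ t - b t) := hχi.sub b.integrable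
  have hdv : (∫ t, (χ t - b t)) ≤ 2 * δ := by
    rw [integral_sub hχi b.integrable, hχ, integral_indicator measurableSet_Icc]
    have h1 := b.measure_closedBall_le_integral volume
    rw [Real.closedBall_eq_Icc] at h1
    have e1 : volume.real (Set.Icc (1 / 4 - b.rIn) (1 / 4 + b.rIn)) = 1 / 2 - 2 * δ := by
      rw [Real.volume_real_Icc_of_le (by linarith [b.rIn_pos])]
      change (1 / 4 + (1 / 4 - δ)) - (1 / 4 - (1 / 4 - δ)) = 1 / 2 - 2 * δ
      ring
    rw [e1] at h1
    simp
    norm_num at *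
    linarith
  have hcmp : ∀ t, |(b (-t) - b t) - oddStep t| ≤ (χ (-t) - b (-t)) + (χ t - b t) := by
    intro t
    have h1 := hbχ t
    have h2 := hbχ (-t)
    change |(b (-t) - b t) - (χ (-t) - χ t)| ≤ _
    rw [abs_le]
    constructor <;> linarith
  have hsum : Integrable (fun t => (χ (-t) - b (-t)) + (χ t - b t)) := hd.comp_neg.add hd
  have hcd : ContDiff ℝ (⊤ : ℕ∞) (fun t => b (-t) - b t) :=
    (b.contDiff.comp contDiff_neg).sub b.contDiff
  refine ⟨fun t => b (-t) - b t, hcd, ?_, ?_, ?_, ?_, ?_⟩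
  · intro t
    have := hb0 t; have := hb1 t; have := hb0 (-t); have := hb1 (-t)
    rw [abs_le]
    constructor <;> linarith
  · intro t ht
    have h1 : b t = 0 := hbz t fun h => by
      rw [abs_of_nonneg h.1] at ht; linarith [h.2]
    have h2 : b (-t) = 0 := hbz (-t) fun h => by
      rw [← abs_neg, abs_of_nonneg h.1] at ht; linarith [h.2]
    simp only [h1, h2, sub_zero]
  · intro t
    simp
  · exact hsum.mono' (hcd.continuous.measurable.sub measurable_oddStep).aestronglyMeasurable
      (Filter.Eventually.of_forall hcmp)
  · refine (integral_mono_of_nonneg (Filter.Eventually.of_forall fun t => abs_nonneg _) hsum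
      (Filter.Eventually.of_forall hcmp)).trans ?_
    rw [integral_add hd.comp_neg hd, integral_neg_eq_self (fun t => χ t - b t)]
    linarith

lemma integrable_mul_haarReal {g : ℝ → ℝ} (hg : Integrable g) (j : ℕ) (μ : ℤ) :
    Integrable (fun t => g t * haarReal j μ t) := by
  refine hg.abs.mono' (hg.aestronglyMeasurable.mul
    (measurable_haarReal j μ).aestronglyMeasurable) (Filter.Eventually.of_forall fun t => ?_)
  rw [norm_mul, Real.norm_eq_abs, Real.norm_eq_abs]
  exact mul_le_of_le_one_right (abs_nonneg _) (abs_haarReal_le j μ t)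

lemma integral_comp_mul_sub (g : ℝ → ℝ) {N : ℝ} (hN : 0 < N) (y : ℝ) :
    (∫ t, g (N * (t - y))) = N⁻¹ * ∫ t, g t := by
  rw [integral_sub_right_eq_self (fun t => g (N * t)) y, Measure.integral_comp_mul_left,
    abs_of_pos (by positivity), smul_eq_mul]

lemma integral_scaled_mul_haarReal_le {ψ : ℝ → ℝ} {η : ℝ} (hψi : Integrable ψ)
    (hi : Integrable (fun t => ψ t - oddStep t)) (hη : (∫ t, |ψ t - oddStep t|) ≤ η)
    (j l : ℕ) (μ : ℤ) (y : ℝ) :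
    (∫ t, ψ (2 ^ l * (t - y)) * haarReal j μ t) ≤
      2 * haarTent j μ y - haarTent j μ (y - (2 * 2 ^ l)⁻¹) - haarTent j μ (y + (2 * 2 ^ l)⁻¹)
        + η * ((2:ℝ) ^ l)⁻¹ := by
  have hN : (0:ℝ) < 2 ^ l := by positivity
  have hs : ∀ g : ℝ → ℝ, Integrable g → Integrable (fun t => g (2 ^ l * (t - y))) :=
    fun g hg => (hg.comp_mul_left' hN.ne').comp_sub_right y
  have ho : Integrable oddStep := by
    refine (hψi.sub hi).congr (Filter.Eventually.of_forall fun t => ?_)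
    simp
  rw [← integral_oddStep_mul_haarReal j μ hN y, ← sub_le_iff_le_add', ← integral_sub
    (integrable_mul_haarReal (hs _ hψi) j μ) (integrable_mul_haarReal (hs _ ho) j μ)]
  calc _ ≤ ∫ t, |ψ (2 ^ l * (t - y)) - oddStep (2 ^ l * (t - y))| := by
        refine integral_mono ((integrable_mul_haarReal (hs _ hψi) j μ).sub
          (integrable_mul_haarReal (hs _ ho) j μ)) (hs _ hi).abs fun t => ?_
        simp only [← sub_mul]
        refine (le_abs_self _).trans ?_
        rw [abs_mul]
        exact mul_le_of_le_one_right (abs_nonneg _) (abs_haarReal_le j μ t)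
    _ = ((2:ℝ) ^ l)⁻¹ * ∫ t, |ψ t - oddStep t| :=
        integral_comp_mul_sub (fun t => |ψ t - oddStep t|) hN y
    _ ≤ ((2:ℝ) ^ l)⁻¹ * η := mul_le_mul_of_nonneg_left hη (by positivity)
    _ = _ := mul_comm _ _

/-- The pairing of a family of rescaled bumps with a Haar function. -/
def bumpPairing (q : ℝ) (K L : ℕ) (A : Finset ℕ) (ψ : ℝ → ℝ) (j' : ℕ) (μ : ℤ) : ℝ :=
  ∑ j ∈ A, (2:ℝ) ^ ((j:ℝ) * (1 - 1 / q)) * ∑ m ∈ Finset.Ico L (2 * L), (2:ℝ) ^ m *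
    ∑ ν ∈ Finset.range (2 ^ j), ∫ t, ψ (2 ^ (j + m) * (t - centre K j (ν:ℤ))) * haarReal j' μ t

lemma centre_eq_int_div {K : ℕ} (hK : 1 ≤ K) (j : ℕ) (ν : ℤ) :
    centre K j ν = ((2 ^ (K - 1) * (2 * ν + 1) : ℤ) : ℝ) / 2 ^ j := by
  unfold centre
  obtain ⟨k, rfl⟩ := Nat.exists_eq_add_of_le hK
  push_cast
  rw [show 1 + k - 1 = k by omega, pow_add]
  ring

/-- Position at level `j'` of the Haar function whose support starts at `centre K j ν`. -/
def haarPos (K j j' : ℕ) (ν : ℤ) : ℤ := 2 ^ (K - 1) * (2 ^ (j' - j) * (2 * ν + 1))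

lemma haarPos_div {K : ℕ} (hK : 1 ≤ K) {j j' : ℕ} (h : j ≤ j') (ν : ℤ) :
    (haarPos K j j' ν : ℝ) / 2 ^ j' = centre K j ν := by
  rw [centre_eq_int_div hK, haarPos]
  obtain ⟨k, rfl⟩ := Nat.exists_eq_add_of_le h
  push_cast
  rw [show j + k - j = k by omega, pow_add]
  field_simp

lemma bumpPairing_term_le {K L : ℕ} (hK : 1 ≤ K) {ψ : ℝ → ℝ} {η : ℝ} (hψi : Integrable ψ)
    (hi : Integrable (fun t => ψ t - oddStep t)) (hη : (∫ t, |ψ t - oddStep t|) ≤ η)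
    {j₀ j' : ℕ} (h₀ : j₀ ≤ j') (h₁ : j' ≤ j₀ + L) (ν₀ : ℕ) (j m ν : ℕ) (hm : L ≤ m) :
    (∫ t, ψ (2 ^ (j + m) * (t - centre K j (ν:ℤ))) * haarReal j' (haarPos K j₀ j' ν₀) t) ≤
      ((2:ℝ) ^ (j + m))⁻¹ * (-(if j = j₀ then (if ν = ν₀ then 1 / 2 else 0) else 0) +
        (if j = j' + K then (if (ν:ℤ) = haarPos K j₀ j' ν₀ then 1 else 0) else 0) + η) := by
  refine (integral_scaled_mul_haarReal_le hψi hi hη j' (j + m) _ _).trans ?_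
  have hp : (0:ℝ) < ((2:ℝ) ^ (j + m))⁻¹ := by positivity
  rw [mul_add, mul_comm η]
  refine add_le_add ?_ le_rfl
  have e2 : ((2:ℝ) * 2 ^ (j + m))⁻¹ = ((2:ℝ) ^ (j + m))⁻¹ * (1 / 2) := by
    rw [mul_inv]; ring
  have hne : j' + K ≠ j₀ := by omega
  by_cases hc : j = j₀ ∧ ν = ν₀
  · obtain ⟨rfl, rfl⟩ := hc
    rw [← haarPos_div hK h₀, haarTent_second_difference_left _ _ (by positivity), e2]
    · simp only [if_true]
      rw [if_neg (by omega)]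
      linarith
    · rw [e2]
      have : ((2:ℝ) ^ (j + m))⁻¹ ≤ ((2:ℝ) ^ j')⁻¹ :=
        inv_anti₀ (by positivity) (pow_le_pow_right₀ (by norm_num) (by omega))
      linarith
  · have hz : (if j = j₀ then (if ν = ν₀ then (1 / 2 : ℝ) else 0) else 0) = 0 := by
      split_ifs with h1 h2
      · exact absurd ⟨h1, h2⟩ hc
      · rfl
      · rfl
    rw [hz, neg_zero, zero_add]
    by_cases hd : j = j' + K ∧ (ν:ℤ) = haarPos K j₀ j' ν₀
    · rw [if_pos hd.1, if_pos hd.2]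
      refine (haarTent_second_difference_le _ _ _ (by positivity)).trans ?_
      rw [e2]; linarith
    · have hz2 : (if j = j' + K then (if (ν:ℤ) = haarPos K j₀ j' ν₀ then (1:ℝ) else 0) else 0)
          = 0 := by
        split_ifs with h1 h2
        · exact absurd ⟨h1, h2⟩ hd
        · rfl
        · rfl
      rw [hz2, mul_zero, centre_eq_int_div hK]
      refine haarTent_second_difference_dyadic (by omega) _ _ fun h => hd ?_
      rw [← centre_eq_int_div hK] at h
      exact centre_eq_midpoint h

lemma bumpPairing_le {q : ℝ} (hq : 0 < q) {K L : ℕ} (hK : 1 ≤ K) {ψ : ℝ → ℝ} {η : ℝ} (hη0 : 0 ≤ η)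
    (hψi : Integrable ψ)
    (hi : Integrable (fun t => ψ t - oddStep t)) (hη : (∫ t, |ψ t - oddStep t|) ≤ η)
    {A : Finset ℕ} {j₀ j' : ℕ} (hj₀ : j₀ ∈ A) (h₀ : j₀ ≤ j') (h₁ : j' ≤ j₀ + L) {ν₀ : ℕ}
    (hν₀ : ν₀ < 2 ^ j₀) :
    bumpPairing q K L A ψ j' (haarPos K j₀ j' ν₀) ≤
      L * (-(1 / 2) * (2:ℝ) ^ (-((j₀:ℝ) / q)) + (2:ℝ) ^ (-(((j' + K : ℕ):ℝ) / q)) +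
        η * ∑ j ∈ A, (2:ℝ) ^ (j:ℝ)) := by
  set μ := haarPos K j₀ j' ν₀ with hμ
  have hν : ∀ j m : ℕ, L ≤ m → (∑ ν ∈ Finset.range (2 ^ j),
      ∫ t, ψ (2 ^ (j + m) * (t - centre K j (ν:ℤ))) * haarReal j' μ t) ≤
      ((2:ℝ) ^ (j + m))⁻¹ * (-(if j = j₀ then 1 / 2 else 0) + (if j = j' + K then 1 else 0) +
        η * 2 ^ j) := by
    intro j m hm
    refine (Finset.sum_le_sum fun ν _ =>
      bumpPairing_term_le hK hψi hi hη h₀ h₁ ν₀ j m ν hm).trans ?_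
    rw [← Finset.mul_sum]
    refine mul_le_mul_of_nonneg_left ?_ (by positivity)
    rw [Finset.sum_add_distrib, Finset.sum_add_distrib, Finset.sum_neg_distrib]
    refine add_le_add (add_le_add (neg_le_neg ?_) ?_) ?_
    · split_ifs with h
      · subst h
        simp [hν₀]
      · simp
    · split_ifs with h
      · rw [Finset.sum_ite, Finset.sum_const_zero, add_zero, Finset.sum_const, nsmul_eq_mul,
          mul_one]
        have : (Finset.filter (fun x : ℕ => (x:ℤ) = μ) (Finset.range (2 ^ j))).card ≤ 1 := by
          refine Finset.card_le_one.2 fun a ha b hb => ?_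
          have h1 := (Finset.mem_filter.1 ha).2
          have h2 := (Finset.mem_filter.1 hb).2
          omega
        exact_mod_cast this
      · simp
    · simp [mul_comm]
  have hm : ∀ j : ℕ, (∑ m ∈ Finset.Ico L (2 * L), (2:ℝ) ^ m *
      ∑ ν ∈ Finset.range (2 ^ j), ∫ t, ψ (2 ^ (j + m) * (t - centre K j (ν:ℤ))) *
        haarReal j' μ t) ≤
      L * (((2:ℝ) ^ j)⁻¹ * (-(if j = j₀ then 1 / 2 else 0) + (if j = j' + K then 1 else 0) +
        η * 2 ^ j)) := by
    intro j
    have : ∀ m ∈ Finset.Ico L (2 * L), (2:ℝ) ^ m *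
      (∑ ν ∈ Finset.range (2 ^ j), ∫ t, ψ (2 ^ (j + m) * (t - centre K j (ν:ℤ))) *
        haarReal j' μ t) ≤
      ((2:ℝ) ^ j)⁻¹ * (-(if j = j₀ then 1 / 2 else 0) + (if j = j' + K then 1 else 0) +
        η * 2 ^ j) := by
      intro m hm
      refine (mul_le_mul_of_nonneg_left (hν j m (Finset.mem_Ico.1 hm).1) (by positivity)).trans ?_
      rw [← mul_assoc, pow_add]
      apply le_of_eq
      congr 1
      field_simp
    refine (Finset.sum_le_sum this).trans ?_
    rw [Finset.sum_const, Nat.card_Ico, nsmul_eq_mul, show 2 * L - L = L by omega]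
  have hpow : ∀ j : ℕ, (2:ℝ) ^ ((j:ℝ) * (1 - 1 / q)) * ((2:ℝ) ^ j)⁻¹ = 2 ^ (-((j:ℝ) / q)) := by
    intro j
    rw [← rpow_natCast, ← rpow_neg (by norm_num), ← rpow_add (by norm_num)]
    congr 1; ring
  unfold bumpPairing
  refine (Finset.sum_le_sum fun j _ => mul_le_mul_of_nonneg_left (hm j) (by positivity)).trans ?_
  have e : ∀ j : ℕ, (2:ℝ) ^ ((j:ℝ) * (1 - 1 / q)) * (L * (((2:ℝ) ^ j)⁻¹ *
      (-(if j = j₀ then 1 / 2 else 0) + (if j = j' + K then 1 else 0) + η * 2 ^ j))) =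
      L * (-(if j = j₀ then 1 / 2 * (2:ℝ) ^ (-((j:ℝ) / q)) else 0) +
        (if j = j' + K then (2:ℝ) ^ (-((j:ℝ) / q)) else 0) +
        η * (2:ℝ) ^ ((j:ℝ) * (1 - 1 / q))) := by
    intro j
    have hh := hpow j
    have h2 : ((2:ℝ) ^ j)⁻¹ * 2 ^ j = 1 := by field_simp
    rw [← hh]
    split_ifs <;> linear_combination (L * η * (2:ℝ) ^ ((j:ℝ) * (1 - 1 / q))) * h2
  rw [Finset.sum_congr rfl fun j _ => e j, ← Finset.mul_sum]
  refine mul_le_mul_of_nonneg_left ?_ (by positivity)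
  rw [Finset.sum_add_distrib, Finset.sum_add_distrib, Finset.sum_neg_distrib, ← Finset.mul_sum]
  refine add_le_add (add_le_add ?_ ?_) (mul_le_mul_of_nonneg_left ?_ hη0)
  · rw [Finset.sum_ite_eq' A j₀, if_pos hj₀]
    linarith
  · rw [Finset.sum_ite_eq' A (j' + K)]
    split_ifs
    · exact le_rfl
    · positivity
  · refine Finset.sum_le_sum fun j _ => rpow_le_rpow_of_exponent_le (by norm_num) ?_
    exact mul_le_of_le_one_right (by positivity) (by linarith [one_div_pos.2 hq])

/-- The rescaled copies of a bump centred at `centre K j ν`. -/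
def bumpAtom (K : ℕ) (ψ : ℝ → ℝ) (j m ν : ℕ) (t : ℝ) : ℂ :=
  ((ψ (2 ^ (j + m) * (t - centre K j (ν:ℤ))) : ℝ) : ℂ)

lemma isDyadicAtom_bumpAtom (K : ℕ) {ψ : ℝ → ℝ} (hc : Continuous ψ) (h1 : ∀ t, |ψ t| ≤ 1)
    (hz : ∀ t, 1 / 2 < |t| → ψ t = 0) (hodd : ∀ t, ψ (-t) = -ψ t) (j m ν : ℕ) :
    IsDyadicAtom (j + m) (centre K j (ν:ℤ)) (bumpAtom K ψ j m ν) where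
  measurable := by
    unfold bumpAtom
    fun_prop
  norm_le t := by
    unfold bumpAtom
    rw [Complex.norm_real]
    exact h1 _
  eq_zero t ht := by
    unfold bumpAtom
    rw [hz, Complex.ofReal_zero]
    rw [abs_mul, abs_of_pos (by positivity)]
    have : (1:ℝ) < 2 ^ (j + m) * |t - centre K j (ν:ℤ)| := by
      rwa [inv_lt_iff_one_lt_mul₀' (by positivity)] at ht
    linarith
  integral_eq_zero := by
    unfold bumpAtom
    rw [integral_complex_ofReal, integral_comp_mul_sub ψ (by positivity)]
    have : (∫ t, ψ t) = 0 := by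
      have h := integral_neg_eq_self ψ volume
      simp_rw [hodd, integral_neg] at h
      linarith
    rw [this]
    simp

lemma contDiff_atomSum_bumpAtom (q : ℝ) (K L : ℕ) (A : Finset ℕ) {ψ : ℝ → ℝ}
    (hs : ContDiff ℝ (⊤ : ℕ∞) ψ) : ContDiff ℝ (⊤ : ℕ∞) (atomSum q L A (bumpAtom K ψ)) := by
  unfold atomSum
  refine ContDiff.sum fun j _ => contDiff_const.mul (ContDiff.sum fun m _ =>
    contDiff_const.mul (ContDiff.sum fun ν _ => contDiff_const.mul ?_))
  unfold bumpAtom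
  exact Complex.ofRealCLM.contDiff.comp (hs.comp (by fun_prop))

lemma abs_centre_le {K j ν : ℕ} (h : ν < 2 ^ j) : |centre K j (ν:ℤ)| ≤ 2 ^ K := by
  unfold centre
  rw [abs_of_nonneg (by push_cast; positivity), div_le_iff₀ (by positivity)]
  refine mul_le_mul_of_nonneg_left ?_ (by positivity)
  have : (ν:ℝ) + 1 ≤ 2 ^ j := by exact_mod_cast h
  push_cast
  linarith

lemma hasCompactSupport_atomSum_bumpAtom (q : ℝ) (K L : ℕ) (A : Finset ℕ) {ψ : ℝ → ℝ}
    (hz : ∀ t, 1 / 2 < |t| → ψ t = 0) : HasCompactSupport (atomSum q L A (bumpAtom K ψ)) := by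
  refine HasCompactSupport.intro (isCompact_Icc (a := -((2:ℝ) ^ K + 1)) (b := 2 ^ K + 1))
    fun t ht => ?_
  unfold atomSum
  refine Finset.sum_eq_zero fun j _ => mul_eq_zero_of_right _ (Finset.sum_eq_zero fun m _ =>
    mul_eq_zero_of_right _ (Finset.sum_eq_zero fun ν hν => ?_))
  rw [one_mul, bumpAtom, hz, Complex.ofReal_zero]
  have h1 : (2:ℝ) ^ K + 1 < |t| := by
    by_contra hcon
    exact ht (abs_le.1 (not_lt.1 hcon))
  have h2 := abs_centre_le (K := K) (Finset.mem_range.1 hν)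
  have h3 : 1 < |t - centre K j (ν:ℤ)| := by
    have := abs_sub_abs_le_abs_sub t (centre K j (ν:ℤ))
    linarith
  rw [abs_mul, abs_of_pos (by positivity)]
  have h4 : (1:ℝ) ≤ 2 ^ (j + m) := one_le_pow₀ (by norm_num)
  nlinarith

lemma integral_atomSum_mul_haarFn (q : ℝ) (K L : ℕ) (A : Finset ℕ) {ψ : ℝ → ℝ}
    (hψi : Integrable ψ) (j' : ℕ) (μ : ℤ) :
    (∫ t, atomSum q L A (bumpAtom K ψ) t * haarFn j' μ t) =
      (bumpPairing q K L A ψ j' μ : ℂ) := by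
  have hs : ∀ (l : ℕ) (y : ℝ), Integrable (fun t => ψ (2 ^ l * (t - y)) * haarReal j' μ t) :=
    fun l y => integrable_mul_haarReal
      ((hψi.comp_mul_left' (by positivity : (2:ℝ) ^ l ≠ 0)).comp_sub_right y) j' μ
  have e : ∀ t, atomSum q L A (bumpAtom K ψ) t * haarFn j' μ t =
      ((∑ j ∈ A, (2:ℝ) ^ ((j:ℝ) * (1 - 1 / q)) * ∑ m ∈ Finset.Ico L (2 * L), (2:ℝ) ^ m *
        ∑ ν ∈ Finset.range (2 ^ j), ψ (2 ^ (j + m) * (t - centre K j (ν:ℤ))) *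
          haarReal j' μ t : ℝ) : ℂ) := by
    intro t
    rw [haarFn_eq_ofReal, atomSum]
    simp only [bumpAtom]
    push_cast
    simp only [one_mul, Finset.sum_mul, mul_assoc]
  simp_rw [e]
  rw [integral_complex_ofReal]
  congr 1
  unfold bumpPairing
  rw [integral_finsetSum]
  · refine Finset.sum_congr rfl fun j _ => ?_
    rw [integral_const_mul, integral_finsetSum]
    · congr 1
      refine Finset.sum_congr rfl fun m _ => ?_
      rw [integral_const_mul, integral_finsetSum]
      exact fun ν _ => hs _ _
    · exact fun m _ => (integrable_finsetSum _ fun ν _ => hs _ _).const_mul _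
  · exact fun j _ => (integrable_finsetSum _ fun m _ =>
      (integrable_finsetSum _ fun ν _ => hs _ _).const_mul _).const_mul _

/-- Pairs of levels of `A` at distance at most `L`. -/
def closePairs (A : Finset ℕ) (L : ℕ) : Finset (ℕ × ℕ) :=
  (A ×ˢ A).filter fun p => p.1 ≤ p.2 ∧ p.2 ≤ p.1 + L

/-- The indices of the Haar functions supported to the right of the centres of the bumps. -/
def haarIndex (K : ℕ) (i : (_ : ℕ × ℕ) × ℕ) : ℕ × ℤ := (i.1.2, haarPos K i.1.1 i.1.2 i.2)

/-- Parameters of the Haar functions paired with the bumps at levels in `A`. -/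
def haarParams (A : Finset ℕ) (L : ℕ) : Finset ((_ : ℕ × ℕ) × ℕ) :=
  (closePairs A L).sigma fun p => Finset.range (2 ^ p.1)

lemma mem_haarParams {A : Finset ℕ} {L : ℕ} {i : (_ : ℕ × ℕ) × ℕ} :
    i ∈ haarParams A L ↔ ((i.1.1 ∈ A ∧ i.1.2 ∈ A) ∧ i.1.1 ≤ i.1.2 ∧ i.1.2 ≤ i.1.1 + L) ∧
      i.2 < 2 ^ i.1.1 := by
  simp [haarParams, closePairs]

lemma haarIndex_injOn (K L : ℕ) (A : Finset ℕ) :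
    Set.InjOn (haarIndex K) (haarParams A L : Set ((_ : ℕ × ℕ) × ℕ)) := by
  rintro ⟨⟨j, j'⟩, ν⟩ hi ⟨⟨k, k'⟩, ν'⟩ hk h
  have hi := (mem_haarParams.1 (Finset.mem_coe.1 hi)).1.2.1
  have hk := (mem_haarParams.1 (Finset.mem_coe.1 hk)).1.2.1
  simp only [haarIndex, haarPos, Prod.mk.injEq] at h hi hk
  obtain ⟨rfl, h⟩ := h
  have h2 := two_pow_mul_odd_inj
    (mul_left_cancel₀ (by positivity : (2:ℤ) ^ (K - 1) ≠ 0) h)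
  have h3 : j = k := by omega
  have h4 : ν = ν' := by omega
  subst h3 h4
  rfl

lemma isSeparated_image_haarIndex {K L : ℕ} {A : Finset ℕ}
    (hA : ∀ j ∈ A, ∀ j' ∈ A, j % K = j' % K) :
    IsSeparated K ((haarParams A L).image (haarIndex K)) where
  level e he e' he' hne := by
    obtain ⟨i, hi, rfl⟩ := Finset.mem_image.1 he
    obtain ⟨i', hi', rfl⟩ := Finset.mem_image.1 he'
    have h := hA _ (mem_haarParams.1 hi).1.1.2 _ (mem_haarParams.1 hi').1.1.2
    simp only [haarIndex] at hne ⊢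
    have hd : (K:ℤ) ∣ (i'.1.2:ℤ) - i.1.2 := (Nat.modEq_iff_dvd (n := K)).1 h
    have := Int.natAbs_dvd_natAbs.2 hd
    exact Nat.le_of_dvd (by omega) (by simpa using this)
  position e he e' he' hne hlev := by
    obtain ⟨i, hi, rfl⟩ := Finset.mem_image.1 he
    obtain ⟨i', hi', rfl⟩ := Finset.mem_image.1 he'
    have hne2 : haarPos K i'.1.1 i'.1.2 i'.2 ≠ haarPos K i.1.1 i.1.2 i.2 := fun h =>
      hne (Prod.ext hlev h.symm)
    simp only [haarIndex]
    have e1 : ((haarPos K i'.1.1 i'.1.2 i'.2 : ℤ) : ℝ) - (haarPos K i.1.1 i.1.2 i.2 : ℤ) =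
        2 ^ (K - 1) * (((2 ^ (i'.1.2 - i'.1.1) * (2 * i'.2 + 1) -
          2 ^ (i.1.2 - i.1.1) * (2 * i.2 + 1) : ℤ)) : ℝ) := by
      simp only [haarPos]; push_cast; ring
    rw [e1, abs_mul, abs_of_pos (by positivity : (0:ℝ) < 2 ^ (K - 1))]
    refine le_mul_of_one_le_right (by positivity) ?_
    have : (1:ℤ) ≤ |2 ^ (i'.1.2 - i'.1.1) * (2 * (i'.2:ℤ) + 1) -
          2 ^ (i.1.2 - i.1.1) * (2 * (i.2:ℤ) + 1)| := by
      refine Int.one_le_abs fun h => hne2 ?_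
      simp only [haarPos]
      rw [sub_eq_zero.1 h]
    exact_mod_cast this

lemma exists_schwartz_haar_coefficients {q : ℝ} (hq : 1 < q) {K : ℕ} (hK : 1 ≤ K)
    (hKq : (2:ℝ) ^ (-((K:ℝ) / q)) ≤ 1 / 4) {L : ℕ} (hL : 1 ≤ L) {A : Finset ℕ}
    (hA : A.Nonempty) (hmod : ∀ j ∈ A, ∀ j' ∈ A, j % K = j' % K) :
    ∃ (E : Finset (ℕ × ℤ)) (f : SchwartzMap ℝ ℂ) (a : ℕ → ℕ → ℕ → ℝ → ℂ),
      (f : ℝ → ℂ) = atomSum q L A a ∧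
      (∀ j ∈ A, ∀ m ν : ℕ, IsDyadicAtom (j + m) (centre K j ν) (a j m ν)) ∧
      IsSeparated K E ∧ (∀ e ∈ E, |(e.2:ℝ) / 2 ^ e.1| ≤ 2 ^ K) ∧ HFset E ⊆ A ∧ f ≠ 0 ∧
      ((L:ℝ) / 8) ^ q * (closePairs A L).card ≤ ∑ e ∈ E, ((2:ℝ) ^ e.1)⁻¹ *
        ((2:ℝ) ^ (-((e.1:ℝ) * (1 - 1 / q))) *
          ‖(2:ℂ) ^ e.1 * ∫ y : ℝ, f y * haarFn e.1 e.2 y‖) ^ q := by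
  have hq0 : 0 < q := by linarith
  have hL0 : (0:ℝ) < L := by exact_mod_cast hL
  set M := A.max' hA with hM
  set S := ∑ j ∈ A, (2:ℝ) ^ (j:ℝ) with hS
  have hS0 : 0 < S := Finset.sum_pos (fun j _ => by positivity) hA
  set η := 1 / 8 * (2:ℝ) ^ (-((M:ℝ) / q)) / S with hηd
  have hη0 : 0 < η := by positivity
  obtain ⟨ψ, hψs, hψ1, hψz, hψo, hψi, hψη⟩ := exists_contDiff_near_oddStep hη0
  have hψcs : HasCompactSupport ψ := by
    refine HasCompactSupport.intro (isCompact_Icc (a := -(1 / 2 : ℝ)) (b := 1 / 2))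
      fun t ht => hψz t ?_
    by_contra hcon
    exact ht (abs_le.1 (not_lt.1 hcon))
  have hψint : Integrable ψ := hψs.continuous.integrable_of_hasCompactSupport hψcs
  set f : SchwartzMap ℝ ℂ := (hasCompactSupport_atomSum_bumpAtom q K L A hψz).toSchwartzMap
    (contDiff_atomSum_bumpAtom q K L A hψs) with hf
  have hfe : (f : ℝ → ℂ) = atomSum q L A (bumpAtom K ψ) := rfl
  have hco : ∀ i ∈ haarParams A L, (L:ℝ) / 8 * (2:ℝ) ^ (-((i.1.1:ℝ) / q)) ≤
      ‖∫ y : ℝ, f y * haarFn (haarIndex K i).1 (haarIndex K i).2 y‖ := by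
    intro i hi
    obtain ⟨⟨⟨h1, h2⟩, h3, h4⟩, h5⟩ := mem_haarParams.1 hi
    rw [hfe, integral_atomSum_mul_haarFn q K L A hψint, Complex.norm_real]
    have hb := bumpPairing_le hq0 hK hη0.le hψint hψi hψη (A := A) h1 h3 h4 h5
    have hx : (0:ℝ) < (2:ℝ) ^ (-((i.1.1:ℝ) / q)) := by positivity
    have hk : (2:ℝ) ^ (-(((i.1.2 + K : ℕ):ℝ) / q)) ≤ 1 / 4 * (2:ℝ) ^ (-((i.1.1:ℝ) / q)) := by
      have e1 : (2:ℝ) ^ (-(((i.1.2 + K : ℕ):ℝ) / q)) =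
          (2:ℝ) ^ (-((K:ℝ) / q)) * (2:ℝ) ^ (-((i.1.2:ℝ) / q)) := by
        rw [← rpow_add (by norm_num)]; congr 1; push_cast; ring
      rw [e1]
      refine mul_le_mul hKq (rpow_le_rpow_of_exponent_le (by norm_num) (neg_le_neg ?_))
        (by positivity) (by norm_num)
      exact div_le_div_of_nonneg_right (by exact_mod_cast h3) hq0.le
    have he : η * S ≤ 1 / 8 * (2:ℝ) ^ (-((i.1.1:ℝ) / q)) := by
      rw [hηd, div_mul_cancel₀ _ hS0.ne']
      refine mul_le_mul_of_nonneg_left (rpow_le_rpow_of_exponent_le (by norm_num)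
        (neg_le_neg ?_)) (by norm_num)
      exact div_le_div_of_nonneg_right (by exact_mod_cast A.le_max' _ h1) hq0.le
    have hfin : bumpPairing q K L A ψ i.1.2 (haarPos K i.1.1 i.1.2 i.2) ≤
        L * (-(1 / 8) * (2:ℝ) ^ (-((i.1.1:ℝ) / q))) :=
      hb.trans (mul_le_mul_of_nonneg_left (by linarith) hL0.le)
    refine le_trans ?_ (neg_le_abs _)
    simp only [haarIndex]
    linarith
  refine ⟨(haarParams A L).image (haarIndex K), f, bumpAtom K ψ, hfe,
    fun j _ m ν => isDyadicAtom_bumpAtom K hψs.continuous hψ1 hψz hψo j m ν,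
    isSeparated_image_haarIndex hmod, ?_, ?_, ?_, ?_⟩
  · intro e he
    obtain ⟨i, hi, rfl⟩ := Finset.mem_image.1 he
    obtain ⟨-, h3, h4⟩ := (mem_haarParams.1 hi).1
    simp only [haarIndex]
    rw [haarPos_div hK h3]
    exact abs_centre_le (mem_haarParams.1 hi).2
  · intro j hj
    obtain ⟨e, he, rfl⟩ := Finset.mem_image.1 hj
    obtain ⟨i, hi, rfl⟩ := Finset.mem_image.1 he
    exact (mem_haarParams.1 hi).1.1.2
  · intro h0
    obtain ⟨j, hj⟩ := hA
    have hi : (⟨(j, j), 0⟩ : (_ : ℕ × ℕ) × ℕ) ∈ haarParams A L :=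
      mem_haarParams.2 ⟨⟨⟨hj, hj⟩, le_rfl, Nat.le_add_right _ _⟩, by positivity⟩
    have h1 := hco _ hi
    rw [h0] at h1
    simp only [zero_apply, zero_mul, integral_zero, norm_zero] at h1
    have h2 : (0:ℝ) < (L:ℝ) / 8 * (2:ℝ) ^ (-((j:ℝ) / q)) := by positivity
    linarith
  · rw [Finset.sum_image (haarIndex_injOn K L A), haarParams, Finset.sum_sigma]
    have hpair : ∀ p ∈ closePairs A L, ((L:ℝ) / 8) ^ q ≤ ∑ ν ∈ Finset.range (2 ^ p.1),
        ((2:ℝ) ^ (haarIndex K ⟨p, ν⟩).1)⁻¹ *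
        ((2:ℝ) ^ (-(((haarIndex K ⟨p, ν⟩).1:ℝ) * (1 - 1 / q))) *
          ‖(2:ℂ) ^ (haarIndex K ⟨p, ν⟩).1 * ∫ y : ℝ, f y *
            haarFn (haarIndex K ⟨p, ν⟩).1 (haarIndex K ⟨p, ν⟩).2 y‖) ^ q := by
      intro p hp
      have hν : ∀ ν ∈ Finset.range (2 ^ p.1), ((L:ℝ) / 8) ^ q * ((2:ℝ) ^ p.1)⁻¹ ≤
        ((2:ℝ) ^ (haarIndex K ⟨p, ν⟩).1)⁻¹ *
        ((2:ℝ) ^ (-(((haarIndex K ⟨p, ν⟩).1:ℝ) * (1 - 1 / q))) *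
          ‖(2:ℂ) ^ (haarIndex K ⟨p, ν⟩).1 * ∫ y : ℝ, f y *
            haarFn (haarIndex K ⟨p, ν⟩).1 (haarIndex K ⟨p, ν⟩).2 y‖) ^ q := by
        intro ν hν
        have h1 := hco ⟨p, ν⟩ (Finset.mem_sigma.2 ⟨hp, hν⟩)
        rw [norm_mul]
        generalize ‖∫ y : ℝ, f y *
            haarFn (haarIndex K ⟨p, ν⟩).1 (haarIndex K ⟨p, ν⟩).2 y‖ = X at h1
        simp only [haarIndex] at *
        have e1 : (2:ℝ) ^ (-((p.2:ℝ) * (1 - 1 / q))) * (‖(2:ℂ) ^ p.2‖ * X) =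
            (2:ℝ) ^ ((p.2:ℝ) / q) * X := by
          rw [norm_pow, Complex.norm_ofNat, ← mul_assoc, ← rpow_natCast,
            ← rpow_add (by norm_num)]
          congr 2; ring
        have h2 : (2:ℝ) ^ ((p.2:ℝ) / q) * ((L:ℝ) / 8 * (2:ℝ) ^ (-((p.1:ℝ) / q))) ≤
            (2:ℝ) ^ ((p.2:ℝ) / q) * X := mul_le_mul_of_nonneg_left h1 (by positivity)
        have h3 := rpow_le_rpow (by positivity) h2 hq0.le
        have e2 : ∀ x : ℝ, ((2:ℝ) ^ (x / q)) ^ q = 2 ^ x := by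
          intro x
          rw [← rpow_mul (by norm_num)]; congr 1; field_simp
        have e3 : ((2:ℝ) ^ ((p.2:ℝ) / q) * ((L:ℝ) / 8 * (2:ℝ) ^ (-((p.1:ℝ) / q)))) ^ q =
            2 ^ p.2 * (((L:ℝ) / 8) ^ q * ((2:ℝ) ^ p.1)⁻¹) := by
          rw [mul_rpow (by positivity) (by positivity),
            mul_rpow (by positivity) (by positivity), e2, ← neg_div, e2,
            rpow_neg (by norm_num), rpow_natCast, rpow_natCast]
        rw [e1]
        rw [e3] at h3
        rwa [le_inv_mul_iff₀ (by positivity)]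
      refine le_trans ?_ (Finset.sum_le_sum hν)
      rw [Finset.sum_const, Finset.card_range, nsmul_eq_mul]
      push_cast
      apply le_of_eq
      field_simp
    refine le_trans ?_ (Finset.sum_le_sum hpair)
    rw [Finset.sum_const, nsmul_eq_mul, mul_comm]

/-- The elements of `A` in the same block of length `L` and the same class modulo `K` as `n`. -/
def blockClass (A : Finset ℕ) (K L n : ℕ) : Finset ℕ :=
  A.filter fun j => j / L = n / L ∧ j % K = n % K

lemma card_close_le_blockClass (A : Finset ℕ) {K L : ℕ} (hK : 1 ≤ K) (hL : 1 ≤ L) (n : ℕ) :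
    (A.filter fun j => (j ≤ n + 4 * L ∧ n ≤ j + 4 * L) ∧
      (blockClass A K L j).card ≤ (blockClass A K L n).card).card ≤
      (blockClass A K L n).card * (9 * K) := by
  have hcard : ((Finset.Icc (n / L - 4) (n / L + 4)) ×ˢ Finset.range K).card ≤ 9 * K := by
    rw [Finset.card_product, Finset.card_range, Nat.card_Icc]
    exact Nat.mul_le_mul_right _ (by omega)
  refine le_trans (Finset.card_le_mul_card_image_of_maps_to
    (f := fun j : ℕ => (j / L, j % K))
    (t := (Finset.Icc (n / L - 4) (n / L + 4)) ×ˢ Finset.range K) ?_ _ ?_)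
    (Nat.mul_le_mul_left _ hcard)
  · intro j hj
    obtain ⟨-, ⟨h1, h2⟩, -⟩ := Finset.mem_filter.1 hj
    have h3 := Nat.div_le_div_right (c := L) h1
    have h4 := Nat.div_le_div_right (c := L) h2
    rw [Nat.add_mul_div_right _ _ (by omega)] at h3 h4
    simp only [Finset.mem_product, Finset.mem_Icc, Finset.mem_range]
    exact ⟨⟨tsub_le_iff_right.2 h4, h3⟩, Nat.mod_lt _ (by omega)⟩
  · intro b _
    rcases Finset.eq_empty_or_nonempty (((A.filter fun j => (j ≤ n + 4 * L ∧ n ≤ j + 4 * L) ∧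
      (blockClass A K L j).card ≤ (blockClass A K L n).card).filter
        fun j : ℕ => (j / L, j % K) = b)) with h | ⟨i, hi⟩
    · rw [h]; simp
    · obtain ⟨hi1, hi2⟩ := Finset.mem_filter.1 hi
      refine le_trans (Finset.card_le_card ?_) (Finset.mem_filter.1 hi1).2.2
      intro j hj
      obtain ⟨hj1, hj2⟩ := Finset.mem_filter.1 hj
      have := hj2.trans hi2.symm
      simp only [Prod.mk.injEq] at this
      exact Finset.mem_filter.2 ⟨(Finset.mem_filter.1 hj1).1, this⟩

lemma card_pairs_eq_sum (A : Finset ℕ) (P : ℕ → ℕ → Prop) [∀ n j, Decidable (P n j)] :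
    ((A ×ˢ A).filter fun p => P p.1 p.2).card = ∑ n ∈ A, (A.filter fun j => P n j).card := by
  rw [Finset.card_filter, Finset.sum_product]
  simp_rw [Finset.card_filter]

lemma card_pairs_le_of_symm (A : Finset ℕ) (P Q : ℕ → ℕ → Prop) [∀ n j, Decidable (P n j)]
    [∀ n j, Decidable (Q n j)] (hP : ∀ n j, P n j → P j n) (hQ : ∀ n j, Q n j ∨ Q j n) :
    ((A ×ˢ A).filter fun p => P p.1 p.2).card ≤
      2 * ((A ×ˢ A).filter fun p => P p.1 p.2 ∧ Q p.1 p.2).card := by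
  have hsub : ((A ×ˢ A).filter fun p => P p.1 p.2) ⊆
      ((A ×ˢ A).filter fun p => P p.1 p.2 ∧ Q p.1 p.2) ∪
      (((A ×ˢ A).filter fun p => P p.1 p.2 ∧ Q p.1 p.2).image Prod.swap) := by
    rintro ⟨n, j⟩ h
    obtain ⟨h1, h2⟩ := Finset.mem_filter.1 h
    obtain ⟨h3, h4⟩ := Finset.mem_product.1 h1
    rcases hQ n j with h5 | h5
    · exact Finset.mem_union_left _ (Finset.mem_filter.2 ⟨h1, h2, h5⟩)
    · refine Finset.mem_union_right _ (Finset.mem_image.2 ⟨(j, n), ?_, rfl⟩)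
      exact Finset.mem_filter.2 ⟨Finset.mem_product.2 ⟨h4, h3⟩, hP _ _ h2, h5⟩
  refine (Finset.card_le_card hsub).trans ((Finset.card_union_le _ _).trans ?_)
  have := Finset.card_image_le (f := Prod.swap)
    (s := (A ×ˢ A).filter fun p => P p.1 p.2 ∧ Q p.1 p.2)
  omega

lemma exists_residue_closePairs {A : Finset ℕ} (hA : A.Nonempty) {K L Z : ℕ} (hK : 1 ≤ K)
    (hL : 1 ≤ L)
    (hZ : ∀ n ∈ A, Z ≤ (A.filter fun j => j ≤ n + 4 * L ∧ n ≤ j + 4 * L).card) :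
    ∃ r : ℕ, (A.filter fun j => j % K = r).Nonempty ∧
      A.card * Z ≤ 36 * K ^ 2 * (closePairs (A.filter fun j => j % K = r) L).card := by
  set T := ∑ n ∈ A, (blockClass A K L n).card with hT
  have h1 : A.card * Z ≤ 18 * K * T := by
    calc A.card * Z = ∑ n ∈ A, Z := by rw [Finset.sum_const, smul_eq_mul]
      _ ≤ ∑ n ∈ A, (A.filter fun j => j ≤ n + 4 * L ∧ n ≤ j + 4 * L).card :=
          Finset.sum_le_sum hZ
      _ = ((A ×ˢ A).filter fun p => p.2 ≤ p.1 + 4 * L ∧ p.1 ≤ p.2 + 4 * L).card :=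
          (card_pairs_eq_sum A fun n j => j ≤ n + 4 * L ∧ n ≤ j + 4 * L).symm
      _ ≤ 2 * ((A ×ˢ A).filter fun p => (p.2 ≤ p.1 + 4 * L ∧ p.1 ≤ p.2 + 4 * L) ∧
            (blockClass A K L p.2).card ≤ (blockClass A K L p.1).card).card :=
          card_pairs_le_of_symm A (fun n j => j ≤ n + 4 * L ∧ n ≤ j + 4 * L)
            (fun n j => (blockClass A K L j).card ≤ (blockClass A K L n).card)
            (fun n j h => ⟨h.2, h.1⟩) (fun n j => le_total _ _)
      _ = 2 * ∑ n ∈ A, (A.filter fun j => (j ≤ n + 4 * L ∧ n ≤ j + 4 * L) ∧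
            (blockClass A K L j).card ≤ (blockClass A K L n).card).card := by
          rw [card_pairs_eq_sum A fun n j => (j ≤ n + 4 * L ∧ n ≤ j + 4 * L) ∧
            (blockClass A K L j).card ≤ (blockClass A K L n).card]
      _ ≤ 2 * ∑ n ∈ A, (blockClass A K L n).card * (9 * K) :=
          Nat.mul_le_mul_left _ (Finset.sum_le_sum fun n _ => card_close_le_blockClass A hK hL n)
      _ = _ := by rw [← Finset.sum_mul]; ring
  have h2 : T ≤ 2 * ∑ r ∈ Finset.range K, (closePairs (A.filter fun j => j % K = r) L).card := by
    calc T = ((A ×ˢ A).filter fun p => p.2 / L = p.1 / L ∧ p.2 % K = p.1 % K).card :=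
          (card_pairs_eq_sum A fun n j => j / L = n / L ∧ j % K = n % K).symm
      _ ≤ 2 * ((A ×ˢ A).filter fun p => (p.2 / L = p.1 / L ∧ p.2 % K = p.1 % K) ∧
            p.1 ≤ p.2).card :=
          card_pairs_le_of_symm A (fun n j => j / L = n / L ∧ j % K = n % K) (fun n j => n ≤ j)
            (fun n j h => ⟨h.1.symm, h.2.symm⟩) (fun n j => le_total _ _)
      _ ≤ 2 * ((Finset.range K).biUnion
            fun r => closePairs (A.filter fun j => j % K = r) L).card := by
          refine Nat.mul_le_mul_left _ (Finset.card_le_card ?_)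
          rintro ⟨n, j⟩ h
          obtain ⟨h1, ⟨h2, h3⟩, h4⟩ := Finset.mem_filter.1 h
          obtain ⟨h5, h6⟩ := Finset.mem_product.1 h1
          simp only at h2 h3 h4 h5 h6
          refine Finset.mem_biUnion.2 ⟨n % K, Finset.mem_range.2 (Nat.mod_lt _ (by omega)), ?_⟩
          refine Finset.mem_filter.2 ⟨Finset.mem_product.2
            ⟨Finset.mem_filter.2 ⟨h5, rfl⟩, Finset.mem_filter.2 ⟨h6, h3⟩⟩, h4, ?_⟩
          simp only
          have e1 := Nat.div_add_mod j L
          have e2 := Nat.div_add_mod n L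
          have e3 := Nat.mod_lt j (by omega : L > 0)
          rw [h2] at e1
          omega
      _ ≤ _ := Nat.mul_le_mul_left _ Finset.card_biUnion_le
  have hTpos : A.card ≤ T := by
    rw [Finset.card_eq_sum_ones]
    exact Finset.sum_le_sum fun n hn =>
      Finset.card_pos.2 ⟨n, Finset.mem_filter.2 ⟨hn, rfl, rfl⟩⟩
  obtain ⟨r, -, hr⟩ := Finset.exists_max_image (Finset.range K)
    (fun r => (closePairs (A.filter fun j => j % K = r) L).card) ⟨0, Finset.mem_range.2 hK⟩
  have h3 : T ≤ 2 * (K * (closePairs (A.filter fun j => j % K = r) L).card) := by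
    refine h2.trans (Nat.mul_le_mul_left _ ((Finset.sum_le_sum hr).trans ?_))
    rw [Finset.sum_const, Finset.card_range, smul_eq_mul]
  refine ⟨r, ?_, ?_⟩
  · rw [Finset.nonempty_iff_ne_empty]
    intro h0
    rw [h0] at h3
    have := hA.card_pos
    simp [closePairs] at h3
    omega
  · calc A.card * Z ≤ 18 * K * T := h1
      _ ≤ 18 * K * (2 * (K * (closePairs (A.filter fun j => j % K = r) L).card)) :=
          Nat.mul_le_mul_left _ h3
      _ = _ := by ring

lemma endpoint_constant_le {q C κ N L n Z P K : ℝ} (hq : 1 < q) (hC : 0 < C) (hκ : 0 < κ)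
    (hN : 0 ≤ N) (hL : 0 < L) (hNL : N ≤ 4 * L) (hn : 0 ≤ n) (hZ : 0 ≤ Z) (hP : 0 ≤ P)
    (hK : 1 ≤ K) (h : n * Z ≤ 36 * K ^ 2 * P) :
    κ / (32 * C * (36 * K ^ 2)) * N ^ (1 - 1 / q) * Z ^ (1 / q) * (C * (L * n) ^ (1 / q)) ≤
      κ * ((L / 8) ^ q * P) ^ (1 / q) := by
  have hq0 : 0 < q := by linarith
  have hi0 : 0 < 1 / q := by positivity
  have hi1 : 1 / q < 1 := by rw [div_lt_one hq0]; exact hq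
  set D := 36 * K ^ 2 with hD
  have hD1 : 1 ≤ D := by nlinarith
  clear_value D
  have h1 : N ^ (1 - 1 / q) ≤ 4 * L ^ (1 - 1 / q) := by
    calc N ^ (1 - 1 / q) ≤ (4 * L) ^ (1 - 1 / q) := rpow_le_rpow hN hNL (by linarith)
      _ = 4 ^ (1 - 1 / q) * L ^ (1 - 1 / q) := mul_rpow (by norm_num) hL.le
      _ ≤ 4 ^ (1:ℝ) * L ^ (1 - 1 / q) := mul_le_mul_of_nonneg_right
          (rpow_le_rpow_of_exponent_le (by norm_num) (by linarith)) (by positivity)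
      _ = _ := by rw [rpow_one]
  have h2 : (n * Z) ^ (1 / q) ≤ D * P ^ (1 / q) := by
    calc (n * Z) ^ (1 / q) ≤ (D * P) ^ (1 / q) := rpow_le_rpow (by positivity) h hi0.le
      _ = D ^ (1 / q) * P ^ (1 / q) := mul_rpow (by linarith) hP
      _ ≤ D ^ (1:ℝ) * P ^ (1 / q) := mul_le_mul_of_nonneg_right
          (rpow_le_rpow_of_exponent_le hD1 hi1.le) (by positivity)
      _ = _ := by rw [rpow_one]
  have hLL : L ^ (1 - 1 / q) * L ^ (1 / q) = L := by
    rw [← rpow_add hL]; simp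
  have eR : ((L / 8) ^ q * P) ^ (1 / q) = L / 8 * P ^ (1 / q) := by
    rw [mul_rpow (by positivity) hP, ← rpow_mul (by positivity), mul_one_div_cancel hq0.ne',
      rpow_one]
  rw [eR, mul_rpow hL.le hn]
  rw [mul_rpow hn hZ] at h2
  have hD0 : 0 < D := by linarith
  calc κ / (32 * C * D) * N ^ (1 - 1 / q) * Z ^ (1 / q) * (C * (L ^ (1 / q) * n ^ (1 / q)))
      = κ / (32 * D) * L ^ (1 / q) * N ^ (1 - 1 / q) * (n ^ (1 / q) * Z ^ (1 / q)) := by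
        field_simp
    _ ≤ κ / (32 * D) * L ^ (1 / q) * (4 * L ^ (1 - 1 / q)) * (D * P ^ (1 / q)) :=
        mul_le_mul (mul_le_mul_of_nonneg_left h1 (by positivity)) h2 (by positivity)
          (by positivity)
    _ = κ / 8 * (L ^ (1 - 1 / q) * L ^ (1 / q)) * P ^ (1 / q) := by field_simp; ring
    _ = _ := by rw [hLL]; ring

lemma logb_card_lt {n : ℕ} (hn : n ≠ 0) :
    Real.logb 2 (n:ℝ) ≤ 4 * ((Nat.log 2 n / 4 + 1 : ℕ):ℝ) := by
  have h1 : (n:ℝ) ≤ 2 ^ (4 * (Nat.log 2 n / 4 + 1)) := by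
    have h2 : n < 2 ^ (Nat.log 2 n + 1) := Nat.lt_pow_succ_log_self (by norm_num) n
    have h3 : 2 ^ (Nat.log 2 n + 1) ≤ 2 ^ (4 * (Nat.log 2 n / 4 + 1)) :=
      Nat.pow_le_pow_right (by norm_num) (by omega)
    exact_mod_cast (h2.le.trans h3)
  rw [Real.logb_le_iff_le_rpow (by norm_num) (by positivity)]
  exact_mod_cast h1

/-- Endpoint lower bound, $1<q<p<\infty$: for every finite $A\subset\mathbb N$ with
$\#A\ge2$ there are $E$ with $\mathrm{HF}(E)\subseteq A$ and a nonzero Schwartz $f$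
with $\|P_E f\|_{F^{-1+1/q}_{p,q}}\ge c(\log_2\#A)^{1-1/q}\check{\mathcal Z}(A)^{1/q}\|f\|$. -/
theorem haar_projection_endpoint_lower_bound
    (p q : ℝ) (hq : 1 < q) (hqp : q < p)
    (φ₀ : ℝ → ℂ) (hφsmooth : ContDiff ℝ (⊤ : ℕ∞) φ₀) (hφcpt : HasCompactSupport φ₀)
    (hφone : ∀ ξ : ℝ, |ξ| ≤ 4/3 → φ₀ ξ = 1)
    (hφzero : ∀ ξ : ℝ, 3/2 ≤ |ξ| → φ₀ ξ = 0) :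
    ∃ c : ℝ, 0 < c ∧ ∀ (A : Finset ℕ) (hA : 2 ≤ A.card),
      ∃ E : Finset (ℕ × ℤ), HFset E ⊆ A ∧
      ∃ f : SchwartzMap ℝ ℂ, f ≠ 0 ∧
        ENNReal.ofReal (c * (Real.logb 2 (A.card : ℝ))^(1 - 1/q) *
            ((Zlow A (Finset.card_pos.mp (by omega)) : ℝ))^(1/q)) *
          FNorm φ₀ p q (-1 + 1/q) f ≤
          FNorm φ₀ p q (-1 + 1/q) (haarProj E f) := by
  have hq0 : 0 < q := by linarith
  obtain ⟨K₀, hK₀⟩ := exists_FNorm_haarSum_ge hq hqp hφsmooth hφcpt hφone hφzero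
  set K := max K₀ (max 1 ⌈2 * q⌉₊) with hKd
  have hK1 : 1 ≤ K := (le_max_left _ _).trans (le_max_right _ _)
  have hKq : (2:ℝ) ^ (-((K:ℝ) / q)) ≤ 1 / 4 := by
    have h1 : 2 * q ≤ K := (Nat.le_ceil _).trans
      (by exact_mod_cast (le_max_right 1 _).trans (le_max_right K₀ _))
    have h2 : 2 ≤ (K:ℝ) / q := by rw [le_div_iff₀ hq0]; exact h1
    calc (2:ℝ) ^ (-((K:ℝ) / q)) ≤ (2:ℝ) ^ (-(2:ℝ)) :=
          rpow_le_rpow_of_exponent_le (by norm_num) (by linarith)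
      _ = 1 / 4 := by rw [rpow_neg (by norm_num), rpow_two]; norm_num
  obtain ⟨κ, hκ, hlow⟩ := hK₀ K (le_max_left _ _)
  obtain ⟨C, hC, hup⟩ := exists_FNorm_atomSum_le hq hqp hφsmooth hφcpt K
  refine ⟨κ / (32 * C * (36 * (K:ℝ) ^ 2)), by positivity, fun A hA => ?_⟩
  have hAne : A.Nonempty := Finset.card_pos.mp (by omega)
  set L := Nat.log 2 A.card / 4 + 1 with hL
  have hL1 : 1 ≤ L := by omega
  have hNL : Real.logb 2 (A.card:ℝ) ≤ 4 * (L:ℝ) := logb_card_lt (by omega)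
  have hN0 : 0 ≤ Real.logb 2 (A.card:ℝ) :=
    Real.logb_nonneg (by norm_num) (by exact_mod_cast (by omega : 1 ≤ A.card))
  have hpow : 2 ^ (2 * L) ≤ 4 * A.card := by
    calc 2 ^ (2 * L) ≤ 2 ^ (2 + Nat.log 2 A.card) :=
          Nat.pow_le_pow_right (by norm_num) (by omega)
      _ = 4 * 2 ^ Nat.log 2 A.card := by rw [pow_add]; norm_num
      _ ≤ _ := Nat.mul_le_mul_left _ (Nat.pow_log_le_self 2 (by omega))
  have hZ : ∀ n ∈ A, Zlow A hAne ≤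
      (A.filter fun j => j ≤ n + 4 * L ∧ n ≤ j + 4 * L).card := by
    intro n hn
    refine (Finset.inf'_le _ hn).trans (Finset.card_le_card fun j hj => ?_)
    obtain ⟨h1, h2⟩ := Finset.mem_filter.1 hj
    obtain ⟨h3, h4⟩ := abs_le.1 (h2.trans hNL)
    refine Finset.mem_filter.2 ⟨h1, ?_, ?_⟩
    · have : (j:ℝ) ≤ n + 4 * L := by linarith
      exact_mod_cast this
    · have : (n:ℝ) ≤ j + 4 * L := by linarith
      exact_mod_cast this
  obtain ⟨r, hrne, hr⟩ := exists_residue_closePairs hAne hK1 hL1 hZ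
  set B := A.filter fun j => j % K = r with hB
  obtain ⟨E, f, a, hfa, hat, hsep, hbd, hHF, hf0, hco⟩ :=
    exists_schwartz_haar_coefficients hq hK1 hKq hL1 hrne fun j hj j' hj' =>
      (Finset.mem_filter.1 hj).2.trans (Finset.mem_filter.1 hj').2.symm
  refine ⟨E, hHF.trans (Finset.filter_subset _ _), f, hf0, ?_⟩
  have hF := hup L A.card B a hL1 (by omega)
    (Finset.card_le_card (Finset.filter_subset _ _)) hpow hat
  rw [← hfa] at hF
  have hP := hlow E (fun e => (2:ℂ) ^ e.1 * ∫ y : ℝ, f y * haarFn e.1 e.2 y) hsep hbd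
  refine le_trans ?_ hP
  refine (mul_le_mul_right hF _).trans ?_
  rw [← ENNReal.ofReal_mul (by positivity)]
  refine ENNReal.ofReal_le_ofReal (le_trans (endpoint_constant_le hq hC hκ hN0
    (by exact_mod_cast hL1) hNL (by positivity) (by positivity)
    (P := ((closePairs B L).card : ℝ)) (by positivity) (by exact_mod_cast hK1)
    (by exact_mod_cast hr)) ?_)
  refine mul_le_mul_of_nonneg_left (rpow_le_rpow (by positivity) hco (by positivity)) hκ.le
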